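/- Let h : 𝕋ⁿ → ℝ be smooth. The L²(𝕋ⁿ)-adjoint of the operator B(h) is given by B(h)*χ = G(h)(χ/(1+|∇h|²)) − div( (χ/(1+|∇h|²)) ∇h ); that is, for all smooth ψ, χ : 𝕋ⁿ → ℝ, ∫_{𝕋ⁿ} (B(h)ψ)(x) χ(x) dx = ∫_{𝕋ⁿ} ψ(x) [ G(h)(χ/(1+|∇h|²)) − div( (χ/(1+|∇h|²)) ∇h ) ](x) dx. -/

import Mathlib

open MeasureTheory
open scoped Classical

noncomputable section

/-- ℤⁿ-periodicity for functions on ℝⁿ (model for functions on the torus 𝕋ⁿ = ℝⁿ/ℤⁿ). -/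
def ZPeriodic (n : ℕ) (f : (Fin n → ℝ) → ℝ) : Prop :=
  ∀ (x : Fin n → ℝ) (k : Fin n → ℤ), f (x + fun i => (k i : ℝ)) = f x

/-- ℤⁿ-periodicity in the horizontal variable for functions on ℝⁿ × ℝ. -/
def ZPeriodicE (n : ℕ) (φ : (Fin n → ℝ) × ℝ → ℝ) : Prop :=
  ∀ (x : Fin n → ℝ) (y : ℝ) (k : Fin n → ℤ), φ (x + fun i => (k i : ℝ), y) = φ (x, y)

/-- Fundamental cell of the torus 𝕋ⁿ. -/
def cell (n : ℕ) : Set (Fin n → ℝ) := Set.univ.pi fun _ => Set.Ico (0:ℝ) 1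

/-- i-th partial derivative of a function on ℝⁿ. -/
def pdX (n : ℕ) (f : (Fin n → ℝ) → ℝ) (i : Fin n) (x : Fin n → ℝ) : ℝ :=
  fderiv ℝ f x (Pi.single i 1)

/-- Directional derivative of a function on ℝⁿ × ℝ. -/
def pdE (n : ℕ) (φ : (Fin n → ℝ) × ℝ → ℝ) (v : (Fin n → ℝ) × ℝ)
    (p : (Fin n → ℝ) × ℝ) : ℝ := fderiv ℝ φ p v

def eX (n : ℕ) (i : Fin n) : (Fin n → ℝ) × ℝ := (Pi.single i 1, 0)
def eY (n : ℕ) : (Fin n → ℝ) × ℝ := (0, 1)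

/-- Laplacian Δ_{x,y} on ℝⁿ × ℝ. -/
def lapE (n : ℕ) (φ : (Fin n → ℝ) × ℝ → ℝ) (p : (Fin n → ℝ) × ℝ) : ℝ :=
  (∑ i, pdE n (pdE n φ (eX n i)) (eX n i) p) + pdE n (pdE n φ (eY n)) (eY n) p

/-- |∇_{x,y}φ|². -/
def gradSqE (n : ℕ) (φ : (Fin n → ℝ) × ℝ → ℝ) (p : (Fin n → ℝ) × ℝ) : ℝ :=
  (∑ i, (pdE n φ (eX n i) p)^2) + (pdE n φ (eY n) p)^2

/-- One periodic cell of the fluid domain Ω(h) = {y < h(x)}. -/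
def fluidCell (n : ℕ) (h : (Fin n → ℝ) → ℝ) : Set ((Fin n → ℝ) × ℝ) :=
  {p | p.1 ∈ cell n ∧ p.2 < h p.1}

/-- φ is the harmonic extension of ψ to Ω(h) = {y < h(x)}: it is harmonic in Ω(h),
has boundary value ψ, is periodic in x, and has square-integrable gradient. -/
structure IsHarmonicExt (n : ℕ) (h ψ : (Fin n → ℝ) → ℝ)
    (φ : (Fin n → ℝ) × ℝ → ℝ) : Prop where
  smooth : ContDiff ℝ (⊤ : ℕ∞) φ
  periodic : ZPeriodicE n φ
  harmonic : ∀ p : (Fin n → ℝ) × ℝ, p.2 < h p.1 → lapE n φ p = 0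
  boundary : ∀ x, φ (x, h x) = ψ x
  gradL2 : IntegrableOn (gradSqE n φ) (fluidCell n h)

/-- The Dirichlet-to-Neumann operator:
(G(h)ψ)(x) = ∂_yφ(x,h(x)) − ∇h(x)·∇_xφ(x,h(x)), where φ is the harmonic extension of ψ. -/
def DtN (n : ℕ) (h ψ : (Fin n → ℝ) → ℝ) : (Fin n → ℝ) → ℝ :=
  if H : ∃ φ, IsHarmonicExt n h ψ φ then
    fun x => pdE n H.choose (eY n) (x, h x)
      - ∑ i, pdX n h i x * pdE n H.choose (eX n i) (x, h x)
  else 0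

/-- (B(h)ψ)(x) = ∂_yφ(x,h(x)). -/
def Bop (n : ℕ) (h ψ : (Fin n → ℝ) → ℝ) : (Fin n → ℝ) → ℝ :=
  if H : ∃ φ, IsHarmonicExt n h ψ φ then
    fun x => pdE n H.choose (eY n) (x, h x)
  else 0

/-- (V(h)ψ)(x) = ∇_xφ(x,h(x)). -/
def Vop (n : ℕ) (h ψ : (Fin n → ℝ) → ℝ) : (Fin n → ℝ) → Fin n → ℝ :=
  if H : ∃ φ, IsHarmonicExt n h ψ φ then
    fun x i => pdE n H.choose (eX n i) (x, h x)
  else 0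

/-- Divergence of a vector field on the torus. -/
def divX (n : ℕ) (W : (Fin n → ℝ) → Fin n → ℝ) (x : Fin n → ℝ) : ℝ :=
  ∑ i, pdX n (fun z => W z i) i x

/-- h is a smooth solution of the Hele-Shaw equation ∂ₜh + G(h)h = 0 on [0,T]. -/
structure IsHeleShawSol (n : ℕ) (T : ℝ) (h : ℝ → (Fin n → ℝ) → ℝ) : Prop where
  smooth : ContDiff ℝ (⊤ : ℕ∞) (Function.uncurry h)
  periodic : ∀ t : ℝ, ZPeriodic n (h t)
  extension : ∀ t ∈ Set.Icc 0 T, ∃ φ, IsHarmonicExt n (h t) (h t) φ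
  equation : ∀ t ∈ Set.Icc 0 T, ∀ x, deriv (fun s => h s x) t + DtN n (h t) (h t) x = 0

/-- B(t,x) = (B(h(t,·))h(t,·))(x). -/
def HSB (n : ℕ) (h : ℝ → (Fin n → ℝ) → ℝ) (t : ℝ) (x : Fin n → ℝ) : ℝ :=
  Bop n (h t) (h t) x

/-- V(t,x) = (V(h(t,·))h(t,·))(x). -/
def HSV (n : ℕ) (h : ℝ → (Fin n → ℝ) → ℝ) (t : ℝ) (x : Fin n → ℝ) : Fin n → ℝ :=
  Vop n (h t) (h t) x

/-- The Rayleigh–Taylor coefficient a = 1 − B. -/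
def HSa (n : ℕ) (h : ℝ → (Fin n → ℝ) → ℝ) (t : ℝ) (x : Fin n → ℝ) : ℝ :=
  1 - HSB n h t x

/-- γ = (1+|∇h|²)⁻¹ ( G(h)(B²+|V|²) − 2B G(h)B − 2V·G(h)V ). -/
def HSgamma (n : ℕ) (h : ℝ → (Fin n → ℝ) → ℝ) (t : ℝ) (x : Fin n → ℝ) : ℝ :=
  (1 + ∑ i, (pdX n (h t) i x)^2)⁻¹ *
    ( DtN n (h t) (fun z => (HSB n h t z)^2 + ∑ i, (HSV n h t z i)^2) x
      - 2 * HSB n h t x * DtN n (h t) (fun z => HSB n h t z) x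
      - 2 * ∑ i, HSV n h t x i * DtN n (h t) (fun z => HSV n h t z i) x )

/-- L(h)f = −V·∇f − ½(div V)f + √a G(h)(√a f). -/
def Lop (n : ℕ) (h : ℝ → (Fin n → ℝ) → ℝ) (t : ℝ) (f : (Fin n → ℝ) → ℝ)
    (x : Fin n → ℝ) : ℝ :=
  - (∑ i, HSV n h t x i * pdX n f i x)
  - (1/2) * divX n (HSV n h t) x * f x
  + Real.sqrt (HSa n h t x) * DtN n (h t) (fun z => Real.sqrt (HSa n h t z) * f z) x



/-! ### Weights and rapid decay -/

/-- Polynomial weight on the dual lattice. -/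
def wt {n : ℕ} (k : Fin n → ℤ) : ℝ := 1 + ∑ i, |(k i : ℝ)|

lemma wt_one_le {n : ℕ} (k : Fin n → ℤ) : 1 ≤ wt k := by
  unfold wt
  have : 0 ≤ ∑ i, |(k i : ℝ)| := Finset.sum_nonneg fun i _ => abs_nonneg _
  linarith

lemma wt_pos {n : ℕ} (k : Fin n → ℤ) : 0 < wt k := lt_of_lt_of_le one_pos (wt_one_le k)

lemma abs_le_wt {n : ℕ} (k : Fin n → ℤ) (i : Fin n) : |(k i : ℝ)| ≤ wt k := by
  unfold wt
  have := Finset.single_le_sum (f := fun i => |(k i : ℝ)|) (fun i _ => abs_nonneg _)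
    (Finset.mem_univ i)
  linarith

lemma one_add_abs_le_wt {n : ℕ} (k : Fin n → ℤ) (i : Fin n) : 1 + |(k i : ℝ)| ≤ wt k := by
  unfold wt
  have := Finset.single_le_sum (f := fun i => |(k i : ℝ)|) (fun i _ => abs_nonneg _)
    (Finset.mem_univ i)
  linarith

lemma wt_add_le {n : ℕ} (k l : Fin n → ℤ) : wt (k + l) ≤ wt k * wt l := by
  unfold wt
  have h0 : 0 ≤ ∑ i, |(k i : ℝ)| := Finset.sum_nonneg fun i _ => abs_nonneg _
  have h1 : 0 ≤ ∑ i, |(l i : ℝ)| := Finset.sum_nonneg fun i _ => abs_nonneg _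
  have h2 : ∑ i, |((k + l) i : ℝ)| ≤ ∑ i, |(k i : ℝ)| + ∑ i, |(l i : ℝ)| := by
    rw [← Finset.sum_add_distrib]
    refine Finset.sum_le_sum fun i _ => ?_
    simp only [Pi.add_apply, Int.cast_add]
    exact abs_add_le _ _
  nlinarith [mul_nonneg h0 h1]

lemma wt_sub_le {n : ℕ} (k l : Fin n → ℤ) : wt k ≤ wt l * wt (k - l) := by
  have := wt_add_le l (k - l)
  rwa [add_sub_cancel] at this

lemma summable_int_wt : Summable (fun j : ℤ => (1 + |(j : ℝ)|)⁻¹ ^ 2) := by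
  have h : Summable (fun j : ℕ => (1 + (j : ℝ))⁻¹ ^ 2) := by
    have := (summable_nat_add_iff 1).mpr (Real.summable_nat_pow_inv.mpr (one_lt_two))
    refine this.congr fun j => ?_
    push_cast
    rw [inv_pow, add_comm]
  refine Summable.of_nat_of_neg ?_ ?_
  · exact h.congr fun j => by simp
  · exact h.congr fun j => by simp

lemma summable_wt (n : ℕ) : Summable (fun k : Fin n → ℤ => (wt k)⁻¹ ^ (2 * n)) := by
  refine summable_of_sum_le (c := (∑' j : ℤ, (1 + |(j : ℝ)|)⁻¹ ^ 2) ^ n)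
    (fun k => by have := wt_pos k; positivity) fun s => ?_
  have h1 : ∀ k : Fin n → ℤ, (wt k)⁻¹ ^ (2 * n) ≤ ∏ i, (1 + |(k i : ℝ)|)⁻¹ ^ 2 := by
    intro k
    rw [pow_mul]
    calc ((wt k)⁻¹ ^ 2) ^ n = ∏ _i : Fin n, (wt k)⁻¹ ^ 2 := by simp
      _ ≤ _ := by
        refine Finset.prod_le_prod (fun i _ => by positivity) fun i _ => ?_
        have h0 : 0 ≤ |(k i : ℝ)| := abs_nonneg _
        have := one_add_abs_le_wt k i
        have := wt_pos k
        gcongr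
  let t : Fin n → Finset ℤ := fun i => s.image fun k => k i
  calc ∑ k ∈ s, (wt k)⁻¹ ^ (2 * n) ≤ ∑ k ∈ s, ∏ i, (1 + |(k i : ℝ)|)⁻¹ ^ 2 :=
        Finset.sum_le_sum fun k _ => h1 k
    _ ≤ ∑ k ∈ Fintype.piFinset t, ∏ i, (1 + |(k i : ℝ)|)⁻¹ ^ 2 := by
        refine Finset.sum_le_sum_of_subset_of_nonneg ?_ fun k _ _ => by positivity
        intro k hk
        rw [Fintype.mem_piFinset]
        intro i
        exact Finset.mem_image_of_mem (fun k : Fin n → ℤ => k i) hk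
    _ = ∏ i, ∑ j ∈ t i, (1 + |(j : ℝ)|)⁻¹ ^ 2 :=
        (Finset.prod_univ_sum t (fun _ j => (1 + |(j : ℝ)|)⁻¹ ^ 2)).symm
    _ ≤ ∏ _i : Fin n, (∑' j : ℤ, (1 + |(j : ℝ)|)⁻¹ ^ 2) := by
        refine Finset.prod_le_prod (fun i _ => Finset.sum_nonneg fun j _ => by positivity)
          fun i _ => ?_
        exact summable_int_wt.sum_le_tsum _ fun j _ => by positivity
    _ = _ := by simp

/-- Rapid decay. -/
def RD {n : ℕ} {E : Type*} [Norm E] (f : (Fin n → ℤ) → E) : Prop :=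
  ∀ s : ℕ, ∃ C : ℝ, ∀ k, ‖f k‖ * wt k ^ s ≤ C

lemma le_of_mul_wt {n : ℕ} {a C : ℝ} {k : Fin n → ℤ} {s : ℕ} (h : a * wt k ^ s ≤ C) :
    a ≤ C * (wt k)⁻¹ ^ s := by
  have := wt_pos k
  rw [inv_pow, ← div_eq_mul_inv, le_div_iff₀ (by positivity)]
  exact h

lemma RD.summable_norm_mul {n : ℕ} {E : Type*} [SeminormedAddCommGroup E] {f : (Fin n → ℤ) → E}
    (hf : RD f) (s : ℕ) : Summable fun k => ‖f k‖ * wt k ^ s := by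
  obtain ⟨C, hC⟩ := hf (s + 2 * n)
  refine Summable.of_nonneg_of_le (fun k => by have := wt_pos k; positivity) (fun k => ?_)
    ((summable_wt n).mul_left C)
  apply le_of_mul_wt
  rw [mul_assoc, ← pow_add]
  exact hC k

lemma RD.summable_norm {n : ℕ} {E : Type*} [SeminormedAddCommGroup E] {f : (Fin n → ℤ) → E}
    (hf : RD f) : Summable fun k => ‖f k‖ := by
  simpa using hf.summable_norm_mul 0

/-- Uniform rapid decay on a set of times. -/
def RDu {n : ℕ} (S : Set ℝ) (f : (Fin n → ℤ) → ℝ → ℂ) : Prop :=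
  ∀ s : ℕ, ∃ C : ℝ, ∀ k, ∀ t ∈ S, ‖f k t‖ * wt k ^ s ≤ C

lemma RDu.exists_nonneg {n : ℕ} {S : Set ℝ} {f : (Fin n → ℤ) → ℝ → ℂ} (hf : RDu S f) (s : ℕ) :
    ∃ C : ℝ, 0 ≤ C ∧ ∀ k, ∀ t ∈ S, ‖f k t‖ * wt k ^ s ≤ C := by
  obtain ⟨C, hC⟩ := hf s
  exact ⟨max C 0, le_max_right _ _, fun k t ht => (hC k t ht).trans (le_max_left _ _)⟩

lemma RDu.exists_bound {n : ℕ} {S : Set ℝ} {f : (Fin n → ℤ) → ℝ → ℂ} (hf : RDu S f) :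
    ∃ u : (Fin n → ℤ) → ℝ, (∀ s : ℕ, Summable fun k => u k * wt k ^ s) ∧ (∀ k, 0 ≤ u k) ∧
      ∀ k, ∀ t ∈ S, ‖f k t‖ ≤ u k := by
  choose C hC0 hC using hf.exists_nonneg
  refine ⟨fun k => ⨆ t : S, ‖f k t‖, fun s => ?_, fun k => Real.iSup_nonneg fun t => norm_nonneg _,
    fun k t ht => ?_⟩
  · refine Summable.of_nonneg_of_le (fun k => ?_) (fun k => ?_)
      ((summable_wt n).mul_left (C (s + 2 * n)))
    · have := wt_pos k
      have : 0 ≤ ⨆ t : S, ‖f k t‖ := Real.iSup_nonneg fun t => norm_nonneg _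
      positivity
    · apply le_of_mul_wt
      rw [mul_assoc, ← pow_add]
      have hp : 0 < wt k ^ (s + 2 * n) := by have := wt_pos k; positivity
      rw [← le_div_iff₀ hp]
      refine Real.iSup_le (fun t => ?_) (div_nonneg (hC0 _) hp.le)
      rw [le_div_iff₀ hp]
      exact hC _ k t t.2
  · refine le_ciSup (f := fun t : S => ‖f k t‖) ⟨C 0, ?_⟩ ⟨t, ht⟩
    rintro _ ⟨t, rfl⟩
    simpa using hC 0 k t t.2

lemma RDu.summable {n : ℕ} {S : Set ℝ} {f : (Fin n → ℤ) → ℝ → ℂ} (hf : RDu S f) {t : ℝ}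
    (ht : t ∈ S) : Summable fun k => ‖f k t‖ := by
  obtain ⟨u, hu, -, hb⟩ := hf.exists_bound
  exact Summable.of_nonneg_of_le (fun k => norm_nonneg _) (fun k => hb k t ht) (by simpa using hu 0)

lemma RDu.add {n : ℕ} {S : Set ℝ} {f g : (Fin n → ℤ) → ℝ → ℂ} (hf : RDu S f) (hg : RDu S g) :
    RDu S (fun k t => f k t + g k t) := by
  intro s
  obtain ⟨C, hC⟩ := hf s
  obtain ⟨D, hD⟩ := hg s
  refine ⟨C + D, fun k t ht => ?_⟩
  have := wt_pos k
  calc _ ≤ (‖f k t‖ + ‖g k t‖) * wt k ^ s := by gcongr; exact norm_add_le _ _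
    _ ≤ _ := by rw [add_mul]; exact add_le_add (hC k t ht) (hD k t ht)

/-- multiplication by a polynomially bounded symbol -/
lemma RDu.mul_symbol {n : ℕ} {S : Set ℝ} {f : (Fin n → ℤ) → ℝ → ℂ} (hf : RDu S f)
    (m : (Fin n → ℤ) → ℂ) (A : ℝ) (r : ℕ) (hm : ∀ k, ‖m k‖ ≤ A * wt k ^ r) :
    RDu S (fun k t => m k * f k t) := by
  intro s
  obtain ⟨C, hC0, hC⟩ := hf.exists_nonneg (r + s)
  have hA : 0 ≤ A := by
    have := (norm_nonneg _).trans (hm 0)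
    have h2 := wt_pos (0 : Fin n → ℤ)
    by_contra h
    push Not at h
    have : A * wt (0 : Fin n → ℤ) ^ r < 0 := mul_neg_of_neg_of_pos h (by positivity)
    linarith
  refine ⟨A * C, fun k t ht => ?_⟩
  have := wt_pos k
  calc ‖m k * f k t‖ * wt k ^ s = ‖m k‖ * (‖f k t‖ * wt k ^ s) := by rw [norm_mul]; ring
    _ ≤ (A * wt k ^ r) * (‖f k t‖ * wt k ^ s) := by gcongr; exact hm k
    _ = A * (‖f k t‖ * wt k ^ (r + s)) := by rw [pow_add]; ring
    _ ≤ A * C := by gcongr; exact hC k t ht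

/-- Convolution in the frequency variable. -/
def conv {n : ℕ} (β : (Fin n → ℤ) → ℂ) (f : (Fin n → ℤ) → ℝ → ℂ) : (Fin n → ℤ) → ℝ → ℂ :=
  fun k t => ∑' l, β l * f (k - l) t

lemma RDu.conv_bound {n : ℕ} {S : Set ℝ} {f : (Fin n → ℤ) → ℝ → ℂ} (hf : RDu S f)
    {β : (Fin n → ℤ) → ℂ} (hβ : RD β) (s : ℕ) :
    ∃ C, 0 ≤ C ∧ ∀ k l, ∀ t ∈ S, ‖β l * f (k - l) t‖ * wt k ^ s ≤ C * (‖β l‖ * wt l ^ s) := by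
  obtain ⟨C, hC0, hC⟩ := hf.exists_nonneg s
  refine ⟨C, hC0, fun k l t ht => ?_⟩
  have := wt_pos k
  have := wt_pos l
  have := wt_pos (k - l)
  calc ‖β l * f (k - l) t‖ * wt k ^ s
      ≤ ‖β l * f (k - l) t‖ * (wt l * wt (k - l)) ^ s := by gcongr; exact wt_sub_le k l
    _ = (‖β l‖ * wt l ^ s) * (‖f (k - l) t‖ * wt (k - l) ^ s) := by
        rw [norm_mul, mul_pow]; ring
    _ ≤ (‖β l‖ * wt l ^ s) * C := by gcongr; exact hC _ t ht
    _ = _ := by ring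

lemma RDu.conv_summable {n : ℕ} {S : Set ℝ} {f : (Fin n → ℤ) → ℝ → ℂ} (hf : RDu S f)
    {β : (Fin n → ℤ) → ℂ} (hβ : RD β) (k : Fin n → ℤ) {t : ℝ} (ht : t ∈ S) :
    Summable fun l => ‖β l * f (k - l) t‖ := by
  obtain ⟨C, hC0, hC⟩ := hf.conv_bound hβ 0
  refine Summable.of_nonneg_of_le (fun _ => norm_nonneg _) (fun l => ?_)
    ((hβ.summable_norm).mul_left C)
  simpa using hC k l t ht

lemma RDu.conv {n : ℕ} {S : Set ℝ} {f : (Fin n → ℤ) → ℝ → ℂ} (hf : RDu S f)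
    {β : (Fin n → ℤ) → ℂ} (hβ : RD β) : RDu S (conv β f) := by
  intro s
  obtain ⟨C, hC0, hC⟩ := hf.conv_bound hβ s
  refine ⟨C * ∑' l, ‖β l‖ * wt l ^ s, fun k t ht => ?_⟩
  have hk : 0 < wt k ^ s := by have := wt_pos k; positivity
  rw [← le_div_iff₀ hk]
  refine (norm_tsum_le_tsum_norm (hf.conv_summable hβ k ht)).trans ?_
  rw [le_div_iff₀ hk, ← tsum_mul_right, ← tsum_mul_left]
  exact ((hf.conv_summable hβ k ht).mul_right _).tsum_le_tsum (fun l => hC k l t ht)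
    ((hβ.summable_norm_mul s).mul_left C)

/-! ### Convolution operators on `ℓ²(ℤⁿ; G)` -/

section absM
variable {n : ℕ} {A : Type*} [NormedRing A] [NormedAlgebra ℂ A] [CompleteSpace A]

/-- convolution of coefficient sequences -/
def cvs (β γ : (Fin n → ℤ) → ℂ) : (Fin n → ℤ) → ℂ := fun k => ∑' l, β l * γ (k - l)

/-- abstract operator `∑ β_l S_l` -/
def Mab (S : (Fin n → ℤ) → A) (β : (Fin n → ℤ) → ℂ) : A := ∑' l, β l • S l

lemma Mab_summable_norm {S : (Fin n → ℤ) → A} (hS : ∀ l, ‖S l‖ ≤ 1)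
    {β : (Fin n → ℤ) → ℂ} (hβ : Summable fun l => ‖β l‖) :
    Summable fun l => ‖β l • S l‖ := by
  refine Summable.of_nonneg_of_le (fun _ => norm_nonneg _) (fun l => ?_) hβ
  rw [norm_smul]
  exact mul_le_of_le_one_right (norm_nonneg _) (hS l)

lemma Mab_hasSum {S : (Fin n → ℤ) → A} (hS : ∀ l, ‖S l‖ ≤ 1)
    {β : (Fin n → ℤ) → ℂ} (hβ : Summable fun l => ‖β l‖) :
    HasSum (fun l => β l • S l) (Mab S β) :=
  (Mab_summable_norm hS hβ).of_norm.hasSum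

lemma Mab_mul {S : (Fin n → ℤ) → A} (hS : ∀ l, ‖S l‖ ≤ 1) (hmul : ∀ l m, S l * S m = S (l + m))
    {β γ : (Fin n → ℤ) → ℂ} (hβ : Summable fun l => ‖β l‖)
    (hγ : Summable fun l => ‖γ l‖) :
    Mab S β * Mab S γ = Mab S (cvs β γ) := by
  unfold Mab
  rw [tsum_mul_tsum_of_summable_norm (Mab_summable_norm hS hβ) (Mab_summable_norm hS hγ)]
  have hs := summable_mul_of_summable_norm (Mab_summable_norm hS hβ) (Mab_summable_norm hS hγ)
  let e : (Fin n → ℤ) × (Fin n → ℤ) ≃ (Fin n → ℤ) × (Fin n → ℤ) :=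
    { toFun := fun p => (p.2, p.1 - p.2)
      invFun := fun p => (p.1 + p.2, p.1)
      left_inv := fun p => by ext i <;> simp
      right_inv := fun p => by ext i <;> simp }
  rw [← e.tsum_eq]
  have hs' := e.summable_iff.mpr hs
  have hsc : Summable fun p : (Fin n → ℤ) × (Fin n → ℤ) => β p.2 * γ (p.1 - p.2) :=
    e.summable_iff.mpr (summable_mul_of_summable_norm hβ hγ)
  rw [Summable.tsum_prod (f := fun c => β (e c).1 • S (e c).1 * γ (e c).2 • S (e c).2) hs']
  refine tsum_congr fun k => ?_
  unfold cvs
  rw [← Summable.tsum_smul_const (hsc.prod_factor k)]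
  refine tsum_congr fun l => ?_
  show β l • S l * γ (k - l) • S (k - l) = _
  rw [smul_mul_smul_comm, hmul, add_sub_cancel]

end absM

section ell2
variable {n : ℕ} {G : Type*} [NormedAddCommGroup G] [InnerProductSpace ℂ G]

/-- ℓ² sequences with values in `G` -/
abbrev LK (n : ℕ) (G : Type*) [NormedAddCommGroup G] : Type _ :=
  lp (fun _ : Fin n → ℤ => G) 2

lemma lk_memlp_iff (f : (Fin n → ℤ) → G) :
    Memℓp f 2 ↔ Summable fun k => ‖f k‖ ^ 2 := by
  rw [memℓp_gen_iff (by norm_num)]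
  simp

lemma LK.norm_sq (f : LK n G) : ‖f‖ ^ 2 = ∑' k, ‖f k‖ ^ 2 := by
  have := lp.norm_rpow_eq_tsum (p := 2) (by norm_num) f
  simpa using this

lemma LK.summable_sq (f : LK n G) : Summable fun k => ‖f k‖ ^ 2 :=
  (lk_memlp_iff _).mp (lp.memℓp f)

lemma shiftW_mem (c : (Fin n → ℤ) → ℂ) (hc : ∀ k, ‖c k‖ ≤ 1) (l : Fin n → ℤ) (f : LK n G) :
    Memℓp (fun k => c k • f (k - l)) 2 := by
  rw [lk_memlp_iff]
  have h := (Equiv.subRight l).summable_iff.mpr (LK.summable_sq f)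
  refine Summable.of_nonneg_of_le (fun _ => by positivity) (fun k => ?_) h
  rw [norm_smul]
  have : ‖c k‖ * ‖f (k - l)‖ ≤ 1 * ‖f (k - l)‖ := by gcongr; exact hc k
  rw [one_mul] at this
  simp only [Function.comp, Equiv.subRight_apply]
  gcongr

/-- the generalised weighted shift as a function -/
def shiftFun (c : (Fin n → ℤ) → ℂ) (hc : ∀ k, ‖c k‖ ≤ 1) (l : Fin n → ℤ) (f : LK n G) : LK n G :=
  ⟨fun k => c k • f (k - l), shiftW_mem c hc l f⟩

lemma shiftFun_apply (c : (Fin n → ℤ) → ℂ) (hc : ∀ k, ‖c k‖ ≤ 1) (l : Fin n → ℤ) (f : LK n G)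
    (k : Fin n → ℤ) : shiftFun c hc l f k = c k • f (k - l) := rfl

lemma shiftFun_norm (c : (Fin n → ℤ) → ℂ) (hc : ∀ k, ‖c k‖ ≤ 1) (l : Fin n → ℤ) (f : LK n G) :
    ‖shiftFun c hc l f‖ ≤ ‖f‖ := by
  refine abs_le_of_sq_le_sq' ?_ (norm_nonneg _) |>.2
  rw [LK.norm_sq, LK.norm_sq, ← (Equiv.subRight l).tsum_eq (fun k => ‖f k‖ ^ 2)]
  have h := (Equiv.subRight l).summable_iff.mpr (LK.summable_sq f)
  refine Summable.tsum_le_tsum (fun k => ?_) (LK.summable_sq _) h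
  rw [shiftFun_apply, norm_smul]
  have : ‖c k‖ * ‖f (k - l)‖ ≤ 1 * ‖f (k - l)‖ := by gcongr; exact hc k
  rw [one_mul] at this
  simp only [Equiv.subRight_apply]
  gcongr

/-- the generalised weighted shift, linear version -/
def shiftLin (c : (Fin n → ℤ) → ℂ) (hc : ∀ k, ‖c k‖ ≤ 1) (l : Fin n → ℤ) :
    LK n G →ₗ[ℂ] LK n G where
  toFun := shiftFun c hc l
  map_add' := fun f g => by
    ext k
    exact smul_add (c k) (f (k - l)) (g (k - l))
  map_smul' := fun a f => by
    ext k
    exact smul_comm (c k) a (f (k - l))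

/-- generalised weighted shift: `(Wf)_k = c_k f_{k-l}` -/
def shiftW (c : (Fin n → ℤ) → ℂ) (hc : ∀ k, ‖c k‖ ≤ 1) (l : Fin n → ℤ) :
    LK n G →L[ℂ] LK n G :=
  LinearMap.mkContinuous (shiftLin c hc l) 1 (fun f => by
    rw [one_mul]; exact shiftFun_norm c hc l f)

/-- plain shift -/
def Sh (l : Fin n → ℤ) : LK n G →L[ℂ] LK n G := shiftW (fun _ => 1) (fun _ => by simp) l

/-- the character `θ ↦ exp (2π i k_j θ)` -/
def chr (j : Fin n) (θ : ℝ) (k : Fin n → ℤ) : ℂ :=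
  Complex.exp (((2 * Real.pi * k j * θ : ℝ) : ℂ) * Complex.I)

lemma chr_norm (j : Fin n) (θ : ℝ) (k : Fin n → ℤ) : ‖chr j θ k‖ = 1 :=
  Complex.norm_exp_ofReal_mul_I _

lemma chr_add (j : Fin n) (θ : ℝ) (k l : Fin n → ℤ) :
    chr j θ (k + l) = chr j θ k * chr j θ l := by
  unfold chr
  rw [← Complex.exp_add]
  congr 1
  push_cast [Pi.add_apply]
  ring

lemma chr_zero (j : Fin n) (k : Fin n → ℤ) : chr j 0 k = 1 := by simp [chr]

/-- translation by `θ` in direction `j` -/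
def tau (j : Fin n) (θ : ℝ) : LK n G →L[ℂ] LK n G :=
  shiftW (chr j θ) (fun k => (chr_norm j θ k).le) 0

lemma shiftW_apply (c : (Fin n → ℤ) → ℂ) (hc : ∀ k, ‖c k‖ ≤ 1) (l : Fin n → ℤ) (f : LK n G)
    (k : Fin n → ℤ) : shiftW c hc l f k = c k • f (k - l) := rfl

lemma Sh_apply (l : Fin n → ℤ) (f : LK n G) (k : Fin n → ℤ) : Sh l f k = f (k - l) := by
  unfold Sh; rw [shiftW_apply, one_smul]

lemma tau_apply (j : Fin n) (θ : ℝ) (f : LK n G) (k : Fin n → ℤ) :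
    tau j θ f k = chr j θ k • f k := by
  unfold tau; rw [shiftW_apply, sub_zero]

lemma Sh_norm_le (l : Fin n → ℤ) : ‖(Sh l : LK n G →L[ℂ] LK n G)‖ ≤ 1 :=
  by
  unfold Sh shiftW; exact LinearMap.mkContinuous_norm_le _ zero_le_one _

lemma Sh_zero : (Sh 0 : LK n G →L[ℂ] LK n G) = 1 := by
  ext f k
  simp [Sh_apply]

lemma Sh_mul (l m : Fin n → ℤ) : (Sh l : LK n G →L[ℂ] LK n G) * Sh m = Sh (l + m) := by
  ext f k
  show Sh l (Sh m f) k = _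
  rw [Sh_apply, Sh_apply, Sh_apply, sub_sub]

lemma Sh_inner (l : Fin n → ℤ) (f g : LK n G) :
    inner ℂ (Sh l f) g = inner ℂ f (Sh (-l) g) := by
  rw [lp.inner_eq_tsum, lp.inner_eq_tsum, ← (Equiv.addRight l).tsum_eq]
  refine tsum_congr fun k => ?_
  simp [Sh_apply]

variable [CompleteSpace G]

/-- multiplication operator with Fourier coefficients `β` -/
def Mop (β : (Fin n → ℤ) → ℂ) : LK n G →L[ℂ] LK n G := Mab Sh β

lemma Mop_hasSum {β : (Fin n → ℤ) → ℂ} (hβ : Summable fun l => ‖β l‖) :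
    HasSum (fun l => β l • (Sh l : LK n G →L[ℂ] LK n G)) (Mop β) :=
  Mab_hasSum Sh_norm_le hβ

lemma Mop_apply_hasSum {β : (Fin n → ℤ) → ℂ} (hβ : Summable fun l => ‖β l‖) (f : LK n G) :
    HasSum (fun l => β l • Sh l f) (Mop β f) :=
  (Mop_hasSum hβ).mapL (ContinuousLinearMap.apply ℂ (LK n G) f)

lemma Mop_coord_hasSum {β : (Fin n → ℤ) → ℂ} (hβ : Summable fun l => ‖β l‖) (f : LK n G)
    (k : Fin n → ℤ) : HasSum (fun l => β l • f (k - l)) (Mop β f k) := by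
  have := (Mop_apply_hasSum hβ f).mapL (lp.evalCLM ℂ (fun _ : Fin n → ℤ => G) 2 k)
  refine this.congr_fun ?_ |> id
  intro l
  show _ = (β l • Sh l f : LK n G) k
  rw [← Sh_apply]; rfl

lemma Mop_inner {β : (Fin n → ℤ) → ℂ} (hβ : Summable fun l => ‖β l‖)
    (hreal : ∀ l, β (-l) = starRingEnd ℂ (β l)) (f g : LK n G) :
    inner ℂ (Mop β f) g = inner ℂ f (Mop β g) := by
  have h1 := (Mop_apply_hasSum hβ g).mapL (innerSL ℂ f)
  have h2 := (Mop_apply_hasSum hβ f).mapL (innerSL ℂ g)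
  have h3 := h2.map (starRingEnd ℂ) Complex.continuous_conj
  have h4 : HasSum (fun l => inner ℂ (β l • Sh l f) g) (inner ℂ (Mop β f) g) := by
    convert h3 using 1
    · ext l
      simp only [Function.comp, innerSL_apply_apply, inner_conj_symm]
    · simp only [innerSL_apply_apply, inner_conj_symm]
  refine h4.unique ?_
  rw [← (Equiv.neg (Fin n → ℤ)).hasSum_iff] at h1
  refine HasSum.congr_fun h1 fun l => ?_
  simp only [Function.comp, innerSL_apply_apply, Equiv.neg_apply, inner_smul_left,
    inner_smul_right, hreal, Sh_inner]

lemma Mop_mul {β γ : (Fin n → ℤ) → ℂ} (hβ : Summable fun l => ‖β l‖)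
    (hγ : Summable fun l => ‖γ l‖) (f : LK n G) :
    Mop β (Mop γ f) = Mop (cvs β γ) f := by
  have key : (Mop β : LK n G →L[ℂ] LK n G) * Mop γ = Mop (cvs β γ) :=
    Mab_mul Sh_norm_le Sh_mul hβ hγ
  rw [← key]; rfl

lemma Mop_delta : (Mop (fun k => if k = 0 then 1 else 0) : LK n G →L[ℂ] LK n G) = 1 := by
  unfold Mop Mab
  rw [tsum_eq_single 0]
  · simp [Sh_zero]
  · intro l hl; simp [hl]

lemma chr_mul_summable {β : (Fin n → ℤ) → ℂ} (hβ : Summable fun l => ‖β l‖) (j : Fin n) (θ : ℝ) :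
    Summable fun l => ‖chr j θ l * β l‖ := by
  simpa [chr_norm] using hβ

lemma tau_Mop {β : (Fin n → ℤ) → ℂ} (hβ : Summable fun l => ‖β l‖) (j : Fin n) (θ : ℝ)
    (f : LK n G) : tau j θ (Mop β f) = Mop (fun l => chr j θ l * β l) (tau j θ f) := by
  ext k
  rw [tau_apply]
  refine ((Mop_coord_hasSum hβ f k).const_smul (chr j θ k)).unique ?_
  convert Mop_coord_hasSum (chr_mul_summable hβ j θ) (tau j θ f) k using 1
  ext l
  rw [tau_apply, smul_smul, smul_smul]
  congr 1
  have := chr_add j θ l (k - l)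
  rw [add_sub_cancel] at this
  rw [this]; ring

end ell2

lemma clm_comp_bilin (E F G : Type*) [NormedAddCommGroup E] [NormedAddCommGroup F]
    [NormedAddCommGroup G] [NormedSpace ℂ E] [NormedSpace ℂ F] [NormedSpace ℂ G] :
    IsBoundedBilinearMap ℝ (fun p : (F →L[ℂ] G) × (E →L[ℂ] F) => p.1.comp p.2) :=
  { add_left := fun x y z => rfl
    smul_left := fun c x z => rfl
    add_right := fun x y z => by ext v; simp
    smul_right := fun c x z => by ext v; exact x.map_smul_of_tower c _
    bound := ⟨1, one_pos, fun x y => by rw [one_mul]; exact x.opNorm_comp_le y⟩ }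

lemma clm_apply_bilin (E F : Type*) [NormedAddCommGroup E] [NormedAddCommGroup F]
    [NormedSpace ℂ E] [NormedSpace ℂ F] :
    IsBoundedBilinearMap ℝ (fun p : (E →L[ℂ] F) × E => p.1 p.2) :=
  { add_left := fun x y z => rfl
    smul_left := fun c x z => rfl
    add_right := fun x y z => map_add _ _ _
    smul_right := fun c x z => x.map_smul_of_tower c z
    bound := ⟨1, one_pos, fun x y => by rw [one_mul]; exact x.le_opNorm y⟩ }

lemma clm_comp_contDiff {E F G : Type*} [NormedAddCommGroup E] [NormedAddCommGroup F]
    [NormedAddCommGroup G] [NormedSpace ℂ E] [NormedSpace ℂ F] [NormedSpace ℂ G]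
    {f : ℝ → F →L[ℂ] G} {g : ℝ → E →L[ℂ] F} (hf : ContDiff ℝ (⊤ : ℕ∞) f)
    (hg : ContDiff ℝ (⊤ : ℕ∞) g) : ContDiff ℝ (⊤ : ℕ∞) (fun θ => (f θ).comp (g θ)) :=
  (clm_comp_bilin E F G).contDiff.comp (hf.prodMk hg)

lemma ring_inverse_contDiffAt {R : Type*} [NormedRing R] [NormedAlgebra ℂ R] [CompleteSpace R]
    {x : R} (hx : IsUnit x) : ContDiffAt ℝ (⊤ : ℕ∞) Ring.inverse x := by
  obtain ⟨u, rfl⟩ := hx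
  exact (contDiffAt_ringInverse ℂ u).restrict_scalars ℝ

lemma isUnit_mem_nhds {R : Type*} [NormedRing R] [CompleteSpace R]
    {x : R} (hx : IsUnit x) : {y : R | IsUnit y} ∈ nhds x := Units.isOpen.mem_nhds hx

lemma clm_inverse_contDiffAt {E : Type*} [NormedAddCommGroup E] [NormedSpace ℂ E]
    [CompleteSpace E] {f : ℝ → E →L[ℂ] E} (hf : ContDiff ℝ (⊤ : ℕ∞) f) (hu : IsUnit (f 0)) :
    ContDiffAt ℝ (⊤ : ℕ∞) (fun θ => Ring.inverse (f θ)) 0 := by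
  have h1 := ring_inverse_contDiffAt (R := E →L[ℂ] E) hu
  exact h1.comp (0 : ℝ) hf.contDiffAt

lemma clm_isUnit_eventually {E : Type*} [NormedAddCommGroup E] [NormedSpace ℂ E]
    [CompleteSpace E] {f : ℝ → E →L[ℂ] E} (hf : Continuous f) (hu : IsUnit (f 0)) :
    ∀ᶠ θ in nhds (0 : ℝ), IsUnit (f θ) := by
  have h1 := isUnit_mem_nhds (R := E →L[ℂ] E) hu
  exact hf.continuousAt.eventually h1

section absHilb
variable {H : Type*} [NormedAddCommGroup H] [InnerProductSpace ℂ H] [CompleteSpace H]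

/-- compression of an operator to a closed subspace -/
def compr (V : Submodule ℂ H) [V.HasOrthogonalProjection] (A : H →L[ℂ] H) : V →L[ℂ] V :=
  V.orthogonalProjectionOnto.comp (A.comp V.subtypeL)

lemma compr_isUnit (V : Submodule ℂ H) [CompleteSpace V] (A : H →L[ℂ] H)
    (c : ℝ) (hc : 0 < c) (hco : ∀ w ∈ V, c * ‖w‖ ^ 2 ≤ ‖inner ℂ (A w) w‖) :
    IsUnit (compr V A) := by
  refine ContinuousLinearMap.isUnit_of_forall_le_norm_inner_map (compr V A) (c := ⟨c, hc.le⟩) hc ?_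
  intro w
  have h := hco w w.2
  have e : inner ℂ (compr V A w) w = inner ℂ (A w) (w : H) := by
    rw [Submodule.coe_inner]
    exact Submodule.inner_orthogonalProjectionOnto_eq_of_mem_right w (A w)
  rw [e]
  rw [mul_comm]
  exact h

lemma weak_iff (V : Submodule ℂ H) [CompleteSpace V] (A : H →L[ℂ] H) (f : H) :
    (∀ w ∈ V, inner ℂ (A f) w = 0) ↔ V.orthogonalProjectionOnto (A f) = 0 := by
  rw [Submodule.orthogonalProjectionOnto_eq_zero_iff, Submodule.mem_orthogonal']

lemma abs_exists (V : Submodule ℂ H) [CompleteSpace V] (A : H →L[ℂ] H)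
    (c : ℝ) (hc : 0 < c) (hco : ∀ w ∈ V, c * ‖w‖ ^ 2 ≤ ‖inner ℂ (A w) w‖) (U0 : H) :
    ∃ v ∈ V, ∀ w ∈ V, inner ℂ (A (v + U0)) w = 0 := by
  obtain ⟨u, hu⟩ := compr_isUnit V A c hc hco
  refine ⟨((↑u⁻¹ : V →L[ℂ] V) (-(V.orthogonalProjectionOnto (A U0))) : V), Subtype.coe_prop _, ?_⟩
  rw [weak_iff, map_add, map_add]
  have : compr V A ((↑u⁻¹ : V →L[ℂ] V) (-(V.orthogonalProjectionOnto (A U0)))) =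
     -(V.orthogonalProjectionOnto (A U0)) := by
    rw [← hu]
    have := congrArg (fun T : V →L[ℂ] V => T (-(V.orthogonalProjectionOnto (A U0)))) u.mul_inv
    exact this
  have h2 := congrArg (fun z => z + V.orthogonalProjectionOnto (A U0)) this
  simpa [compr] using h2

lemma abs_reg (V : Submodule ℂ H) [CompleteSpace V] (A : ℝ → H →L[ℂ] H)
    (hA : ContDiff ℝ (⊤ : ℕ∞) A)
    (c : ℝ) (hc : 0 < c) (hco : ∀ w ∈ V, c * ‖w‖ ^ 2 ≤ ‖inner ℂ (A 0 w) w‖)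
    (τ : ℝ → H →L[ℂ] H) (hτV : ∀ θ, ∀ w ∈ V, τ θ w ∈ V)
    (hadj : ∀ θ f g, inner ℂ (τ θ f) g = inner ℂ f (τ (-θ) g))
    (hintw : ∀ θ f, τ θ (A 0 f) = A θ (τ θ f))
    (U0 : H) (hU0 : ContDiff ℝ (⊤ : ℕ∞) (fun θ => τ θ U0))
    (v : H) (hv : v ∈ V) (hw : ∀ w ∈ V, inner ℂ (A 0 (v + U0)) w = 0) :
    ContDiffAt ℝ (⊤ : ℕ∞) (fun θ => τ θ v) 0 := by
  have hQ : ContDiff ℝ (⊤ : ℕ∞) (fun θ => compr V (A θ)) := by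
    unfold compr
    exact clm_comp_contDiff contDiff_const (clm_comp_contDiff hA contDiff_const)
  have hunit := compr_isUnit V (A 0) c hc hco
  have key : ∀ θ, compr V (A θ) ⟨τ θ v, hτV θ v hv⟩ = -(V.orthogonalProjectionOnto (A θ (τ θ U0))) := by
    intro θ
    have h1 : ∀ w ∈ V, inner ℂ (A θ (τ θ (v + U0))) w = 0 := by
      intro w hwV
      rw [← hintw, hadj]
      exact hw _ (hτV _ _ hwV)
    rw [weak_iff, map_add, map_add, map_add] at h1
    exact eq_neg_of_add_eq_zero_left h1
  have hinv : ContDiffAt ℝ (⊤ : ℕ∞) (fun θ => Ring.inverse (compr V (A θ))) 0 :=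
    clm_inverse_contDiffAt hQ hunit
  have hrhs : ContDiff ℝ (⊤ : ℕ∞) (fun θ => -(V.orthogonalProjectionOnto (A θ (τ θ U0)))) := by
    have h1 : ContDiff ℝ (⊤ : ℕ∞) (fun θ => A θ (τ θ U0)) := by
      exact (clm_apply_bilin H H).contDiff.comp (hA.prodMk hU0)
    exact (((V.orthogonalProjectionOnto).restrictScalars ℝ).contDiff.comp h1).neg
  have hsol : (fun θ => τ θ v) =ᶠ[nhds 0] fun θ =>
      (((Ring.inverse (compr V (A θ))) (-(V.orthogonalProjectionOnto (A θ (τ θ U0)))) : V) : H) := by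
    have hopen : ∀ᶠ θ in nhds (0 : ℝ), IsUnit (compr V (A θ)) :=
      clm_isUnit_eventually hQ.continuous hunit
    filter_upwards [hopen] with θ hθ
    rw [← key]
    have := congrArg (fun T : V →L[ℂ] V => T ⟨τ θ v, hτV θ v hv⟩) (Ring.inverse_mul_cancel _ hθ)
    exact (congrArg Subtype.val this).symm
  refine ContDiffAt.congr_of_eventuallyEq ?_ hsol
  have h3 : ContDiffAt ℝ (⊤ : ℕ∞) (fun θ =>
      (Ring.inverse (compr V (A θ))) (-(V.orthogonalProjectionOnto (A θ (τ θ U0))))) 0 :=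
    (clm_apply_bilin V V).contDiff.contDiffAt.comp (0 : ℝ) (hinv.prodMk hrhs.contDiffAt)
  exact (((V.subtypeL).restrictScalars ℝ).contDiff.contDiffAt).comp (0 : ℝ) h3

end absHilb

section comps
variable {ι : Type*} [Fintype ι] {K : Type*} [NormedAddCommGroup K] [InnerProductSpace ℂ K]

/-- (gradient, t-derivative) space -/
abbrev HH (ι : Type*) (K : Type*) [NormedAddCommGroup K] : Type _ :=
  PiLp 2 (fun _ : Option ι => K)

/-- coordinate projection -/
def prj (c : Option ι) : HH ι K →L[ℂ] K := PiLp.proj 2 (fun _ : Option ι => K) c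

/-- coordinate injection -/
def inj (c : Option ι) : K →L[ℂ] HH ι K :=
  (PiLp.continuousLinearEquiv 2 ℂ (fun _ : Option ι => K)).symm.toContinuousLinearMap.comp
    (ContinuousLinearMap.single ℂ (fun _ : Option ι => K) c)

lemma prj_apply (c : Option ι) (f : HH ι K) : prj c f = f c := rfl

lemma inj_apply (c d : Option ι) (x : K) : inj c x d = if d = c then x else 0 := by
  show (Pi.single c x : Option ι → K) d = _
  rw [Pi.single_apply]

/-- the flattening operator -/
def TT (M : ι → K →L[ℂ] K) : HH ι K →L[ℂ] HH ι K :=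
  1 + ∑ i, (inj (some i)).comp ((M i).comp (prj none))

/-- adjoint of the flattening operator -/
def TTs (M : ι → K →L[ℂ] K) : HH ι K →L[ℂ] HH ι K :=
  1 + ∑ i, (inj none).comp ((M i).comp (prj (some i)))

lemma TT_none (M : ι → K →L[ℂ] K) (f : HH ι K) : TT M f none = f none := by
  simp [TT, inj_apply]

lemma TT_some (M : ι → K →L[ℂ] K) (f : HH ι K) (i : ι) :
    TT M f (some i) = f (some i) + M i (f none) := by
  simp [TT, inj_apply, prj_apply]

lemma TTs_none (M : ι → K →L[ℂ] K) (f : HH ι K) :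
    TTs M f none = f none + ∑ i, M i (f (some i)) := by
  simp [TTs, inj_apply, prj_apply]

lemma TTs_some (M : ι → K →L[ℂ] K) (f : HH ι K) (i : ι) :
    TTs M f (some i) = f (some i) := by
  simp [TTs, inj_apply]

lemma HH_inner (f g : HH ι K) :
    inner ℂ f g = inner ℂ (f none) (g none) + ∑ i, inner ℂ (f (some i)) (g (some i)) := by
  rw [PiLp.inner_apply, Fintype.sum_option]

lemma TTs_inner (M : ι → K →L[ℂ] K) (hM : ∀ i f g, inner ℂ (M i f) g = inner ℂ f (M i g))
    (f g : HH ι K) : inner ℂ (TTs M f) g = inner ℂ f (TT M g) := by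
  simp only [HH_inner, TTs_none, TTs_some, TT_none, TT_some, inner_add_left, inner_add_right,
    sum_inner, hM, Finset.sum_add_distrib]
  ring

lemma TT_lower (M : ι → K →L[ℂ] K) : ∃ c : ℝ, 0 < c ∧ ∀ f : HH ι K, c * ‖f‖ ^ 2 ≤ ‖TT M f‖ ^ 2 := by
  have hinv : ∀ f : HH ι K, TT (fun i => - M i) (TT M f) = f := by
    intro f
    ext c
    rcases c with _ | i
    · rw [TT_none, TT_none]
    · rw [TT_some, TT_none, TT_some]; simp
  set S := TT (fun i => - M i)
  refine ⟨((‖S‖ + 1) ^ 2)⁻¹, by positivity, fun f => ?_⟩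
  rw [inv_mul_le_iff₀ (by positivity), ← mul_pow]
  gcongr
  calc ‖f‖ = ‖S (TT M f)‖ := by rw [hinv]
    _ ≤ ‖S‖ * ‖TT M f‖ := S.le_opNorm _
    _ ≤ _ := by gcongr; linarith

/-- the energy operator -/
def AA (M : ι → K →L[ℂ] K) : HH ι K →L[ℂ] HH ι K := (TTs M).comp (TT M)

lemma AA_inner (M : ι → K →L[ℂ] K) (hM : ∀ i f g, inner ℂ (M i f) g = inner ℂ f (M i g))
    (f g : HH ι K) : inner ℂ (AA M f) g = inner ℂ (TT M f) (TT M g) := TTs_inner M hM _ _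

lemma AA_coercive (M : ι → K →L[ℂ] K) (hM : ∀ i f g, inner ℂ (M i f) g = inner ℂ f (M i g)) :
    ∃ c : ℝ, 0 < c ∧ ∀ f : HH ι K, c * ‖f‖ ^ 2 ≤ ‖inner ℂ (AA M f) f‖ := by
  obtain ⟨c, hc, h⟩ := TT_lower M
  refine ⟨c, hc, fun f => (h f).trans ?_⟩
  rw [AA_inner M hM, inner_self_eq_norm_sq_to_K]
  simp

lemma AA_contDiff {M : ℝ → ι → K →L[ℂ] K} (hM : ∀ i, ContDiff ℝ (⊤ : ℕ∞) (fun θ => M θ i)) :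
    ContDiff ℝ (⊤ : ℕ∞) (fun θ => AA (M θ)) := by
  refine clm_comp_contDiff ?_ ?_
  · refine contDiff_const.add (ContDiff.sum fun i _ => ?_)
    exact clm_comp_contDiff contDiff_const (clm_comp_contDiff (hM i) contDiff_const)
  · refine contDiff_const.add (ContDiff.sum fun i _ => ?_)
    exact clm_comp_contDiff contDiff_const (clm_comp_contDiff (hM i) contDiff_const)

/-- componentwise operator -/
def cw (τ : K →L[ℂ] K) : HH ι K →L[ℂ] HH ι K := ∑ c, (inj c).comp (τ.comp (prj c))

lemma cw_apply (τ : K →L[ℂ] K) (f : HH ι K) (c : Option ι) : cw τ f c = τ (f c) := by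
  simp only [cw, sum_apply, ContinuousLinearMap.comp_apply, prj_apply]
  rw [WithLp.ofLp_sum, Finset.sum_apply]
  simp [inj_apply]

lemma cw_AA (τ : K →L[ℂ] K) (M M' : ι → K →L[ℂ] K) (h : ∀ i f, τ (M i f) = M' i (τ f))
    (f : HH ι K) : cw τ (AA M f) = AA M' (cw τ f) := by
  ext c
  rw [cw_apply]
  rcases c with _ | i
  · simp only [AA, ContinuousLinearMap.comp_apply, TTs_none, TT_none, TT_some, cw_apply, map_add,
      map_sum, h]
  · simp only [AA, ContinuousLinearMap.comp_apply, TTs_some, TT_none, TT_some, cw_apply, map_add,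
      map_sum, h]

lemma cw_inner (τ τ' : K →L[ℂ] K) (h : ∀ f g, inner ℂ (τ f) g = inner ℂ f (τ' g)) (f g : HH ι K) :
    inner ℂ (cw τ f) g = inner ℂ f (cw τ' g) := by
  simp only [HH_inner, cw_apply, h]

variable [CompleteSpace K]

theorem comp_exists (V : Submodule ℂ (HH ι K)) (hV : IsClosed (V : Set (HH ι K)))
    (M : ι → K →L[ℂ] K)
    (hM : ∀ i f g, inner ℂ (M i f) g = inner ℂ f (M i g)) (U0 : HH ι K) :
    ∃ v ∈ V, ∀ w ∈ V, inner ℂ (TT M (v + U0)) (TT M w) = 0 := by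
  have : CompleteSpace V := hV.completeSpace_coe
  obtain ⟨c, hc, h⟩ := AA_coercive M hM
  simpa only [AA_inner M hM] using abs_exists V (AA M) c hc (fun w _ => h w) U0

theorem comp_reg (V : Submodule ℂ (HH ι K)) (hV : IsClosed (V : Set (HH ι K)))
    (M : ℝ → ι → K →L[ℂ] K)
    (hM : ∀ i f g, inner ℂ (M 0 i f) g = inner ℂ f (M 0 i g))
    (hMs : ∀ i, ContDiff ℝ (⊤ : ℕ∞) (fun θ => M θ i))
    (τ : ℝ → K →L[ℂ] K) (hτV : ∀ θ, ∀ w ∈ V, cw (τ θ) w ∈ V)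
    (hadj : ∀ θ f g, inner ℂ (τ θ f) g = inner ℂ f (τ (-θ) g))
    (hintw : ∀ θ i f, τ θ (M 0 i f) = M θ i (τ θ f))
    (U0 : HH ι K) (hU0 : ∀ c, ContDiff ℝ (⊤ : ℕ∞) (fun θ => τ θ (U0 c)))
    (v : HH ι K) (hv : v ∈ V) (hw : ∀ w ∈ V, inner ℂ (TT (M 0) (v + U0)) (TT (M 0) w) = 0)
    (c : Option ι) :
    ContDiffAt ℝ (⊤ : ℕ∞) (fun θ => τ θ (v c)) 0 := by
  have : CompleteSpace V := hV.completeSpace_coe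
  obtain ⟨c0, hc, h⟩ := AA_coercive (M 0) hM
  have h1 : ContDiff ℝ (⊤ : ℕ∞) (fun θ => cw (τ θ) U0) := by
    have e : (fun θ => cw (τ θ) U0) = fun θ => ∑ c, inj c (τ θ (U0 c)) := by
      funext θ
      simp only [cw, sum_apply, ContinuousLinearMap.comp_apply, prj_apply]
    rw [e]
    exact ContDiff.sum fun c _ =>
      ((inj c : K →L[ℂ] HH ι K).restrictScalars ℝ).contDiff.comp (hU0 c)
  have h2 := abs_reg V (fun θ => AA (M θ)) (AA_contDiff hMs) c0 hc (fun w _ => h w)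
    (fun θ => cw (τ θ)) hτV (fun θ => cw_inner _ _ (hadj θ)) (fun θ => cw_AA _ _ _ (hintw θ)) U0 h1
    v hv (by simpa only [AA_inner (M 0) hM] using hw)
  have h3 := (((prj c : HH ι K →L[ℂ] K).restrictScalars ℝ).contDiff (n := (⊤ : ℕ∞))).contDiffAt.comp
    (0 : ℝ) h2
  refine h3.congr_of_eventuallyEq (Filter.Eventually.of_forall fun θ => ?_)
  exact (cw_apply (τ θ) v c).symm

end comps

section orbit
variable {n : ℕ}

lemma chr_hasDerivAt (j : Fin n) (k : Fin n → ℤ) (θ : ℝ) :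
    HasDerivAt (fun θ => chr j θ k) (chr j θ k * (2 * Real.pi * k j * Complex.I)) θ := by
  unfold chr
  have h1 : HasDerivAt (fun θ : ℝ => ((2 * Real.pi * k j * θ : ℝ) : ℂ) * Complex.I)
      (((2 * Real.pi * k j : ℝ) : ℂ) * Complex.I) θ := by
    have : HasDerivAt (fun θ : ℝ => 2 * Real.pi * k j * θ) (2 * Real.pi * k j) θ := by
      simpa using (hasDerivAt_id θ).const_mul (2 * Real.pi * k j)
    exact this.ofReal_comp.mul_const _
  convert h1.cexp using 1
  push_cast
  ring

/-- the symbol of `∂_j` -/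
def symb (j : Fin n) (k : Fin n → ℤ) : ℂ := 2 * Real.pi * k j * Complex.I

lemma symb_norm (j : Fin n) (k : Fin n → ℤ) : ‖symb j k‖ = 2 * Real.pi * |(k j : ℝ)| := by
  unfold symb
  simp [abs_of_pos Real.pi_pos]

lemma symb_norm_le (j : Fin n) (k : Fin n → ℤ) : ‖symb j k‖ ≤ 2 * Real.pi * wt k ^ 1 := by
  rw [symb_norm, pow_one]
  have := abs_le_wt k j
  have := Real.pi_pos
  gcongr

lemma orbit_deriv {E : Type*} [NormedAddCommGroup E] [NormedSpace ℂ E] [CompleteSpace E]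
    (j : Fin n) (e : (Fin n → ℤ) → E) (h0 : Summable fun k => ‖e k‖)
    (h1 : Summable fun k => ‖symb j k • e k‖) (θ : ℝ) :
    HasDerivAt (fun θ => ∑' k, chr j θ k • e k) (∑' k, chr j θ k • (symb j k • e k)) θ := by
  refine hasDerivAt_tsum (𝕜 := ℝ) (u := fun k => ‖symb j k • e k‖)
    (g := fun k θ => chr j θ k • e k) (g' := fun k θ => chr j θ k • (symb j k • e k)) (y₀ := 0) h1 (fun k θ => ?_)
    (fun k θ => ?_) ?_ θ
  · have := (chr_hasDerivAt j k θ).smul_const (e k)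
    rw [mul_smul] at this
    exact this
  · rw [norm_smul, chr_norm, one_mul]
  · refine Summable.of_norm ?_
    simpa [norm_smul, chr_norm] using h0

lemma orbit_contDiff {E : Type*} [NormedAddCommGroup E] [NormedSpace ℂ E] [CompleteSpace E]
    (j : Fin n) (e : (Fin n → ℤ) → E) (he : RD e) :
    ContDiff ℝ (⊤ : ℕ∞) (fun θ => ∑' k, chr j θ k • e k) := by
  rw [contDiff_infty]
  intro m
  induction m generalizing e with
  | zero =>
    have hs : RD (fun k => symb j k • e k) := by
      intro s
      obtain ⟨C, hC⟩ := he (s + 1)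
      refine ⟨2 * Real.pi * C, fun k => ?_⟩
      have h := hC k
      have := symb_norm_le j k
      have hp := Real.pi_pos
      have := wt_pos k
      rw [norm_smul]
      calc ‖symb j k‖ * ‖e k‖ * wt k ^ s ≤ (2 * Real.pi * wt k ^ 1) * ‖e k‖ * wt k ^ s := by gcongr
        _ = 2 * Real.pi * (‖e k‖ * wt k ^ (s + 1)) := by ring
        _ ≤ _ := by gcongr
    have hd : Differentiable ℝ (fun θ => ∑' k, chr j θ k • e k) := fun θ =>
      (orbit_deriv j e he.summable_norm hs.summable_norm θ).differentiableAt
    simpa using hd.continuous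
  | succ m ih =>
    have hs : RD (fun k => symb j k • e k) := by
      intro s
      obtain ⟨C, hC⟩ := he (s + 1)
      refine ⟨2 * Real.pi * C, fun k => ?_⟩
      have h := hC k
      have := symb_norm_le j k
      have hp := Real.pi_pos
      have := wt_pos k
      rw [norm_smul]
      calc ‖symb j k‖ * ‖e k‖ * wt k ^ s ≤ (2 * Real.pi * wt k ^ 1) * ‖e k‖ * wt k ^ s := by gcongr
        _ = 2 * Real.pi * (‖e k‖ * wt k ^ (s + 1)) := by ring
        _ ≤ _ := by gcongr
    push_cast
    rw [contDiff_succ_iff_deriv]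
    have hd := orbit_deriv j e he.summable_norm hs.summable_norm
    refine ⟨fun θ => (hd θ).differentiableAt, by simp, ?_⟩
    rw [show deriv (fun θ => ∑' k, chr j θ k • e k) = _ from funext fun θ => (hd θ).deriv]
    exact ih _ hs

lemma wt_pow_le (k : Fin n → ℤ) (s : ℕ) :
    wt k ^ s ≤ ((n : ℝ) + 1) ^ s * (1 + ∑ j, |(k j : ℝ)| ^ s) := by
  have h := Finset.exists_max_image (Finset.univ : Finset (Option (Fin n)))
    (fun c => Option.elim c (1 : ℝ) (fun j => |(k j : ℝ)|)) ⟨none, Finset.mem_univ _⟩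
  obtain ⟨c, -, hc⟩ := h
  have hsum : wt k ≤ (n + 1) * Option.elim c (1 : ℝ) (fun j => |(k j : ℝ)|) := by
    have := Finset.sum_le_card_nsmul _ _ _ hc
    rw [Fintype.sum_option] at this
    simpa [wt] using this
  have h0 : 0 ≤ Option.elim c (1 : ℝ) (fun j => |(k j : ℝ)|) := by
    rcases c with _ | j <;> simp
  calc wt k ^ s ≤ ((n + 1) * Option.elim c (1 : ℝ) (fun j => |(k j : ℝ)|)) ^ s := by
        have := wt_pos k
        gcongr
    _ = (n + 1) ^ s * (Option.elim c (1 : ℝ) (fun j => |(k j : ℝ)|)) ^ s := mul_pow _ _ _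
    _ ≤ _ := by
        gcongr
        have hn : 0 ≤ ∑ j, |(k j : ℝ)| ^ s := Finset.sum_nonneg fun j _ => by positivity
        rcases c with _ | j
        · simpa using hn
        · have := Finset.single_le_sum (f := fun j => |(k j : ℝ)| ^ s)
            (fun j _ => by positivity) (Finset.mem_univ j)
          simp only [Option.elim_some]
          linarith

variable {G : Type*} [NormedAddCommGroup G] [InnerProductSpace ℂ G]

lemma chr_iteratedDeriv (j : Fin n) (k : Fin n → ℤ) (x : G) (s : ℕ) :
    iteratedDeriv s (fun θ => chr j θ k • x) = fun θ => chr j θ k • (symb j k ^ s • x) := by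
  induction s with
  | zero => simp
  | succ s ih =>
    rw [iteratedDeriv_succ, ih]
    funext θ
    have := (chr_hasDerivAt j k θ).smul_const (symb j k ^ s • x)
    rw [this.deriv, mul_smul, smul_smul (2 * _ * _ * _), pow_succ', symb]

lemma RD_of_orbit (f : LK n G)
    (hf : ∀ j, ContDiffAt ℝ (⊤ : ℕ∞) (fun θ => tau j θ f) 0) : RD (fun k => f k) := by
  intro s
  have hj : ∀ j k, ‖symb j k ^ s • f k‖ ≤ ‖iteratedFDeriv ℝ s (fun θ => tau j θ f) 0‖ := by
    intro j k
    let L : LK n G →L[ℝ] G := (lp.evalCLM ℂ (fun _ : Fin n → ℤ => G) 2 k).restrictScalars ℝ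
    have h1 : (fun θ => chr j θ k • f k) = L ∘ (fun θ => tau j θ f) := by
      funext θ
      exact (tau_apply j θ f k).symm
    have h2 := L.iteratedFDeriv_comp_left (hf j) (i := s) (by exact_mod_cast le_top)
    have h3 : ‖iteratedFDeriv ℝ s (fun θ => chr j θ k • f k) 0‖ = ‖symb j k ^ s • f k‖ := by
      rw [norm_iteratedFDeriv_eq_norm_iteratedDeriv, chr_iteratedDeriv]
      simp only [chr_zero, one_smul]
    rw [← h3, h1, h2]
    refine (ContinuousLinearMap.norm_compContinuousMultilinearMap_le _ _).trans ?_
    refine mul_le_of_le_one_left (norm_nonneg _) ?_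
    refine L.opNorm_le_bound zero_le_one fun x => ?_
    rw [one_mul]
    exact lp.norm_apply_le_norm (by norm_num) x k
  set C := fun j => ‖iteratedFDeriv ℝ s (fun θ => tau j θ f) 0‖
  refine ⟨(n + 1) ^ s * (‖f‖ + ∑ j, C j), fun k => ?_⟩
  have h0 : ‖f k‖ ≤ ‖f‖ := lp.norm_apply_le_norm (by norm_num) f k
  calc ‖f k‖ * wt k ^ s ≤ ‖f k‖ * (((n : ℝ) + 1) ^ s * (1 + ∑ j, |(k j : ℝ)| ^ s)) := by
        gcongr; exact wt_pow_le k s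
    _ = (n + 1) ^ s * (‖f k‖ + ∑ j, |(k j : ℝ)| ^ s * ‖f k‖) := by
        rw [← Finset.sum_mul]; ring
    _ ≤ _ := by
        gcongr with j
        refine le_trans ?_ (hj j k)
        rw [norm_smul, norm_pow, symb_norm]
        gcongr
        have := Real.pi_gt_three
        have := abs_nonneg (k j : ℝ)
        nlinarith

variable [CompleteSpace G]

lemma tau_contDiff (j : Fin n) (f : LK n G) (hf : RD (fun k => f k)) :
    ContDiff ℝ (⊤ : ℕ∞) (fun θ => tau j θ f) := by
  have h := orbit_contDiff j (fun k => lp.single 2 k (f k) : (Fin n → ℤ) → LK n G) ?_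
  · refine (congrArg (ContDiff ℝ (⊤ : ℕ∞)) (funext fun θ => ?_)).mpr h
    have h1 := lp.hasSum_single (p := 2) (by norm_num) (tau j θ f)
    rw [← h1.tsum_eq]
    refine tsum_congr fun k => ?_
    rw [tau_apply]
    exact lp.single_smul (E := fun _ : Fin n → ℤ => G) 2 k (chr j θ k) (f k)
  · intro s
    obtain ⟨C, hC⟩ := hf s
    refine ⟨C, fun k => ?_⟩
    rw [lp.norm_single (by norm_num)]
    exact hC k

lemma Mop_contDiff (j : Fin n) (β : (Fin n → ℤ) → ℂ) (hβ : RD β) :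
    ContDiff ℝ (⊤ : ℕ∞)
      (fun θ => (Mop (fun l => chr j θ l * β l) : LK n G →L[ℂ] LK n G)) := by
  have h := orbit_contDiff j (fun l => β l • (Sh l : LK n G →L[ℂ] LK n G)) ?_
  · refine (congrArg (ContDiff ℝ (⊤ : ℕ∞)) (funext fun θ => ?_)).mpr h
    unfold Mop Mab
    simp_rw [mul_smul]
  · intro s
    obtain ⟨C, hC⟩ := hβ s
    refine ⟨C, fun k => ?_⟩
    refine le_trans ?_ (hC k)
    have := wt_pos k
    gcongr
    rw [norm_smul]
    exact mul_le_of_le_one_right (norm_nonneg _) (Sh_norm_le k)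

lemma tau_adj (j : Fin n) (θ : ℝ) (f g : LK n G) :
    inner ℂ (tau j θ f) g = inner ℂ f (tau j (-θ) g) := by
  rw [lp.inner_eq_tsum, lp.inner_eq_tsum]
  refine tsum_congr fun k => ?_
  rw [tau_apply, tau_apply, inner_smul_left, inner_smul_right]
  congr 1
  unfold chr
  rw [← Complex.exp_conj, map_mul, Complex.conj_ofReal, Complex.conj_I]
  push_cast
  ring_nf

theorem solve_RD (V : Submodule ℂ (HH (Fin n) (LK n G)))
    (hV : IsClosed (V : Set (HH (Fin n) (LK n G))))
    (hτV : ∀ j θ, ∀ w ∈ V, cw (tau j θ) w ∈ V)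
    (b : Fin n → (Fin n → ℤ) → ℂ) (hb : ∀ i, RD (b i))
    (hreal : ∀ i l, b i (-l) = starRingEnd ℂ (b i l))
    (U0 : HH (Fin n) (LK n G)) (hU0 : ∀ c, RD (fun k => U0 c k)) :
    ∃ v ∈ V, (∀ w ∈ V, inner ℂ (TT (fun i => Mop (b i)) (v + U0)) (TT (fun i => Mop (b i)) w) = 0)
      ∧ ∀ c, RD (fun k => v c k) := by
  have hM : ∀ i (f g : LK n G), inner ℂ (Mop (b i) f) g = inner ℂ f (Mop (b i) g) := fun i f g =>
    Mop_inner (hb i).summable_norm (hreal i) f g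
  obtain ⟨v, hv, hw⟩ := comp_exists V hV (fun i => Mop (b i)) hM U0
  refine ⟨v, hv, hw, fun c => RD_of_orbit _ fun j => ?_⟩
  have e0 : (fun i => (Mop (b i) : LK n G →L[ℂ] LK n G)) =
      fun i => Mop (fun l => chr j 0 l * b i l) := by
    funext i; congr 1; funext l; rw [chr_zero, one_mul]
  have e1 : ∀ i, (Mop (b i) : LK n G →L[ℂ] LK n G) = Mop (fun l => chr j 0 l * b i l) :=
    fun i => congrFun e0 i
  refine comp_reg V hV (fun θ i => Mop (fun l => chr j θ l * b i l)) ?_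
    (fun i => Mop_contDiff j (b i) (hb i)) (fun θ => tau j θ) (hτV j) (tau_adj j) ?_ U0
    (fun c => tau_contDiff j _ (hU0 c)) v hv ?_ c
  · intro i f g
    simp only [← e1]
    exact hM i f g
  · intro θ i f
    simp only [← e1]
    exact tau_Mop (hb i).summable_norm j θ f
  · simp only [← e1]
    exact hw

end orbit

section half

/-- Lebesgue measure on the half line -/
abbrev mu0 : Measure ℝ := volume.restrict (Set.Ioi (0 : ℝ))

/-- `L²(0,∞)` -/
abbrev G2 : Type := Lp ℂ 2 mu0

/-- extension by zero -/
def ext0 (f : G2) : ℝ → ℂ := (Set.Ioi (0 : ℝ)).indicator f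

lemma ext0_memLp (f : G2) : MemLp (ext0 f) 2 volume :=
  (memLp_indicator_iff_restrict measurableSet_Ioi).mpr (Lp.memLp f)

lemma ext0_loc (f : G2) : LocallyIntegrable (ext0 f) volume :=
  (ext0_memLp f).locallyIntegrable (by norm_num)

lemma ext0_ii (f : G2) (a b : ℝ) : IntervalIntegrable (ext0 f) volume a b :=
  intervalIntegrable_iff.mpr
    (((ext0_loc f).integrableOn_isCompact isCompact_uIcc).mono_set Set.uIoc_subset_uIcc)

lemma ext0_ae (f : G2) : f =ᵐ[mu0] ext0 f := by
  rw [Filter.EventuallyEq, ae_restrict_iff' measurableSet_Ioi]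
  exact Filter.Eventually.of_forall fun x hx => by simp only [ext0, Set.indicator_of_mem hx]

lemma ext0_congr {f : G2} {g : ℝ → ℂ} (h : f =ᵐ[mu0] g) :
    ext0 f =ᵐ[volume] (Set.Ioi (0 : ℝ)).indicator g :=
  (ae_eq_restrict_iff_indicator_ae_eq measurableSet_Ioi).mp h

lemma ext0_add (f g : G2) : ext0 (f + g) =ᵐ[volume] fun t => ext0 f t + ext0 g t := by
  refine (ext0_congr (Lp.coeFn_add f g)).trans (Filter.Eventually.of_forall fun t => ?_)
  by_cases h : t ∈ Set.Ioi (0:ℝ) <;> simp [ext0, h]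

lemma ext0_smul (c : ℂ) (f : G2) : ext0 (c • f) =ᵐ[volume] fun t => c • ext0 f t := by
  refine (ext0_congr (Lp.coeFn_smul c f)).trans (Filter.Eventually.of_forall fun t => ?_)
  by_cases h : t ∈ Set.Ioi (0:ℝ) <;> simp [ext0, h]

lemma ext0_norm_int (f : G2) {a b : ℝ} (hab : a ≤ b) :
    ∫ s in a..b, ‖ext0 f s‖ ≤ Real.sqrt (b - a) * ‖f‖ := by
  have h1 : MemLp (ext0 f) 2 (volume.restrict (Set.Ioc a b)) := (ext0_memLp f).restrict _
  have h2 := eLpNorm_le_eLpNorm_mul_rpow_measure_univ (p := 1) (q := 2) (by norm_num) h1.1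
  have h3 : eLpNorm (ext0 f) 2 (volume.restrict (Set.Ioc a b)) ≤ eLpNorm f 2 mu0 := by
    refine (eLpNorm_mono_measure _ Measure.restrict_le_self).trans ?_
    rw [ext0, eLpNorm_indicator_eq_eLpNorm_restrict measurableSet_Ioi]
  rw [intervalIntegral.integral_of_le hab]
  have h4 : ∫ s in Set.Ioc a b, ‖ext0 f s‖ =
      (eLpNorm (ext0 f) 1 (volume.restrict (Set.Ioc a b))).toReal := by
    rw [eLpNorm_one_eq_lintegral_enorm, integral_norm_eq_lintegral_enorm h1.1]
  rw [h4]
  have h5 : eLpNorm (ext0 f) 1 (volume.restrict (Set.Ioc a b)) ≤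
      eLpNorm f 2 mu0 * ENNReal.ofReal (Real.sqrt (b - a)) := by
    refine h2.trans (mul_le_mul' h3 (le_of_eq ?_))
    rw [Measure.restrict_apply_univ, Real.volume_Ioc, Real.sqrt_eq_rpow,
      ← ENNReal.ofReal_rpow_of_nonneg (by linarith) (by norm_num)]
    norm_num
  refine (ENNReal.toReal_mono (ENNReal.mul_ne_top (Lp.eLpNorm_ne_top f) ENNReal.ofReal_ne_top)
    h5).trans (le_of_eq ?_)
  rw [ENNReal.toReal_mul, ENNReal.toReal_ofReal (Real.sqrt_nonneg _), Lp.norm_def, mul_comm]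

lemma ext0_int_le (f : G2) (a b : ℝ) :
    ‖∫ s in a..b, ext0 f s‖ ≤ Real.sqrt |b - a| * ‖f‖ := by
  wlog hab : a ≤ b generalizing a b
  · rw [intervalIntegral.integral_symm, norm_neg, abs_sub_comm]
    exact this b a (by linarith)
  refine (intervalIntegral.norm_integral_le_integral_norm hab).trans ?_
  rw [abs_of_nonneg (by linarith)]
  exact ext0_norm_int f hab

/-- primitive -/
def PI (t : ℝ) : G2 →L[ℂ] ℂ :=
  LinearMap.mkContinuous
    { toFun := fun f => ∫ s in (0:ℝ)..t, ext0 f s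
      map_add' := fun f g => by
        rw [← intervalIntegral.integral_add (ext0_ii f 0 t) (ext0_ii g 0 t)]
        exact intervalIntegral.integral_congr_ae ((ext0_add f g).mono fun x hx _ => hx)
      map_smul' := fun c f => by
        rw [RingHom.id_apply, ← intervalIntegral.integral_smul]
        exact intervalIntegral.integral_congr_ae ((ext0_smul c f).mono fun x hx _ => hx) }
    (Real.sqrt |t|) (fun f => by
      have := ext0_int_le f 0 t
      rw [sub_zero] at this
      exact this)

lemma PI_def (t : ℝ) (f : G2) : PI t f = ∫ s in (0:ℝ)..t, ext0 f s := rfl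

lemma PI_sub (a b : ℝ) (f : G2) : PI b f - PI a f = ∫ s in a..b, ext0 f s := by
  rw [PI_def, PI_def, intervalIntegral.integral_interval_sub_left (ext0_ii _ _ _) (ext0_ii _ _ _)]

lemma PI_norm (t : ℝ) (f : G2) : ‖PI t f‖ ≤ Real.sqrt |t| * ‖f‖ := by
  have := ext0_int_le f 0 t
  rwa [sub_zero] at this

lemma PI_neg {t : ℝ} (ht : t ≤ 0) (f : G2) : PI t f = 0 := by
  rw [PI_def, intervalIntegral.integral_symm, intervalIntegral.integral_of_le ht, neg_eq_zero]
  refine setIntegral_eq_zero_of_forall_eq_zero fun x hx => ?_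
  exact Set.indicator_of_notMem (by simp only [Set.mem_Ioi, not_lt]; exact hx.2) _

lemma PI_cont (f : G2) : Continuous fun t => PI t f :=
  intervalIntegral.continuous_primitive (fun a b => ext0_ii f a b) 0

/-- double primitive -/
def DPI (t : ℝ) : G2 →L[ℂ] ℂ :=
  LinearMap.mkContinuous
    { toFun := fun f => ∫ s in (0:ℝ)..t, PI s f
      map_add' := fun f g => by
        simp only [map_add]
        exact intervalIntegral.integral_add ((PI_cont f).intervalIntegrable _ _)
          ((PI_cont g).intervalIntegrable _ _)
      map_smul' := fun c f => by
        simp only [map_smul, RingHom.id_apply]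
        exact intervalIntegral.integral_smul _ _ }
    (Real.sqrt |t| * |t|) (fun f => by
      have := intervalIntegral.norm_integral_le_of_norm_le_const (a := 0) (b := t)
        (f := fun s => PI s f) (C := Real.sqrt |t| * ‖f‖) (fun x hx => by
          refine (PI_norm x f).trans ?_
          refine mul_le_mul_of_nonneg_right (Real.sqrt_le_sqrt ?_) (norm_nonneg _)
          rcases Set.mem_uIoc.mp hx with h | h
          · rw [abs_of_pos h.1, abs_of_pos (h.1.trans_le h.2)]; exact h.2
          · rw [abs_of_nonpos h.2, abs_of_neg (h.1.trans_le h.2)]; linarith [h.1])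
      rw [sub_zero] at this
      refine this.trans (le_of_eq ?_)
      ring)

lemma DPI_def (t : ℝ) (f : G2) : DPI t f = ∫ s in (0:ℝ)..t, PI s f := rfl

lemma ae_of_PI {f : G2} {g : ℝ → ℂ} (hg : LocallyIntegrable g volume)
    (h : ∀ t : ℝ, 0 ≤ t → PI t f = ∫ s in (0:ℝ)..t, g s) : f =ᵐ[mu0] g := by
  set d : ℝ → ℂ := ext0 f - (Set.Ioi (0:ℝ)).indicator g with hd
  have hgi : LocallyIntegrable ((Set.Ioi (0:ℝ)).indicator g) volume := hg.indicator measurableSet_Ioi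
  have hdl : LocallyIntegrable d volume := (ext0_loc f).sub hgi
  have hii : ∀ {u : ℝ → ℂ}, LocallyIntegrable u volume → ∀ a b, IntervalIntegrable u volume a b :=
    fun hu a b => intervalIntegrable_iff.mpr
      ((hu.integrableOn_isCompact isCompact_uIcc).mono_set Set.uIoc_subset_uIcc)
  have h0 : ∀ t : ℝ, 0 ≤ t → ∫ s in (0:ℝ)..t, d s = 0 := by
    intro t ht
    have := intervalIntegral.integral_sub (ext0_ii f 0 t) (hii hgi 0 t)
    rw [hd]
    refine this.trans ?_
    rw [← PI_def, h t ht, sub_eq_zero]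
    refine intervalIntegral.integral_congr_ae (Filter.Eventually.of_forall fun x hx => ?_)
    rw [Set.uIoc_of_le ht] at hx
    exact (Set.indicator_of_mem (show x ∈ Set.Ioi (0:ℝ) from hx.1) g).symm
  have h1 := LocallyIntegrable.ae_hasDerivAt_integral hdl
  rw [Filter.EventuallyEq, ae_restrict_iff' measurableSet_Ioi]
  filter_upwards [h1] with x hx hx0
  have h2 := hx 0
  have h3 : HasDerivAt (fun t => ∫ s in (0:ℝ)..t, d s) 0 x := by
    refine (hasDerivAt_const x (0:ℂ)).congr_of_eventuallyEq ?_
    filter_upwards [Ioi_mem_nhds hx0] with t ht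
    exact h0 t (le_of_lt ht)
  have h4 := h2.unique h3
  simp only [hd, Pi.sub_apply, ext0, Set.indicator_of_mem hx0, sub_eq_zero] at h4
  exact h4

lemma PI_congr {f : G2} {g : ℝ → ℂ} (h : f =ᵐ[mu0] g) {t : ℝ} (ht : 0 ≤ t) :
    PI t f = ∫ s in (0:ℝ)..t, g s := by
  refine intervalIntegral.integral_congr_ae ((ext0_congr h).mono fun x hx hxt => ?_)
  rw [Set.uIoc_of_le ht] at hxt
  rw [hx]; exact Set.indicator_of_mem (show x ∈ Set.Ioi (0:ℝ) from hxt.1) g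

/-- uniform bound for a function with `L²` derivative -/
lemma sup_bound {f g : G2} {C : ℂ} (h : f =ᵐ[mu0] fun t => C + PI t g) (t : ℝ) :
    ‖C + PI t g‖ ≤ ‖f‖ + ‖g‖ := by
  have key : ∀ t : ℝ, 0 ≤ t → ‖C + PI t g‖ ≤ ‖f‖ + ‖g‖ := by
    intro t ht
    have hc : Continuous fun s => ‖C + PI s g‖ := (continuous_const.add (PI_cont g)).norm
    have h1 : ∫ s in t..(t+1), ‖ext0 f s‖ = ∫ s in t..(t+1), ‖C + PI s g‖ := by
      refine intervalIntegral.integral_congr_ae ((ext0_congr h).mono fun x hx hxt => ?_)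
      rw [Set.uIoc_of_le (by linarith)] at hxt
      rw [hx, Set.indicator_of_mem (show x ∈ Set.Ioi (0:ℝ) from lt_of_le_of_lt ht hxt.1)]
    have h2 := ext0_norm_int f (a := t) (b := t+1) (by linarith)
    rw [h1] at h2
    have h3 : ∫ s in t..(t+1), (‖C + PI t g‖ - ‖g‖) ≤ ∫ s in t..(t+1), ‖C + PI s g‖ := by
      refine intervalIntegral.integral_mono_on (by linarith) (by simp)
        (hc.intervalIntegrable _ _) fun s hs => ?_
      have h4 := ext0_int_le g t s
      rw [← PI_sub] at h4
      have h5 : Real.sqrt |s - t| ≤ 1 := by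
        rw [Real.sqrt_le_one, abs_of_nonneg (by linarith [hs.1])]; linarith [hs.2]
      have h6 : ‖C + PI t g‖ ≤ ‖C + PI s g‖ + ‖PI s g - PI t g‖ := by
        have : C + PI t g = (C + PI s g) - (PI s g - PI t g) := by ring
        rw [this]; exact norm_sub_le _ _
      nlinarith [norm_nonneg g]
    rw [intervalIntegral.integral_const] at h3
    simp at h2 h3
    linarith
  rcases le_total 0 t with ht | ht
  · exact key t ht
  · have := key 0 le_rfl
    rw [PI_neg le_rfl] at this
    rwa [PI_neg ht]

/-- integration by parts -/
lemma fub_ibp {α β : ℝ → ℂ} {B : ℝ} (hB : 0 ≤ B) (hα : IntervalIntegrable α volume 0 B)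
    (hβ : IntervalIntegrable β volume 0 B) :
    (∫ t in (0:ℝ)..B, α t * ∫ s in (0:ℝ)..t, β s) + (∫ t in (0:ℝ)..B, (∫ s in (0:ℝ)..t, α s) * β t)
      = (∫ s in (0:ℝ)..B, α s) * ∫ s in (0:ℝ)..B, β s := by
  rw [intervalIntegrable_iff_integrableOn_Ioc_of_le hB] at hα hβ
  set μ : Measure ℝ := volume.restrict (Set.Ioc 0 B) with hμ
  have hf : Integrable (fun z : ℝ × ℝ => α z.1 * β z.2) (μ.prod μ) := Integrable.mul_prod hα hβ
  have hS : MeasurableSet {z : ℝ × ℝ | z.2 ≤ z.1} := measurableSet_le measurable_snd measurable_fst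
  have hin : ∀ (γ : ℝ → ℂ) (t : ℝ), t ∈ Set.Ioc 0 B →
      ∫ s in (0:ℝ)..t, γ s = ∫ s, (Set.Iic t).indicator γ s ∂μ := by
    intro γ t ht
    rw [intervalIntegral.integral_of_le ht.1.le, integral_indicator measurableSet_Iic, hμ,
      Measure.restrict_restrict measurableSet_Iic]
    congr 2
    ext s; simp only [Set.mem_Ioc, Set.mem_inter_iff, Set.mem_Iic]
    constructor
    · intro h; exact ⟨h.2, h.1, h.2.trans ht.2⟩
    · intro h; exact ⟨h.2.1, h.1⟩
  have hin' : ∀ (γ : ℝ → ℂ) (t : ℝ), t ∈ Set.Ioc 0 B →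
      ∫ s in (0:ℝ)..t, γ s = ∫ s, (Set.Iio t).indicator γ s ∂μ := by
    intro γ t ht
    rw [hin γ t ht]
    refine integral_congr_ae (ae_restrict_of_ae ?_)
    filter_upwards [compl_mem_ae_iff.mpr (measure_singleton t)] with s hs
    have : s ≠ t := hs
    by_cases h : s < t
    · simp [h, h.le]
    · have h' : ¬ s ≤ t := fun h2 => h (lt_of_le_of_ne h2 this)
      simp [h, h']
  have e1 : (∫ t in (0:ℝ)..B, α t * ∫ s in (0:ℝ)..t, β s) =
      ∫ z in {z : ℝ × ℝ | z.2 ≤ z.1}, α z.1 * β z.2 ∂(μ.prod μ) := by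
    rw [← integral_indicator hS, integral_prod _ (hf.indicator hS),
      intervalIntegral.integral_of_le hB]
    refine setIntegral_congr_fun measurableSet_Ioc fun t ht => ?_
    rw [hin β t ht, ← integral_const_mul]
    refine integral_congr_ae (Filter.Eventually.of_forall fun s => ?_)
    by_cases h : s ≤ t <;> simp [Set.indicator, h]
  have e2 : (∫ t in (0:ℝ)..B, (∫ s in (0:ℝ)..t, α s) * β t) =
      ∫ z in {z : ℝ × ℝ | z.2 ≤ z.1}ᶜ, α z.1 * β z.2 ∂(μ.prod μ) := by
    rw [← integral_indicator hS.compl, integral_prod_symm _ (hf.indicator hS.compl),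
      intervalIntegral.integral_of_le hB]
    refine setIntegral_congr_fun measurableSet_Ioc fun t ht => ?_
    rw [hin' α t ht, ← integral_mul_const]
    refine integral_congr_ae (Filter.Eventually.of_forall fun s => ?_)
    by_cases h : s < t <;> simp [Set.indicator, h]
  rw [e1, e2, integral_add_compl hS hf, integral_prod_mul,
    intervalIntegral.integral_of_le hB, intervalIntegral.integral_of_le hB]

end half

section half2

lemma inner_G2_eq {f g : G2} {B : ℝ} (hB : 0 ≤ B) {u v : ℝ → ℂ} (hu : f =ᵐ[mu0] u)
    (hv : g =ᵐ[mu0] v) (h0 : ∀ t, B < t → v t = 0) :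
    inner ℂ f g = ∫ t in (0:ℝ)..B, starRingEnd ℂ (u t) * v t := by
  rw [L2.inner_def, intervalIntegral.integral_of_le hB]
  have e : ∫ a, inner ℂ (f a) (g a) ∂mu0 = ∫ a in Set.Ioi (0:ℝ), starRingEnd ℂ (u a) * v a := by
    refine integral_congr_ae ?_
    filter_upwards [hu, hv] with x hx hy
    rw [hx, hy, RCLike.inner_apply, mul_comm]
  rw [e]
  refine (setIntegral_eq_of_subset_of_forall_sdiff_eq_zero measurableSet_Ioi
    (fun x hx => hx.1) fun x hx => ?_)
  have : B < x := by
    by_contra h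
    exact hx.2 ⟨hx.1, not_lt.mp h⟩
  rw [h0 x this, mul_zero]

lemma PI_memLp_Ioc (Q : G2) (B : ℝ) :
    MemLp (fun t => PI t Q) 2 (volume.restrict (Set.Ioc 0 B)) := by
  refine MemLp.of_bound (PI_cont Q).aestronglyMeasurable (Real.sqrt B * ‖Q‖) ?_
  rw [ae_restrict_iff' measurableSet_Ioc]
  refine Filter.Eventually.of_forall fun t ht => (PI_norm t Q).trans ?_
  refine mul_le_mul_of_nonneg_right (Real.sqrt_le_sqrt ?_) (norm_nonneg _)
  rw [abs_of_pos ht.1]; exact ht.2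

lemma weak_const_B {p Q : G2}
    (h : ∀ θ W : G2, (W =ᵐ[mu0] fun t => PI t θ) → inner ℂ p θ = inner ℂ Q W) {B : ℝ} (hB : 0 < B) :
    ∃ m : ℂ, ∀ᵐ t ∂(volume.restrict (Set.Ioc 0 B)), ext0 p t + PI t Q = m := by
  set F : ℝ → ℂ := fun t => ext0 p t + PI t Q with hF
  have hFi : IntervalIntegrable F volume 0 B :=
    (ext0_ii p 0 B).add ((PI_cont Q).intervalIntegrable _ _)
  set m : ℂ := (B : ℂ)⁻¹ * ∫ t in (0:ℝ)..B, F t with hm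
  set D : ℝ → ℂ := fun t => F t - m with hD
  have hDi : IntervalIntegrable D volume 0 B := hFi.sub (by simp)
  have hD0 : ∫ t in (0:ℝ)..B, D t = 0 := by
    rw [hD, intervalIntegral.integral_sub hFi (by simp), intervalIntegral.integral_const, hm]
    simp only [sub_zero, Complex.real_smul]
    have : (B:ℂ) ≠ 0 := by exact_mod_cast hB.ne'
    rw [mul_inv_cancel_left₀ this, sub_self]
  have hDm : MemLp D 2 (volume.restrict (Set.Ioc 0 B)) := by
    refine MemLp.sub (MemLp.add ((ext0_memLp p).restrict _) ?_) (memLp_const m)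
    exact PI_memLp_Ioc Q B
  set E : ℝ → ℂ := (Set.Ioc 0 B).indicator D with hE
  have hEm : MemLp E 2 mu0 := ((memLp_indicator_iff_restrict measurableSet_Ioc).mpr hDm).restrict _
  set θ : G2 := hEm.toLp E with hθ
  have hθE : θ =ᵐ[mu0] E := hEm.coeFn_toLp
  have hPθ : ∀ t, 0 ≤ t → PI t θ = ∫ s in (0:ℝ)..t, E s := fun t ht => PI_congr hθE ht
  have hEint : IntervalIntegrable E volume 0 B := by
    rw [intervalIntegrable_iff_integrableOn_Ioc_of_le hB.le] at hDi ⊢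
    exact hDi.congr_fun (fun x hx => (Set.indicator_of_mem hx D).symm) measurableSet_Ioc
  have hEB : ∫ s in (0:ℝ)..B, E s = 0 := by
    rw [← hD0]
    refine intervalIntegral.integral_congr_ae (Filter.Eventually.of_forall fun x hx => ?_)
    rw [Set.uIoc_of_le hB.le] at hx
    exact Set.indicator_of_mem hx D
  have hPB : ∀ t, B ≤ t → PI t θ = 0 := by
    intro t ht
    have h1 := PI_sub B t θ
    rw [hPθ B hB.le, hEB, sub_zero] at h1
    rw [h1, intervalIntegral.integral_of_le ht]
    refine (setIntegral_congr_ae measurableSet_Ioc ((ext0_congr hθE).mono fun x hx hxt => ?_)).trans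
      (integral_zero _ _)
    rw [hx]
    have : x ∉ Set.Ioc 0 B := fun h => absurd hxt.1 (not_lt.mpr h.2)
    simp [Set.indicator, hE, this]
  have hWm : MemLp (fun t => PI t θ) 2 mu0 := by
    refine MemLp.restrict _ ?_
    refine (PI_cont θ).memLp_of_hasCompactSupport ?_
    refine HasCompactSupport.of_support_subset_isCompact (isCompact_Icc (a := (0:ℝ)) (b := B)) ?_
    intro t ht
    constructor
    · by_contra h; exact ht (PI_neg (by linarith) θ)
    · by_contra h; exact ht (hPB t (by linarith))
  have key := h θ (hWm.toLp _) hWm.coeFn_toLp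
  rw [inner_G2_eq hB.le (ext0_ae p) hθE (fun t ht => Set.indicator_of_notMem
      (fun h => absurd ht (not_lt.mpr h.2)) D),
    inner_G2_eq hB.le (ext0_ae Q) hWm.coeFn_toLp (fun t ht => hPB t ht.le)] at key
  have hQc : IntervalIntegrable (fun t => starRingEnd ℂ (ext0 Q t)) volume 0 B := by
    have := ext0_ii Q 0 B
    rw [intervalIntegrable_iff] at this ⊢
    exact (Complex.conjCLE.toContinuousLinearMap).integrable_comp this
  have ibp := fub_ibp hB.le hQc hEint
  rw [hEB, mul_zero] at ibp
  have e1 : (∫ t in (0:ℝ)..B, starRingEnd ℂ (ext0 Q t) * ∫ s in (0:ℝ)..t, E s) =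
      ∫ t in (0:ℝ)..B, starRingEnd ℂ (ext0 Q t) * PI t θ := by
    refine intervalIntegral.integral_congr fun t ht => ?_
    rw [Set.uIcc_of_le hB.le] at ht
    rw [hPθ t ht.1]
  have e2 : (∫ t in (0:ℝ)..B, (∫ s in (0:ℝ)..t, starRingEnd ℂ (ext0 Q s)) * E t) =
      ∫ t in (0:ℝ)..B, starRingEnd ℂ (PI t Q) * E t := by
    refine intervalIntegral.integral_congr fun t ht => ?_
    rw [PI_def]
    congr 1
    rw [intervalIntegral.intervalIntegral_eq_integral_uIoc,
      intervalIntegral.intervalIntegral_eq_integral_uIoc, integral_conj]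
    split_ifs <;> simp
  rw [e1, e2, ← key] at ibp
  have hL2 : ∀ {u v : ℝ → ℂ}, MemLp u 2 (volume.restrict (Set.Ioc 0 B)) →
      MemLp v 2 (volume.restrict (Set.Ioc 0 B)) →
      IntervalIntegrable (fun t => starRingEnd ℂ (u t) * v t) volume 0 B := by
    intro u v hu hv
    rw [intervalIntegrable_iff_integrableOn_Ioc_of_le hB.le]
    exact MemLp.integrable_mul (p := 2) (q := 2) hu.star hv
  have hPm : MemLp (fun t => PI t Q) 2 (volume.restrict (Set.Ioc 0 B)) := by
    exact PI_memLp_Ioc Q B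
  have hEm2 : MemLp E 2 (volume.restrict (Set.Ioc 0 B)) :=
    ((memLp_indicator_iff_restrict measurableSet_Ioc).mpr hDm).restrict _
  rw [← intervalIntegral.integral_add (hL2 ((ext0_memLp p).restrict _) hEm2) (hL2 hPm hEm2)] at ibp
  have e3 : ∫ t in (0:ℝ)..B, starRingEnd ℂ (D t) * D t = 0 := by
    have e4 : ∫ t in (0:ℝ)..B, starRingEnd ℂ (D t) * D t =
        ∫ t in (0:ℝ)..B, ((starRingEnd ℂ (ext0 p t) * E t + starRingEnd ℂ (PI t Q) * E t)
          - starRingEnd ℂ m * D t) := by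
      refine intervalIntegral.integral_congr_ae (Filter.Eventually.of_forall fun t ht => ?_)
      rw [Set.uIoc_of_le hB.le] at ht
      rw [hE, Set.indicator_of_mem ht]
      simp only [hD, hF, map_sub, map_add]
      ring
    rw [e4, intervalIntegral.integral_sub
      ((hL2 ((ext0_memLp p).restrict _) hEm2).add (hL2 hPm hEm2)) (hDi.const_mul _), ibp,
      intervalIntegral.integral_const_mul, hD0]
    simp
  refine ⟨m, ?_⟩
  have e5 : ∫ t in Set.Ioc 0 B, ‖D t‖ ^ 2 = 0 := by
    rw [intervalIntegral.integral_of_le hB.le] at e3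
    have : ∫ t in Set.Ioc 0 B, starRingEnd ℂ (D t) * D t =
        ((∫ t in Set.Ioc 0 B, ‖D t‖ ^ 2 : ℝ) : ℂ) := by
      refine Eq.trans ?_ (integral_ofReal (𝕜 := ℂ))
      refine integral_congr_ae (Filter.Eventually.of_forall fun t => ?_)
      show starRingEnd ℂ (D t) * D t = ((‖D t‖ ^ 2 : ℝ) : ℂ)
      rw [mul_comm, Complex.mul_conj, Complex.normSq_eq_norm_sq]
    rw [this] at e3
    exact_mod_cast e3
  rw [integral_eq_zero_iff_of_nonneg (fun t => by positivity)
    ((memLp_two_iff_integrable_sq_norm hDm.1).mp hDm)] at e5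
  filter_upwards [e5] with t ht
  have : D t = 0 := by simpa using ht
  exact sub_eq_zero.mp this

theorem weak_const {p Q : G2}
    (h : ∀ θ W : G2, (W =ᵐ[mu0] fun t => PI t θ) → inner ℂ p θ = inner ℂ Q W) :
    ∃ C : ℂ, p =ᵐ[mu0] fun t => C + PI t (-Q) := by
  choose m hm using fun N : ℕ => weak_const_B h (B := (N:ℝ) + 1) (by positivity)
  have hm0 : ∀ N, m N = m 0 := by
    intro N
    have h0 := hm 0
    have h1 : ∀ᵐ t ∂(volume.restrict (Set.Ioc (0:ℝ) ((0:ℕ) + 1))), ext0 p t + PI t Q = m N :=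
      ae_mono (Measure.restrict_mono (Set.Ioc_subset_Ioc_right (by gcongr; simp)) le_rfl) (hm N)
    have hne : (volume.restrict (Set.Ioc (0:ℝ) ((0:ℕ) + 1))) ≠ 0 := by
      rw [Ne, Measure.restrict_eq_zero]
      simp
    have : Filter.NeBot (ae (volume.restrict (Set.Ioc (0:ℝ) ((0:ℕ) + 1)))) := ae_neBot.mpr hne
    obtain ⟨t, ha, hb⟩ := (h0.and h1).exists
    rw [← ha, ← hb]
  refine ⟨m 0, ?_⟩
  have h2 : ∀ᵐ t ∂(volume : Measure ℝ), ∀ N : ℕ, t ∈ Set.Ioc (0:ℝ) (N+1) → ext0 p t + PI t Q = m N :=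
    ae_all_iff.mpr fun N => (ae_restrict_iff' measurableSet_Ioc).mp (hm N)
  rw [Filter.EventuallyEq, ae_restrict_iff' measurableSet_Ioi]
  filter_upwards [h2] with t ht ht0
  obtain ⟨N, hN⟩ := exists_nat_ge t
  have := ht N ⟨ht0, by linarith⟩
  rw [hm0 N] at this
  rw [← this, map_neg, ext0, Set.indicator_of_mem ht0]
  ring

variable {n : ℕ}

lemma conv_continuous {f : (Fin n → ℤ) → ℝ → ℂ} (hf : RDu Set.univ f) (hc : ∀ k, Continuous (f k))
    {β : (Fin n → ℤ) → ℂ} (hβ : RD β) (k : Fin n → ℤ) : Continuous (conv β f k) := by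
  obtain ⟨C, hC0, hC⟩ := hf.conv_bound hβ 0
  refine continuous_tsum (fun l => continuous_const.mul (hc _)) ((hβ.summable_norm).mul_left C)
    fun l t => ?_
  simpa using hC k l t trivial

lemma conv_hasSum_int {f : (Fin n → ℤ) → ℝ → ℂ} (hf : RDu Set.univ f) (hc : ∀ k, Continuous (f k))
    {β : (Fin n → ℤ) → ℂ} (hβ : RD β) (k : Fin n → ℤ) (a b : ℝ) :
    HasSum (fun l => ∫ t in a..b, β l * f (k - l) t) (∫ t in a..b, conv β f k t) := by
  obtain ⟨C, hC0, hC⟩ := hf.conv_bound hβ 0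
  refine intervalIntegral.hasSum_integral_of_dominated_convergence (fun l _ => C * ‖β l‖)
    (fun l => (continuous_const.mul (hc _)).aestronglyMeasurable)
    (fun l => Filter.Eventually.of_forall fun t _ => by simpa using hC k l t trivial)
    (Filter.Eventually.of_forall fun t _ => (hβ.summable_norm).mul_left C)
    (by simp)
    (Filter.Eventually.of_forall fun t _ => (hf.conv_summable hβ k trivial).of_norm.hasSum)

lemma Mop_rep {f : LK n G2} {g : (Fin n → ℤ) → ℝ → ℂ} (hfg : ∀ k, f k =ᵐ[mu0] g k)
    (hg : RDu Set.univ g) (hc : ∀ k, Continuous (g k)) {β : (Fin n → ℤ) → ℂ} (hβ : RD β)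
    (k : Fin n → ℤ) : Mop β f k =ᵐ[mu0] conv β g k := by
  refine ae_of_PI (conv_continuous hg hc hβ k).locallyIntegrable fun t ht => ?_
  have h1 := (Mop_coord_hasSum hβ.summable_norm f k).mapL (PI t)
  have h2 := conv_hasSum_int hg hc hβ k 0 t
  refine h1.unique ?_
  refine (congrArg (fun u => HasSum u _) (funext fun l => ?_)).mpr h2
  rw [map_smul, PI_congr (hfg (k - l)) ht, intervalIntegral.integral_const_mul, smul_eq_mul]

lemma RD_Mop {G : Type*} [NormedAddCommGroup G] [InnerProductSpace ℂ G] [CompleteSpace G]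
    {f : LK n G} (hf : RD fun k => f k) {β : (Fin n → ℤ) → ℂ} (hβ : RD β) :
    RD (fun k => Mop β f k) := by
  intro s
  obtain ⟨C, hC⟩ := hf s
  have hC0 : 0 ≤ C := le_trans (by have := wt_pos (0 : Fin n → ℤ); positivity) (hC 0)
  refine ⟨C * ∑' l, ‖β l‖ * wt l ^ s, fun k => ?_⟩
  have hk := wt_pos k
  have hb : ∀ l, ‖β l • f (k - l)‖ * wt k ^ s ≤ C * (‖β l‖ * wt l ^ s) := by
    intro l
    have h1 := wt_pos l
    have h2 := wt_pos (k - l)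
    rw [norm_smul]
    calc ‖β l‖ * ‖f (k - l)‖ * wt k ^ s ≤ ‖β l‖ * ‖f (k - l)‖ * (wt l * wt (k - l)) ^ s := by
          gcongr; exact wt_sub_le k l
      _ = (‖f (k - l)‖ * wt (k - l) ^ s) * (‖β l‖ * wt l ^ s) := by ring
      _ ≤ _ := by gcongr; exact hC _
  have hs : Summable fun l => ‖β l • f (k - l)‖ * wt k ^ s :=
    Summable.of_nonneg_of_le (fun l => by positivity) hb ((hβ.summable_norm_mul s).mul_left C)
  have hs' : Summable fun l => ‖β l • f (k - l)‖ := by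
    have := hs.mul_right (wt k ^ s)⁻¹
    refine this.congr fun l => ?_
    field_simp
  show ‖Mop β f k‖ * wt k ^ s ≤ _
  have e := (Mop_coord_hasSum hβ.summable_norm f k).tsum_eq
  rw [← e]
  calc _ ≤ (∑' l, ‖β l • f (k - l)‖) * wt k ^ s := by
        gcongr; exact norm_tsum_le_tsum_norm hs'
    _ = ∑' l, ‖β l • f (k - l)‖ * wt k ^ s := (tsum_mul_right).symm
    _ ≤ ∑' l, C * (‖β l‖ * wt l ^ s) :=
        Summable.tsum_le_tsum hb hs ((hβ.summable_norm_mul s).mul_left C)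
    _ = _ := tsum_mul_left

end half2

section pde
variable {n : ℕ}

lemma RD.toRDu {f : (Fin n → ℤ) → ℂ} (hf : RD f) (S : Set ℝ) : RDu S (fun k _ => f k) := by
  intro s
  obtain ⟨C, hC⟩ := hf s
  exact ⟨C, fun k t _ => hC k⟩

lemma RDu.at {f : (Fin n → ℤ) → ℝ → ℂ} {S : Set ℝ} (hf : RDu S f) {t : ℝ} (ht : t ∈ S) :
    RD (fun k => f k t) := by
  intro s
  obtain ⟨C, hC⟩ := hf s
  exact ⟨C, fun k => hC k t ht⟩

lemma RD.cvs {β γ : (Fin n → ℤ) → ℂ} (hβ : RD β) (hγ : RD γ) : RD (cvs β γ) :=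
  ((hγ.toRDu Set.univ).conv hβ).at (t := 0) trivial

lemma RD.add {E : Type*} [SeminormedAddCommGroup E] {f g : (Fin n → ℤ) → E}
    (hf : RD f) (hg : RD g) : RD (fun k => f k + g k) := by
  intro s
  obtain ⟨C, hC⟩ := hf s
  obtain ⟨D, hD⟩ := hg s
  refine ⟨C + D, fun k => ?_⟩
  have := wt_pos k
  calc _ ≤ (‖f k‖ + ‖g k‖) * wt k ^ s := by gcongr; exact norm_add_le _ _
    _ = ‖f k‖ * wt k ^ s + ‖g k‖ * wt k ^ s := by ring
    _ ≤ _ := add_le_add (hC k) (hD k)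

lemma RD_zero {E : Type*} [SeminormedAddCommGroup E] : RD (fun _ : Fin n → ℤ => (0 : E)) :=
  fun s => ⟨0, fun k => by simp⟩

lemma RD_sum {ι : Type*} {E : Type*} [SeminormedAddCommGroup E] (S : Finset ι)
    {f : ι → (Fin n → ℤ) → E}
    (hf : ∀ i ∈ S, RD (f i)) : RD (fun k => ∑ i ∈ S, f i k) := by
  induction S using Finset.induction_on with
  | empty => simpa using RD_zero
  | insert a S ha ih =>
    simp only [Finset.sum_insert ha]
    exact (hf a (by simp)).add (ih fun i hi => hf i (by simp [hi]))

lemma RDu_sum {ι : Type*} (T : Finset ι) {S : Set ℝ}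
    {f : ι → (Fin n → ℤ) → ℝ → ℂ}
    (hf : ∀ i ∈ T, RDu S (f i)) : RDu S (fun k t => ∑ i ∈ T, f i k t) := by
  induction T using Finset.induction_on with
  | empty => simpa using (RD_zero (n := n) (E := ℂ)).toRDu S
  | insert a T ha ih =>
    simp only [Finset.sum_insert ha]
    exact (hf a (by simp)).add (ih fun i hi => hf i (by simp [hi]))

lemma RD.smul_symbol {E : Type*} [SeminormedAddCommGroup E] [NormedSpace ℂ E]
    {f : (Fin n → ℤ) → E} (hf : RD f) (j : Fin n) :
    RD (fun k => symb j k • f k) := by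
  intro s
  obtain ⟨C, hC⟩ := hf (s + 1)
  refine ⟨2 * Real.pi * C, fun k => ?_⟩
  have := symb_norm_le j k
  have hp := Real.pi_pos
  have := wt_pos k
  calc ‖symb j k • f k‖ * wt k ^ s ≤ (‖symb j k‖ * ‖f k‖) * wt k ^ s := by
        gcongr; exact norm_smul_le _ _
    _ ≤ (2 * Real.pi * wt k ^ 1) * ‖f k‖ * wt k ^ s := by gcongr
    _ = 2 * Real.pi * (‖f k‖ * wt k ^ (s + 1)) := by ring
    _ ≤ _ := by gcongr; exact hC k

lemma RDu.neg {S : Set ℝ} {f : (Fin n → ℤ) → ℝ → ℂ} (hf : RDu S f) :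
    RDu S (fun k t => - f k t) := by
  intro s
  obtain ⟨C, hC⟩ := hf s
  exact ⟨C, fun k t ht => by rw [norm_neg]; exact hC k t ht⟩

lemma RD.smul_const {E : Type*} [SeminormedAddCommGroup E] [NormedSpace ℂ E]
    {f : (Fin n → ℤ) → ℂ} (hf : RD f) (e : E) : RD (fun k => f k • e) := by
  intro s
  obtain ⟨C, hC⟩ := hf s
  refine ⟨C * ‖e‖, fun k => ?_⟩
  have := wt_pos k
  calc ‖f k • e‖ * wt k ^ s ≤ (‖f k‖ * ‖e‖) * wt k ^ s := by gcongr; exact norm_smul_le _ _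
    _ = (‖f k‖ * wt k ^ s) * ‖e‖ := by ring
    _ ≤ _ := by gcongr; exact hC k

section LKabs
variable {G : Type*} [NormedAddCommGroup G] [InnerProductSpace ℂ G] [CompleteSpace G]

/-- rapidly decaying families as elements of `ℓ²` -/
def mkLK (f : (Fin n → ℤ) → G) (hf : RD f) : LK n G :=
  ⟨f, (lk_memlp_iff f).mpr (by
    have h1 := hf.summable_norm
    obtain ⟨C, hC⟩ := hf 0
    refine Summable.of_nonneg_of_le (fun k => by positivity) (fun k => ?_) (h1.mul_left C)
    have := hC k
    rw [pow_zero, mul_one] at this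
    rw [sq]; gcongr)⟩

lemma mkLK_apply (f : (Fin n → ℤ) → G) (hf : RD f) (k) : mkLK f hf k = f k := rfl

lemma Mop_add' {β γ : (Fin n → ℤ) → ℂ} (hβ : Summable fun l => ‖β l‖) (hγ : Summable fun l => ‖γ l‖)
    (f : LK n G) : Mop (fun k => β k + γ k) f = Mop β f + Mop γ f := by
  have hs : Summable fun l => ‖β l + γ l‖ :=
    Summable.of_nonneg_of_le (fun _ => norm_nonneg _) (fun l => norm_add_le _ _) (hβ.add hγ)
  refine (Mop_apply_hasSum hs f).unique ?_
  refine (congrArg (fun u => HasSum u _) (funext fun l => ?_)).mpr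
    ((Mop_apply_hasSum hβ f).add (Mop_apply_hasSum hγ f))
  rw [add_smul]

lemma Mop_sum' {ι : Type*} (S : Finset ι) {β : ι → (Fin n → ℤ) → ℂ} (hβ : ∀ i, RD (β i))
    (f : LK n G) : Mop (fun k => ∑ i ∈ S, β i k) f = ∑ i ∈ S, Mop (β i) f := by
  induction S using Finset.induction_on with
  | empty =>
    have h := Mop_apply_hasSum (β := fun _ : Fin n → ℤ => 0) (by simpa using summable_zero) f
    simp only [Finset.sum_empty]
    refine h.unique ?_
    simp only [zero_smul]
    exact hasSum_zero
  | insert a S ha ih =>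
    simp only [Finset.sum_insert ha]
    rw [Mop_add' (hβ a).summable_norm (RD_sum S fun i _ => hβ i).summable_norm, ih]

lemma RD_delta : RD (fun k : Fin n → ℤ => if k = 0 then (1:ℂ) else 0) := by
  intro s
  refine ⟨1, fun k => ?_⟩
  by_cases h : k = 0
  · subst h; simp [wt]
  · simp [h]

/-- inversion of the vertical equation -/
lemma Z_formula {b : Fin n → (Fin n → ℤ) → ℂ} (hb : ∀ i, RD (b i)) {c : (Fin n → ℤ) → ℂ} (hc : RD c)
    (hinv : cvs c (fun k => (if k = 0 then 1 else 0) + ∑ i, cvs (b i) (b i) k)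
      = fun k => if k = 0 then 1 else 0) (Z : LK n G) (X : Fin n → LK n G) :
    Z = Mop c ((Z + ∑ i, Mop (b i) (X i + Mop (b i) Z)) - ∑ i, Mop (b i) (X i)) := by
  have h1 : (Z + ∑ i, Mop (b i) (X i + Mop (b i) Z)) - ∑ i, Mop (b i) (X i) =
      Mop (fun k => (if k = 0 then 1 else 0) + ∑ i, cvs (b i) (b i) k) Z := by
    rw [Mop_add' RD_delta.summable_norm
      (RD_sum Finset.univ fun i _ => (hb i).cvs (hb i)).summable_norm,
      Mop_sum' _ (fun i => (hb i).cvs (hb i)), Mop_delta]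
    have : ∀ i, Mop (cvs (b i) (b i)) Z = Mop (b i) (Mop (b i) Z) := fun i =>
      (Mop_mul (hb i).summable_norm (hb i).summable_norm Z).symm
    simp only [this, map_add, Finset.sum_add_distrib]
    have h1 : (1 : LK n G →L[ℂ] LK n G) Z = Z := rfl
    rw [h1]
    abel
  rw [h1, Mop_mul hc.summable_norm (RD_delta.add
    (RD_sum Finset.univ fun i _ => (hb i).cvs (hb i))).summable_norm, hinv, Mop_delta]
  rfl

/-- orthogonality in components -/
lemma orth_comp {b : Fin n → (Fin n → ℤ) → ℂ} (hb : ∀ i, RD (b i))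
    (hreal : ∀ i l, b i (-l) = starRingEnd ℂ (b i l)) (U w : HH (Fin n) (LK n G))
    (h : inner ℂ (TT (fun i => Mop (b i)) U) (TT (fun i => Mop (b i)) w) = 0)
    (k : Fin n → ℤ) (θ : G) (W : Fin n → G)
    (h1 : w none = lp.single 2 k θ) (h2 : ∀ i, w (some i) = lp.single 2 k (W i)) :
    inner ℂ ((U none + ∑ i, Mop (b i) (U (some i) + Mop (b i) (U none)) : LK n G) k) θ
      + ∑ i, inner ℂ ((U (some i) + Mop (b i) (U none) : LK n G) k) (W i) = 0 := by
  have hM : ∀ i (f g : LK n G), inner ℂ (Mop (b i) f) g = inner ℂ f (Mop (b i) g) := fun i f g =>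
    Mop_inner (hb i).summable_norm (hreal i) f g
  rw [← TTs_inner _ hM, HH_inner] at h
  simp only [TTs_none, TTs_some, TT_none, TT_some, h1, h2] at h
  simp only [lp.inner_single_right] at h
  exact h

end LKabs

/-- evaluation functional defining the energy space -/
def Lfun (i : Fin n) (k : Fin n → ℤ) (t : ℝ) : HH (Fin n) (LK n G2) →L[ℂ] ℂ :=
  ((PI t).comp (lp.evalCLM ℂ (fun _ : Fin n → ℤ => G2) 2 k)).comp (prj (some i)) -
    symb i k • ((DPI t).comp (lp.evalCLM ℂ (fun _ : Fin n → ℤ => G2) 2 k)).comp (prj none)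

lemma Lfun_apply (i : Fin n) (k : Fin n → ℤ) (t : ℝ) (U : HH (Fin n) (LK n G2)) :
    Lfun i k t U = PI t (U (some i) k) - symb i k * DPI t (U none k) := rfl

/-- energy space -/
def Vsub (n : ℕ) : Submodule ℂ (HH (Fin n) (LK n G2)) :=
  ⨅ i : Fin n, ⨅ k : Fin n → ℤ, ⨅ t : Set.Ici (0:ℝ), LinearMap.ker (Lfun i k t).toLinearMap

lemma mem_Vsub {U : HH (Fin n) (LK n G2)} : U ∈ Vsub n ↔
    ∀ i k (t : ℝ), 0 ≤ t → PI t (U (some i) k) = symb i k * DPI t (U none k) := by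
  unfold Vsub
  simp only [Submodule.mem_iInf, LinearMap.mem_ker]
  constructor
  · intro h i k t ht
    have := h i k ⟨t, ht⟩
    exact sub_eq_zero.mp this
  · intro h i k t
    exact sub_eq_zero.mpr (h i k t t.2)

lemma Vsub_closed : IsClosed (Vsub n : Set (HH (Fin n) (LK n G2))) := by
  unfold Vsub
  simp only [Submodule.coe_iInf]
  refine isClosed_iInter fun i => isClosed_iInter fun k => isClosed_iInter fun t => ?_
  exact (Lfun i k t).isClosed_ker

lemma Vsub_tau (j : Fin n) (θ : ℝ) (w) (hw : w ∈ Vsub n) : cw (tau j θ) w ∈ Vsub n := by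
  rw [mem_Vsub] at hw ⊢
  intro i k t ht
  rw [cw_apply, cw_apply, tau_apply, tau_apply, map_smul, map_smul, hw i k t ht, smul_eq_mul,
    smul_eq_mul]
  ring

end pde

section pde2
variable {n : ℕ}

lemma exists_lift : ∃ e r : G2, r =ᵐ[mu0] fun t => 1 + PI t e := by
  have hm : MemLp (fun t : ℝ => ((Real.exp (-t) : ℝ) : ℂ)) 2 mu0 := by
    have hc : Continuous (fun t : ℝ => ((Real.exp (-t) : ℝ) : ℂ)) := by fun_prop
    rw [memLp_two_iff_integrable_sq_norm hc.aestronglyMeasurable]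
    refine (exp_neg_integrableOn_Ioi 0 (b := 2) two_pos).congr (Filter.Eventually.of_forall fun t => ?_)
    simp only [Complex.norm_real, Real.norm_eq_abs, abs_of_pos (Real.exp_pos _), sq,
      ← Real.exp_add]
    congr 1; ring
  refine ⟨-(hm.toLp _), hm.toLp _, hm.coeFn_toLp.trans ?_⟩
  rw [Filter.EventuallyEq, ae_restrict_iff' measurableSet_Ioi]
  refine Filter.Eventually.of_forall fun t ht => ?_
  rw [map_neg, PI_congr hm.coeFn_toLp (le_of_lt ht)]
  have : ∫ s in (0:ℝ)..t, ((Real.exp (-s) : ℝ) : ℂ) = 1 - ((Real.exp (-t) : ℝ) : ℂ) := by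
    rw [intervalIntegral.integral_ofReal]
    have : ∫ s in (0:ℝ)..t, Real.exp (-s) = 1 - Real.exp (-t) := by
      rw [intervalIntegral.integral_comp_neg (fun s => Real.exp s), integral_exp]; simp
    rw [this]; push_cast; rfl
  rw [this]; ring

/-- element of `HH` from components -/
def mkHH {K : Type*} [NormedAddCommGroup K] (z : K) (x : Fin n → K) : HH (Fin n) K :=
  WithLp.toLp 2 (fun o => Option.rec z x o)

lemma mkHH_none {K : Type*} [NormedAddCommGroup K] (z : K) (x : Fin n → K) :
    mkHH z x none = z := rfl

lemma mkHH_some {K : Type*} [NormedAddCommGroup K] (z : K) (x : Fin n → K) (i : Fin n) :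
    mkHH z x (some i) = x i := rfl

lemma test_mem (k : Fin n → ℤ) (θ W : G2) (hW : W =ᵐ[mu0] fun t => PI t θ) :
    mkHH (lp.single 2 k θ : LK n G2) (fun i => (lp.single 2 k (symb i k • W) : LK n G2)) ∈ Vsub n := by
  rw [mem_Vsub]
  intro i l t ht
  rw [mkHH_none, mkHH_some]
  by_cases h : l = k
  · subst h
    rw [lp.single_apply_self, lp.single_apply_self, map_smul, PI_congr hW ht, DPI_def, smul_eq_mul]
  · rw [lp.single_apply_ne _ _ _ h, lp.single_apply_ne _ _ _ h, map_zero, map_zero, mul_zero]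

lemma symb_conj (i : Fin n) (k : Fin n → ℤ) : starRingEnd ℂ (symb i k) = - symb i k := by
  unfold symb
  have h2 : starRingEnd ℂ (2:ℂ) = 2 := Complex.conj_ofNat 2
  simp only [map_mul, Complex.conj_ofReal, Complex.conj_I, h2, map_intCast]
  ring

lemma int_add_sum_neg {P : ℝ → ℂ} {F : Fin n → ℝ → ℂ} (hP : Continuous P)
    (hF : ∀ i, Continuous (F i)) (t : ℝ) :
    ∫ s in (0:ℝ)..t, (P s + ∑ i, - F i s) = (∫ s in (0:ℝ)..t, P s) - ∑ i, ∫ s in (0:ℝ)..t, F i s := by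
  have hi : ∀ i, IntervalIntegrable (fun s => - F i s) volume 0 t := fun i =>
    (hF i).neg.intervalIntegrable _ _
  have hS : Continuous (fun s => ∑ i, - F i s) := continuous_finsetSum _ fun i _ => (hF i).neg
  rw [intervalIntegral.integral_add (hP.intervalIntegrable _ _) (hS.intervalIntegrable _ _),
    intervalIntegral.integral_finsetSum fun i _ => hi i]
  simp only [intervalIntegral.integral_neg, Finset.sum_neg_distrib]
  ring

lemma int_sum_mul {m : Fin n → ℂ} {F : Fin n → ℝ → ℂ}
    (hF : ∀ i, Continuous (F i)) (t : ℝ) :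
    ∫ s in (0:ℝ)..t, ∑ i, m i * F i s = ∑ i, m i * ∫ s in (0:ℝ)..t, F i s := by
  have hi : ∀ i, IntervalIntegrable (fun s => m i * F i s) volume 0 t := fun i =>
    (continuous_const.mul (hF i)).intervalIntegrable _ _
  rw [intervalIntegral.integral_finsetSum fun i _ => hi i]
  simp only [intervalIntegral.integral_const_mul]

lemma half_solve_L2 (b : Fin n → (Fin n → ℤ) → ℂ) (hb : ∀ i, RD (b i))
    (hreal : ∀ i l, b i (-l) = starRingEnd ℂ (b i l)) (ψ : (Fin n → ℤ) → ℂ) (hψ : RD ψ) :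
    ∃ (Z : LK n G2) (X : Fin n → LK n G2) (C : (Fin n → ℤ) → ℂ),
      RD (fun k => Z k) ∧ (∀ i, RD (fun k => X i k)) ∧
      (∀ i k, X i k =ᵐ[mu0] fun t => symb i k * ψ k + PI t (symb i k • Z k)) ∧
      (∀ k, (Z + ∑ i, Mop (b i) (X i + Mop (b i) Z) : LK n G2) k =ᵐ[mu0]
        fun t => C k + PI t (-(∑ i, symb i k • (X i + Mop (b i) Z : LK n G2) k))) := by
  obtain ⟨e, r, hr⟩ := exists_lift
  set U0 : HH (Fin n) (LK n G2) := mkHH (mkLK (fun k => ψ k • e) (hψ.smul_const e))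
    (fun i => mkLK (fun k => symb i k • (ψ k • r)) ((hψ.smul_const r).smul_symbol i)) with hU0
  have hU0R : ∀ c, RD (fun k => U0 c k) := by
    rintro (_ | i)
    · exact hψ.smul_const e
    · exact (hψ.smul_const r).smul_symbol i
  obtain ⟨v, hv, horth, hvR⟩ := solve_RD (Vsub n) Vsub_closed Vsub_tau b hb hreal U0 hU0R
  set U := v + U0 with hU
  have hUR : ∀ c, RD (fun k => U c k) := fun c => (hvR c).add (hU0R c)
  rw [mem_Vsub] at hv
  have hC : ∀ k, ∃ C : ℂ, (U none + ∑ i, Mop (b i) (U (some i) + Mop (b i) (U none)) : LK n G2) k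
      =ᵐ[mu0] fun t => C + PI t (-(∑ i, symb i k • (U (some i) + Mop (b i) (U none) : LK n G2) k)) := by
    intro k
    refine weak_const fun θ W hW => ?_
    have h1 := orth_comp hb hreal U _ (horth _ (test_mem k θ W hW)) k θ _ (mkHH_none _ _)
      (fun i => mkHH_some _ _ i)
    rw [add_eq_zero_iff_eq_neg] at h1
    rw [h1, sum_inner, ← Finset.sum_neg_distrib]
    refine Finset.sum_congr rfl fun i _ => ?_
    rw [inner_smul_left, inner_smul_right, symb_conj, neg_mul]
  choose C hC using hC
  refine ⟨U none, fun i => U (some i), C, hUR none, fun i => hUR (some i), fun i k => ?_, hC⟩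
  refine ae_of_PI (continuous_const.add (PI_cont _)).locallyIntegrable fun t ht => ?_
  have e1 : U (some i) k = v (some i) k + symb i k • (ψ k • r) := rfl
  have e2 : U none k = v none k + ψ k • e := rfl
  have hci : ∀ f : G2, IntervalIntegrable (fun s => PI s f) volume 0 t := fun f =>
    (PI_cont f).intervalIntegrable _ _
  rw [e1, e2, map_add, hv i k t ht, map_smul, map_smul, PI_congr hr ht,
    intervalIntegral.integral_add (by simp) (hci e), ← DPI_def,
    intervalIntegral.integral_add (by simp) (hci _), ← DPI_def, map_smul, map_add, map_smul]
  simp only [intervalIntegral.integral_const, smul_eq_mul, sub_zero, Complex.real_smul]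
  ring

lemma RDu_of_sup {f g : (Fin n → ℤ) → G2} (hf : RD f) (hg : RD g) {C : (Fin n → ℤ) → ℂ}
    (h : ∀ k, f k =ᵐ[mu0] fun t => C k + PI t (g k)) : RDu Set.univ (fun k t => C k + PI t (g k)) := by
  intro s
  obtain ⟨A, hA⟩ := hf s
  obtain ⟨B, hB⟩ := hg s
  refine ⟨A + B, fun k t _ => ?_⟩
  have := wt_pos k
  calc _ ≤ (‖f k‖ + ‖g k‖) * wt k ^ s := by gcongr; exact sup_bound (h k) t
    _ = ‖f k‖ * wt k ^ s + ‖g k‖ * wt k ^ s := by ring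
    _ ≤ _ := add_le_add (hA k) (hB k)

theorem half_solve (b : Fin n → (Fin n → ℤ) → ℂ) (hb : ∀ i, RD (b i))
    (hreal : ∀ i l, b i (-l) = starRingEnd ℂ (b i l)) (c : (Fin n → ℤ) → ℂ) (hc : RD c)
    (hinv : cvs c (fun k => (if k = 0 then 1 else 0) + ∑ i, cvs (b i) (b i) k)
      = fun k => if k = 0 then 1 else 0) (ψ : (Fin n → ℤ) → ℂ) (hψ : RD ψ) :
    ∃ (z p : (Fin n → ℤ) → ℝ → ℂ) (x : Fin n → (Fin n → ℤ) → ℝ → ℂ) (C : (Fin n → ℤ) → ℂ)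
      (Z : (Fin n → ℤ) → G2) (X : Fin n → (Fin n → ℤ) → G2),
      RDu Set.univ z ∧ RDu Set.univ p ∧ (∀ i, RDu Set.univ (x i)) ∧
      (∀ k, Continuous (z k)) ∧ (∀ k, Continuous (p k)) ∧ (∀ i k, Continuous (x i k)) ∧
      RD Z ∧ (∀ i, RD (X i)) ∧ (∀ k, Z k =ᵐ[mu0] z k) ∧ (∀ i k, X i k =ᵐ[mu0] x i k) ∧
      z = conv c (fun k t => p k t + ∑ i, - conv (b i) (x i) k t) ∧
      (∀ i k t, 0 ≤ t → x i k t = symb i k * (ψ k + ∫ s in (0:ℝ)..t, z k s)) ∧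
      (∀ k t, 0 ≤ t → p k t = C k - ∫ s in (0:ℝ)..t,
        ∑ i, symb i k * (x i k s + conv (b i) z k s)) := by
  obtain ⟨Z, X, C, hZ, hX, hXx, hp⟩ := half_solve_L2 b hb hreal ψ hψ
  set q : Fin n → LK n G2 := fun i => X i + Mop (b i) Z with hq
  have hqR : ∀ i, RD (fun k => q i k) := fun i => (hX i).add (RD_Mop hZ (hb i))
  set Q : (Fin n → ℤ) → G2 := fun k => -(∑ i, symb i k • q i k) with hQ
  have hQR : RD Q := by
    have : RD (fun k => ∑ i, symb i k • q i k) := RD_sum _ fun i _ => (hqR i).smul_symbol i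
    intro s
    obtain ⟨A, hA⟩ := this s
    exact ⟨A, fun k => by rw [hQ, norm_neg]; exact hA k⟩
  set pL : LK n G2 := Z + ∑ i, Mop (b i) (q i) with hpL
  have hpR : RD (fun k => pL k) := by
    have h1 : RD (fun k => Z k + ∑ i, Mop (b i) (q i) k) :=
      hZ.add (RD_sum _ fun i _ => RD_Mop (hqR i) (hb i))
    have h2 : (fun k => pL k) = fun k => Z k + ∑ i, Mop (b i) (q i) k := by
      funext k
      rw [hpL, lp.coeFn_add, Pi.add_apply, lp.coeFn_sum, Finset.sum_apply]
    rw [h2]; exact h1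
  set p : (Fin n → ℤ) → ℝ → ℂ := fun k t => C k + PI t (Q k) with hpdef
  set x : Fin n → (Fin n → ℤ) → ℝ → ℂ := fun i k t => symb i k * ψ k + PI t (symb i k • Z k) with hxdef
  have hpu : RDu Set.univ p := RDu_of_sup hpR hQR hp
  have hxu : ∀ i, RDu Set.univ (x i) := fun i =>
    RDu_of_sup (C := fun k => symb i k * ψ k) (hX i) (hZ.smul_symbol i) (hXx i)
  have hpc : ∀ k, Continuous (p k) := fun k => continuous_const.add (PI_cont _)
  have hxc : ∀ i k, Continuous (x i k) := fun i k => continuous_const.add (PI_cont _)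
  set g : (Fin n → ℤ) → ℝ → ℂ := fun k t => p k t + ∑ i, - conv (b i) (x i) k t with hg
  have hgu : RDu Set.univ g := hpu.add (RDu_sum _ fun i _ => ((hxu i).conv (hb i)).neg)
  have hgc : ∀ k, Continuous (g k) := fun k => (hpc k).add
    (continuous_finsetSum _ fun i _ => (conv_continuous (hxu i) (hxc i) (hb i) k).neg)
  have hrep : ∀ k, (pL - ∑ i, Mop (b i) (X i) : LK n G2) k =ᵐ[mu0] g k := by
    intro k
    have e : (pL - ∑ i, Mop (b i) (X i) : LK n G2) k = pL k - ∑ i, Mop (b i) (X i) k := by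
      rw [lp.coeFn_sub, Pi.sub_apply, lp.coeFn_sum, Finset.sum_apply]
    rw [e]
    refine ae_of_PI (hgc k).locallyIntegrable fun t ht => ?_
    rw [map_sub, map_sum, PI_congr (hp k) ht]
    have e2 : ∀ i, PI t (Mop (b i) (X i) k) = ∫ s in (0:ℝ)..t, conv (b i) (x i) k s := fun i =>
      PI_congr (Mop_rep (hXx i) (hxu i) (hxc i) (hb i) k) ht
    rw [Finset.sum_congr rfl fun i _ => e2 i]
    exact (int_add_sum_neg (hpc k) (fun i => conv_continuous (hxu i) (hxc i) (hb i) k) t).symm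
  set z := conv c g with hz
  have hzu : RDu Set.univ z := hgu.conv hc
  have hzc : ∀ k, Continuous (z k) := fun k => conv_continuous hgu hgc hc k
  have hZz : ∀ k, Z k =ᵐ[mu0] z k := by
    intro k
    have h1 := Mop_rep hrep hgu hgc hc k
    rw [← Z_formula hb hc hinv Z X] at h1
    exact h1
  refine ⟨z, p, x, C, fun k => Z k, fun i k => X i k, hzu, hpu, hxu, hzc, hpc, hxc, hZ, hX, hZz, hXx,
    rfl, fun i k t ht => ?_, fun k t ht => ?_⟩
  · simp only [hxdef]
    rw [map_smul, PI_congr (hZz k) ht, smul_eq_mul]; ring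
  · simp only [hpdef, hQ]
    have hcv : ∀ i, Continuous (conv (b i) z k) := fun i => conv_continuous hzu hzc (hb i) k
    have e3 : ∀ i, PI t (q i k) = ∫ s in (0:ℝ)..t, (x i k s + conv (b i) z k s) := by
      intro i
      have e : q i k = X i k + Mop (b i) Z k := rfl
      rw [e, map_add, PI_congr (hXx i k) ht, PI_congr (Mop_rep hZz hzu hzc (hb i) k) ht,
        intervalIntegral.integral_add ((hxc i k).intervalIntegrable _ _)
          ((hcv i).intervalIntegrable _ _)]
    rw [map_neg, map_sum, int_sum_mul (m := fun i => symb i k)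
      (F := fun i s => x i k s + conv (b i) z k s) (fun i => (hxc i k).add (hcv i)) t, ← sub_eq_add_neg]
    congr 1
    refine Finset.sum_congr rfl fun i _ => ?_
    rw [map_smul, e3, smul_eq_mul]

end pde2

section boot
variable {n : ℕ}

/-- uniformly rapidly decaying continuous families -/
def Gd (f : (Fin n → ℤ) → ℝ → ℂ) : Prop := RDu Set.univ f ∧ ∀ k, Continuous (f k)

/-- `f'` is the derivative of `f` on `[0,∞)` -/
def Rl (f f' : (Fin n → ℤ) → ℝ → ℂ) : Prop :=
  ∀ k t, 0 ≤ t → f k t = f k 0 + ∫ s in (0:ℝ)..t, f' k s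

lemma Gd.add {f g : (Fin n → ℤ) → ℝ → ℂ} (hf : Gd f) (hg : Gd g) : Gd (fun k t => f k t + g k t) :=
  ⟨hf.1.add hg.1, fun k => (hf.2 k).add (hg.2 k)⟩

lemma Gd.neg {f : (Fin n → ℤ) → ℝ → ℂ} (hf : Gd f) : Gd (fun k t => - f k t) :=
  ⟨hf.1.neg, fun k => (hf.2 k).neg⟩

lemma Gd.sum {f : Fin n → (Fin n → ℤ) → ℝ → ℂ} (hf : ∀ i, Gd (f i)) : Gd (fun k t => ∑ i, f i k t) :=
  ⟨RDu_sum _ fun i _ => (hf i).1, fun k => continuous_finsetSum _ fun i _ => (hf i).2 k⟩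

lemma Gd.symb {f : (Fin n → ℤ) → ℝ → ℂ} (hf : Gd f) (i : Fin n) : Gd (fun k t => symb i k * f k t) :=
  ⟨hf.1.mul_symbol _ _ 1 (symb_norm_le i), fun k => continuous_const.mul (hf.2 k)⟩

lemma Gd.conv {f : (Fin n → ℤ) → ℝ → ℂ} (hf : Gd f) {β : (Fin n → ℤ) → ℂ} (hβ : RD β) :
    Gd (conv β f) := ⟨hf.1.conv hβ, conv_continuous hf.1 hf.2 hβ⟩

lemma Gd.ii {f : (Fin n → ℤ) → ℝ → ℂ} (hf : Gd f) (k) (a b : ℝ) :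
    IntervalIntegrable (f k) volume a b := (hf.2 k).intervalIntegrable _ _

lemma Rl.add {f g f' g' : (Fin n → ℤ) → ℝ → ℂ} (hf : Rl f f') (hg : Rl g g')
    (hf' : Gd f') (hg' : Gd g') : Rl (fun k t => f k t + g k t) (fun k t => f' k t + g' k t) := by
  intro k t ht
  rw [intervalIntegral.integral_add (hf'.ii k _ _) (hg'.ii k _ _)]
  simp only
  rw [hf k t ht, hg k t ht]; ring

lemma Rl.neg {f f' : (Fin n → ℤ) → ℝ → ℂ} (hf : Rl f f') :
    Rl (fun k t => - f k t) (fun k t => - f' k t) := by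
  intro k t ht
  rw [intervalIntegral.integral_neg]
  simp only
  rw [hf k t ht]; ring

lemma Rl.sum {f f' : Fin n → (Fin n → ℤ) → ℝ → ℂ} (hf : ∀ i, Rl (f i) (f' i))
    (hf' : ∀ i, Gd (f' i)) : Rl (fun k t => ∑ i, f i k t) (fun k t => ∑ i, f' i k t) := by
  intro k t ht
  rw [intervalIntegral.integral_finsetSum fun i _ => (hf' i).ii k _ _, ← Finset.sum_add_distrib]
  exact Finset.sum_congr rfl fun i _ => hf i k t ht

lemma Rl.symb {f f' : (Fin n → ℤ) → ℝ → ℂ} (hf : Rl f f') (i : Fin n) :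
    Rl (fun k t => symb i k * f k t) (fun k t => symb i k * f' k t) := by
  intro k t ht
  rw [intervalIntegral.integral_const_mul]
  simp only
  rw [hf k t ht]; ring

lemma Rl.conv {f f' : (Fin n → ℤ) → ℝ → ℂ} (hf : Rl f f') (hfg : Gd f) (hf' : Gd f')
    {β : (Fin n → ℤ) → ℂ} (hβ : RD β) : Rl (conv β f) (conv β f') := by
  intro k t ht
  have h1 := conv_hasSum_int hf'.1 hf'.2 hβ k 0 t
  have h2 : HasSum (fun l => β l * f (k - l) 0) (_root_.conv β f k 0) :=
    (hfg.1.conv_summable hβ k trivial).of_norm.hasSum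
  have h3 : HasSum (fun l => β l * f (k - l) t) (_root_.conv β f k t) :=
    (hfg.1.conv_summable hβ k trivial).of_norm.hasSum
  refine h3.unique ?_
  refine (congrArg (fun u => HasSum u _) (funext fun l => ?_)).mpr (h2.add h1)
  rw [hf (k - l) t ht, intervalIntegral.integral_const_mul]; ring

/-- reconstruct `z` from `p, x` -/
def Zof (b : Fin n → (Fin n → ℤ) → ℂ) (c : (Fin n → ℤ) → ℂ) (p : (Fin n → ℤ) → ℝ → ℂ)
    (x : Fin n → (Fin n → ℤ) → ℝ → ℂ) : (Fin n → ℤ) → ℝ → ℂ :=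
  conv c (fun k t => p k t + ∑ i, - conv (b i) (x i) k t)

/-- next derivatives -/
def stepP (b : Fin n → (Fin n → ℤ) → ℂ) (z : (Fin n → ℤ) → ℝ → ℂ)
    (x : Fin n → (Fin n → ℤ) → ℝ → ℂ) : (Fin n → ℤ) → ℝ → ℂ :=
  fun k t => - ∑ i, symb i k * (x i k t + conv (b i) z k t)

def stepX (z : (Fin n → ℤ) → ℝ → ℂ) : Fin n → (Fin n → ℤ) → ℝ → ℂ :=
  fun i k t => symb i k * z k t

lemma boot_seq {b : Fin n → (Fin n → ℤ) → ℂ} (hb : ∀ i, RD (b i)) {c : (Fin n → ℤ) → ℂ} (hc : RD c)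
    {p : (Fin n → ℤ) → ℝ → ℂ} {x : Fin n → (Fin n → ℤ) → ℝ → ℂ} (hp : Gd p) (hx : ∀ i, Gd (x i))
    (rp : Rl p (stepP b (Zof b c p x) x)) (rx : ∀ i, Rl (x i) (stepX (Zof b c p x) i)) :
    ∃ zs : ℕ → (Fin n → ℤ) → ℝ → ℂ, zs 0 = Zof b c p x ∧ (∀ j, Gd (zs j)) ∧
      ∀ j, Rl (zs j) (zs (j + 1)) := by
  set St := ((Fin n → ℤ) → ℝ → ℂ) × (Fin n → (Fin n → ℤ) → ℝ → ℂ)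
  set step : St → St := fun s => (stepP b (Zof b c s.1 s.2) s.2, stepX (Zof b c s.1 s.2)) with hstep
  set S : ℕ → St := fun j => step^[j] (p, x) with hS
  have hZ : ∀ s : St, Gd s.1 → (∀ i, Gd (s.2 i)) → Gd (Zof b c s.1 s.2) := fun s h1 h2 =>
    (h1.add (Gd.sum fun i => ((h2 i).conv (hb i)).neg)).conv hc
  have hG : ∀ j, Gd (S j).1 ∧ ∀ i, Gd ((S j).2 i) := by
    intro j
    induction j with
    | zero => exact ⟨hp, hx⟩
    | succ j ih =>
      have e : S (j + 1) = step (S j) := Function.iterate_succ_apply' _ _ _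
      have hz := hZ (S j) ih.1 ih.2
      rw [e]
      exact ⟨(Gd.sum fun i => ((ih.2 i).add (hz.conv (hb i))).symb i).neg, fun i => hz.symb i⟩
  have hZR : ∀ j, Rl (S j).1 (S (j+1)).1 → (∀ i, Rl ((S j).2 i) ((S (j+1)).2 i)) →
      Rl (Zof b c (S j).1 (S j).2) (Zof b c (S (j+1)).1 (S (j+1)).2) := by
    intro j h1 h2
    have g0 := hG j
    have g1 := hG (j+1)
    refine Rl.conv ?_ (g0.1.add (Gd.sum fun i => ((g0.2 i).conv (hb i)).neg))
      (g1.1.add (Gd.sum fun i => ((g1.2 i).conv (hb i)).neg)) hc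
    exact h1.add (Rl.sum (fun i => ((h2 i).conv (g0.2 i) (g1.2 i) (hb i)).neg)
      fun i => ((g1.2 i).conv (hb i)).neg) g1.1 (Gd.sum fun i => ((g1.2 i).conv (hb i)).neg)
  have hR : ∀ j, Rl (S j).1 (S (j+1)).1 ∧ ∀ i, Rl ((S j).2 i) ((S (j+1)).2 i) := by
    intro j
    induction j with
    | zero => exact ⟨rp, rx⟩
    | succ j ih =>
      have e : S (j + 1) = step (S j) := Function.iterate_succ_apply' _ _ _
      have e2 : S (j + 1 + 1) = step (S (j+1)) := Function.iterate_succ_apply' _ _ _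
      have hz := hZR j ih.1 ih.2
      have g0 := hG j
      have g1 := hG (j+1)
      have hz1 := hZ (S (j+1)) g1.1 g1.2
      have hz0 := hZ (S j) g0.1 g0.2
      have r1 : Rl (step (S j)).1 (step (S (j+1))).1 := by
        refine Rl.neg (Rl.sum (fun i => ?_) (fun i => ((g1.2 i).add (hz1.conv (hb i))).symb i))
        exact ((ih.2 i).add (hz.conv hz0 hz1 (hb i)) (g1.2 i) (hz1.conv (hb i))).symb i
      have r2 : ∀ i, Rl ((step (S j)).2 i) ((step (S (j+1))).2 i) := fun i => hz.symb i
      rw [e2]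
      constructor
      · rw [← e] at r1; exact r1
      · rw [← e] at r2; exact r2
  exact ⟨fun j => Zof b c (S j).1 (S j).2, rfl, fun j => hZ _ (hG j).1 (hG j).2,
    fun j => hZR j (hR j).1 (hR j).2⟩

/-- right-sided differentiability -/
lemma Rl.hasDeriv {f f' : (Fin n → ℤ) → ℝ → ℂ} (hf : Rl f f') (hf' : Gd f') (k : Fin n → ℤ) {t : ℝ}
    (ht : 0 ≤ t) : HasDerivWithinAt (f k) (f' k t) (Set.Ici 0) t := by
  have h1 : HasDerivAt (fun t => f k 0 + ∫ s in (0:ℝ)..t, f' k s) (f' k t) t :=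
    (intervalIntegral.integral_hasDerivAt_right (hf'.ii k 0 t)
      ((hf'.2 k).stronglyMeasurableAtFilter _ _) (hf'.2 k).continuousAt).const_add _
  exact h1.hasDerivWithinAt.congr (fun y hy => hf k y hy) (hf k t ht)

end boot

section borel
variable {n : ℕ}

lemma exists_jets : ∃ (g : ℕ → ℕ → ℝ → ℝ) (B : ℕ → ℕ → ℝ), (∀ m j t, HasDerivAt (g m j) (g m (j+1) t) t) ∧
    (∀ m j, g m j 0 = if m = j then 1 else 0) ∧ (∀ m j t, |g m j t| ≤ B m j) := by
  let η : ContDiffBump (0:ℝ) := ⟨1, 2, one_pos, one_lt_two⟩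
  let G : ℕ → ℝ → ℝ := fun m t => (t ^ m / (m.factorial : ℝ)) * η t
  have hG : ∀ m, ContDiff ℝ (⊤ : ℕ∞) (G m) := fun m =>
    ((contDiff_id.pow m).div_const _).mul η.contDiff
  have hcs : ∀ m j, HasCompactSupport (iteratedDeriv j (G m)) := by
    intro m j
    induction j with
    | zero => rw [iteratedDeriv_zero]; exact η.hasCompactSupport.mul_left
    | succ j ih => rw [iteratedDeriv_succ]; exact ih.deriv
  have hbd : ∀ m j, ∃ B, ∀ t, |iteratedDeriv j (G m) t| ≤ B := fun m j => by
    obtain ⟨C, hC⟩ := (hcs m j).exists_bound_of_continuous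
      ((hG m).continuous_iteratedDeriv j (by exact_mod_cast le_top))
    exact ⟨C, hC⟩
  choose B hB using hbd
  refine ⟨fun m j => iteratedDeriv j (G m), B, fun m j t => ?_, fun m j => ?_, hB⟩
  · simp only
    rw [iteratedDeriv_succ]
    exact ((hG m).differentiable_iteratedDeriv j (by exact_mod_cast ENat.natCast_lt_top j) t).hasDerivAt
  · have he : G m =ᶠ[nhds 0] fun t => t ^ m * (m.factorial : ℝ)⁻¹ := by
      filter_upwards [η.eventuallyEq_one] with t ht
      simp only [G]
      rw [ht]; simp [div_eq_mul_inv]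
    simp only
    rw [he.iteratedDeriv_eq]
    have : iteratedDeriv j (fun t : ℝ => t ^ m * (m.factorial : ℝ)⁻¹) 0
       = iteratedDeriv j (fun t : ℝ => t ^ m) 0 * (m.factorial : ℝ)⁻¹ := by
      rw [← iteratedDeriv_mul_const_field]
    rw [this, iteratedDeriv_pow]
    rcases lt_trichotomy m j with h | h | h
    · rw [Nat.descFactorial_of_lt h]; simp [h.ne]
    · subst h
      have : (m.factorial : ℝ) ≠ 0 := by positivity
      simp [Nat.descFactorial_self, this]
    · rw [if_neg h.ne']
      have : m - j ≠ 0 := by omega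
      simp [this]

lemma borel_fam {c : ℕ → (Fin n → ℤ) → ℂ} (hc : ∀ m, RD (c m)) :
    ∃ w : ℕ → (Fin n → ℤ) → ℝ → ℂ, (∀ j, RDu Set.univ (w j)) ∧
      (∀ j k t, HasDerivAt (w j k) (w (j+1) k t) t) ∧ ∀ j k, w j k 0 = c j k := by
  obtain ⟨g, B, hg, hg0, hB⟩ := exists_jets
  choose C hC using hc
  have hC0 : ∀ m s, 0 ≤ C m s := fun m s =>
    le_trans (by have := wt_pos (0 : Fin n → ℤ); positivity) (hC m s 0)
  have hB0 : ∀ m j, 0 ≤ B m j := fun m j => (abs_nonneg _).trans (hB m j 0)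
  let L : ℕ → ℝ := fun m => 1 + 2 ^ m * C m m * ∑ j ∈ Finset.range m, B m j
  have hS0 : ∀ m, 0 ≤ ∑ j ∈ Finset.range m, B m j := fun m => Finset.sum_nonneg fun j _ => hB0 m j
  have hL1 : ∀ m, 1 ≤ L m := fun m => by
    have : 0 ≤ 2 ^ m * C m m * ∑ j ∈ Finset.range m, B m j :=
      mul_nonneg (mul_nonneg (by positivity) (hC0 _ _)) (hS0 m)
    simp only [L]; linarith
  have hL0 : ∀ m, 0 < L m := fun m => lt_of_lt_of_le one_pos (hL1 m)
  -- scalar factor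
  let F : ℕ → ℕ → ℝ → ℝ := fun m j t => (L m ^ m)⁻¹ * L m ^ j * g m j (L m * t)
  have hF : ∀ m j t, HasDerivAt (F m j) (F m (j+1) t) t := by
    intro m j t
    have h1 : HasDerivAt (fun t => L m * t) (L m) t := by
      simpa using (hasDerivAt_id t).const_mul (L m)
    have h2 := ((hg m j (L m * t)).comp t h1).const_mul ((L m ^ m)⁻¹ * L m ^ j)
    refine h2.congr_deriv ?_
    simp only [F]; ring
  let T : ℕ → ℕ → (Fin n → ℤ) → ℝ → ℂ := fun j m k t => c m k * (F m j t : ℂ)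
  have hT : ∀ j m k t, HasDerivAt (T j m k) (T (j+1) m k t) t := fun j m k t =>
    (HasDerivAt.ofReal_comp (hF m j t)).const_mul (c m k)
  have hFb : ∀ m j t, |F m j t| ≤ (L m ^ m)⁻¹ * L m ^ j * B m j := by
    intro m j t
    have := hL0 m
    simp only [F]
    rw [abs_mul, abs_of_nonneg (by positivity)]
    exact mul_le_mul_of_nonneg_left (hB _ _ _) (by positivity)
  let V : ℕ → ℕ → ℕ → ℝ := fun j s m => if m ∈ Finset.range (j + s + 1) then
    C m s * ((L m ^ m)⁻¹ * L m ^ j * B m j) else (1/2) ^ m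
  have hV : ∀ j s, Summable (V j s) := by
    intro j s
    refine (summable_geometric_two).congr_cofinite ?_
    have : ((Finset.range (j + s + 1) : Finset ℕ) : Set ℕ)ᶜ ∈ Filter.cofinite :=
      (Finset.finite_toSet _).compl_mem_cofinite
    filter_upwards [this] with m hm
    simp only [V]
    rw [if_neg (by simpa using hm)]
  have hTV : ∀ j s m k t, ‖T j m k t‖ * wt k ^ s ≤ V j s m := by
    intro j s m k t
    have hn : ‖T j m k t‖ = ‖c m k‖ * |F m j t| := by
      simp [T]
    have hw := wt_pos k
    have hw1 := wt_one_le k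
    have hl := hL0 m
    rw [hn]
    simp only [V]
    split_ifs with h
    · calc _ = (‖c m k‖ * wt k ^ s) * |F m j t| := by ring
        _ ≤ _ := mul_le_mul (hC m s k) (hFb m j t) (abs_nonneg _) (hC0 _ _)
    · have hm : j + s + 1 ≤ m := by simpa using h
      have h1 : ‖c m k‖ * wt k ^ s ≤ C m m :=
        le_trans (mul_le_mul_of_nonneg_left (pow_le_pow_right₀ hw1 (by omega)) (norm_nonneg _))
          (hC m m k)
      have h2 : (L m ^ m)⁻¹ * L m ^ j ≤ (L m)⁻¹ := by
        have : L m ^ j * L m ≤ L m ^ m := by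
          rw [← pow_succ]; exact pow_le_pow_right₀ (hL1 m) (by omega)
        rw [inv_mul_le_iff₀ (by positivity), ← div_eq_mul_inv, le_div_iff₀ hl]
        exact this
      have h3 : B m j ≤ ∑ j ∈ Finset.range m, B m j :=
        Finset.single_le_sum (f := fun j => B m j) (fun i _ => hB0 m i) (Finset.mem_range.mpr (by omega))
      calc ‖c m k‖ * |F m j t| * wt k ^ s = (‖c m k‖ * wt k ^ s) * |F m j t| := by ring
        _ ≤ C m m * ((L m)⁻¹ * ∑ j ∈ Finset.range m, B m j) := by
          refine mul_le_mul h1 ((hFb m j t).trans ?_) (abs_nonneg _) (hC0 _ _)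
          exact mul_le_mul h2 h3 (hB0 _ _) (by positivity)
        _ ≤ (1/2)^m := by
          have e : C m m * ((L m)⁻¹ * ∑ j ∈ Finset.range m, B m j)
            = (C m m * ∑ j ∈ Finset.range m, B m j) / L m := by field_simp
          rw [e, div_le_iff₀ hl]
          simp only [L]
          have : (1/2:ℝ)^m * 2^m = 1 := by rw [← mul_pow]; norm_num
          have h4 : (0:ℝ) < (1/2)^m := by positivity
          calc C m m * ∑ j ∈ Finset.range m, B m j = ((1/2:ℝ)^m * 2^m) * (C m m * ∑ j ∈ Finset.range m, B m j) := by
                rw [this, one_mul]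
            _ ≤ _ := by nlinarith
  have hTV0 : ∀ j m k t, ‖T j m k t‖ ≤ V j 0 m := fun j m k t => by
    simpa using hTV j 0 m k t
  have hsum : ∀ j k t, Summable fun m => T j m k t := fun j k t =>
    Summable.of_norm_bounded (hV j 0) fun m => hTV0 j m k t
  refine ⟨fun j k t => ∑' m, T j m k t, fun j s => ⟨∑' m, V j s m, fun k t _ => ?_⟩, fun j k t => ?_,
    fun j k => ?_⟩
  · have hw := wt_pos k
    have hs : Summable fun m => ‖T j m k t‖ :=
      Summable.of_nonneg_of_le (fun _ => norm_nonneg _) (fun m => hTV0 j m k t) (hV j 0)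
    calc _ ≤ (∑' m, ‖T j m k t‖) * wt k ^ s :=
          mul_le_mul_of_nonneg_right (norm_tsum_le_tsum_norm hs) (by positivity)
      _ = ∑' m, ‖T j m k t‖ * wt k ^ s := tsum_mul_right.symm
      _ ≤ _ := (hs.mul_right _).tsum_le_tsum (fun m => hTV j s m k t) (hV j s)
  · exact hasDerivAt_tsum (hV (j+1) 0) (fun m t => hT j m k t) (fun m t => hTV0 (j+1) m k t)
      (hsum j k 0) t
  · simp only
    rw [tsum_eq_single j]
    · have := hL0 j
      simp [T, F, hg0]
      rw [inv_mul_cancel₀, mul_one]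
      exact pow_ne_zero _ (by exact_mod_cast this.ne')
    · intro m hm
      simp [T, F, hg0, hm]

/-- Extension of one-sided smooth families to the whole line. -/
lemma extend_fam {zs : ℕ → (Fin n → ℤ) → ℝ → ℂ} (hG : ∀ j, Gd (zs j)) (hR : ∀ j, Rl (zs j) (zs (j+1))) :
    ∃ W : ℕ → (Fin n → ℤ) → ℝ → ℂ, (∀ j, RDu Set.univ (W j)) ∧
      (∀ j k t, HasDerivAt (W j k) (W (j+1) k t) t) ∧ ∀ k t, 0 ≤ t → W 0 k t = zs 0 k t := by
  obtain ⟨w, hw, hd, h0⟩ := borel_fam (c := fun m k => zs m k 0) (fun m s => by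
    obtain ⟨C, hC⟩ := (hG m).1 s
    exact ⟨C, fun k => hC k 0 trivial⟩)
  let W : ℕ → (Fin n → ℤ) → ℝ → ℂ := fun j k t => if 0 ≤ t then zs j k t else w j k t
  have hp : ∀ j k t, 0 ≤ t → W j k t = zs j k t := fun j k t ht => if_pos ht
  have hm : ∀ j k t, t ≤ 0 → W j k t = w j k t := fun j k t ht => by
    rcases ht.lt_or_eq with h | h
    · exact if_neg (not_le.mpr h)
    · subst h; rw [hp _ _ _ le_rfl, h0]
  refine ⟨W, fun j s => ?_, fun j k t => ?_, hp 0⟩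
  · obtain ⟨C, hC⟩ := (hG j).1 s
    obtain ⟨D, hD⟩ := hw j s
    refine ⟨max C D, fun k t ht => ?_⟩
    rcases le_total 0 t with h | h
    · rw [hp _ _ _ h]; exact (hC k t ht).trans (le_max_left _ _)
    · rw [hm _ _ _ h]; exact (hD k t ht).trans (le_max_right _ _)
  · have A : 0 ≤ t → HasDerivWithinAt (W j k) (W (j+1) k t) (Set.Ici 0) t := fun ht => by
      rw [hp _ _ _ ht]
      exact ((hR j).hasDeriv (hG (j+1)) k ht).congr (fun y hy => hp j k y hy) (hp _ _ _ ht)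
    have A' : t ≤ 0 → HasDerivWithinAt (W j k) (W (j+1) k t) (Set.Iic 0) t := fun ht => by
      rw [hm _ _ _ ht]
      exact (hd j k t).hasDerivWithinAt.congr (fun y hy => hm j k y hy) (hm _ _ _ ht)
    rcases lt_trichotomy t 0 with h | h | h
    · exact (A' h.le).hasDerivAt (Iic_mem_nhds h)
    · subst h
      have := (A' le_rfl).union (A le_rfl)
      rw [Set.Iic_union_Ici] at this
      exact this.hasDerivAt Filter.univ_mem
    · exact (A h.le).hasDerivAt (Ici_mem_nhds h)

end borel

section syn
variable {n : ℕ}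

/-- characters -/
def ek (k : Fin n → ℤ) (x : Fin n → ℝ) : ℂ := Complex.exp (∑ i, symb i k * (x i : ℂ))

lemma ek_norm (k : Fin n → ℤ) (x : Fin n → ℝ) : ‖ek k x‖ = 1 := by
  have : (∑ i, symb i k * (x i : ℂ)) = ((∑ i, 2 * Real.pi * k i * x i : ℝ) : ℂ) * Complex.I := by
    push_cast
    rw [Finset.sum_mul]
    refine Finset.sum_congr rfl fun i _ => ?_
    unfold symb; ring
  unfold ek
  rw [this, Complex.norm_exp_ofReal_mul_I]

lemma ek_add (k l : Fin n → ℤ) (x : Fin n → ℝ) : ek (k + l) x = ek k x * ek l x := by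
  unfold ek
  rw [← Complex.exp_add, ← Finset.sum_add_distrib]
  congr 1
  refine Finset.sum_congr rfl fun i _ => ?_
  unfold symb; simp; ring

lemma ek_zero (x : Fin n → ℝ) : ek 0 x = 1 := by
  unfold ek symb; simp

lemma ek_periodic (k : Fin n → ℤ) (x : Fin n → ℝ) (m : Fin n → ℤ) :
    ek k (x + fun i => (m i : ℝ)) = ek k x := by
  unfold ek
  have : (∑ i, symb i k * (((x + fun i => (m i : ℝ)) i : ℝ) : ℂ))
      = (∑ i, symb i k * (x i : ℂ)) + ((∑ i, k i * m i : ℤ) : ℂ) * (2 * Real.pi * Complex.I) := by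
    push_cast
    rw [Finset.sum_mul, ← Finset.sum_add_distrib]
    refine Finset.sum_congr rfl fun i _ => ?_
    unfold symb; simp; ring
  rw [this, Complex.exp_add, Complex.exp_int_mul_two_pi_mul_I, mul_one]

/-- coordinate covectors -/
def dxi (i : Fin n) : (Fin n → ℝ) →L[ℝ] ℂ :=
  Complex.ofRealCLM.comp (ContinuousLinearMap.proj (R := ℝ) (φ := fun _ : Fin n => ℝ) i)

lemma ek_hasFDerivAt (k : Fin n → ℤ) (x : Fin n → ℝ) :
    HasFDerivAt (ek k) (∑ i, (symb i k * ek k x) • dxi i) x := by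
  have h : HasFDerivAt (fun x : Fin n → ℝ => ∑ i, symb i k * (x i : ℂ)) (∑ i, symb i k • dxi i) x := by
    refine HasFDerivAt.fun_sum fun i _ => ?_
    exact ((dxi i).hasFDerivAt (x := x)).const_mul (symb i k)
  have h2 := h.cexp
  refine h2.congr_fderiv ?_
  rw [Finset.smul_sum]
  refine Finset.sum_congr rfl fun i _ => ?_
  rw [smul_smul, mul_comm]; rfl

/-- Fourier synthesis. -/
def FS (β : (Fin n → ℤ) → ℂ) (x : Fin n → ℝ) : ℂ := ∑' k, β k * ek k x

lemma FS_summable_norm {β : (Fin n → ℤ) → ℂ} (hβ : RD β) (x) : Summable fun k => ‖β k * ek k x‖ := by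
  simpa [ek_norm] using hβ.summable_norm

lemma FS_hasSum {β : (Fin n → ℤ) → ℂ} (hβ : RD β) (x) : HasSum (fun k => β k * ek k x) (FS β x) :=
  (FS_summable_norm hβ x).of_norm.hasSum

lemma FS_add {β γ : (Fin n → ℤ) → ℂ} (hβ : RD β) (hγ : RD γ) (x) :
    FS (fun k => β k + γ k) x = FS β x + FS γ x := by
  refine HasSum.tsum_eq ?_
  refine (congrArg (fun u => HasSum u _) (funext fun l => ?_)).mpr ((FS_hasSum hβ x).add (FS_hasSum hγ x))
  ring

lemma FS_neg {β : (Fin n → ℤ) → ℂ} (hβ : RD β) (x) :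
    FS (fun k => - β k) x = - FS β x := by
  refine HasSum.tsum_eq ?_
  refine (congrArg (fun u => HasSum u _) (funext fun l => ?_)).mpr ((FS_hasSum hβ x).neg)
  ring

lemma FS_sum {ι : Type*} (S : Finset ι) {β : ι → (Fin n → ℤ) → ℂ} (hβ : ∀ i, RD (β i)) (x) :
    FS (fun k => ∑ i ∈ S, β i k) x = ∑ i ∈ S, FS (β i) x := by
  refine HasSum.tsum_eq ?_
  refine (congrArg (fun u => HasSum u _) (funext fun l => ?_)).mpr
    (hasSum_sum (s := S) fun i _ => FS_hasSum (hβ i) x)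
  rw [Finset.sum_mul]

lemma FS_cvs {β γ : (Fin n → ℤ) → ℂ} (hβ : RD β) (hγ : RD γ) (x) :
    FS (cvs β γ) x = FS β x * FS γ x :=
  (Mab_mul (A := ℂ) (S := fun k => ek k x) (fun l => (ek_norm l x).le) (fun l m => (ek_add l m x).symm)
    hβ.summable_norm hγ.summable_norm).symm

lemma FS_delta (x : Fin n → ℝ) : FS (fun k => if k = 0 then 1 else 0) x = 1 := by
  unfold FS
  rw [tsum_eq_single 0]
  · simp [ek_zero]
  · intro k hk; simp [hk]

lemma FS_periodic (β : (Fin n → ℤ) → ℂ) (x : Fin n → ℝ) (m : Fin n → ℤ) :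
    FS β (x + fun i => (m i : ℝ)) = FS β x := by
  unfold FS; simp only [ek_periodic]

lemma RD.symb {β : (Fin n → ℤ) → ℂ} (hβ : RD β) (i : Fin n) : RD (fun k => symb i k * β k) :=
  hβ.smul_symbol i

/-! ### space-time synthesis -/

def LD (f : (Fin n → ℤ) → ℝ → ℂ) : Prop := ∀ M : ℝ, RDu (Set.Ioo (-M) M) f

lemma RDu.toLD {f : (Fin n → ℤ) → ℝ → ℂ} (hf : RDu Set.univ f) : LD f := fun M s => by
  obtain ⟨C, hC⟩ := hf s
  exact ⟨C, fun k t _ => hC k t trivial⟩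

lemma LD.at {f : (Fin n → ℤ) → ℝ → ℂ} (hf : LD f) (t : ℝ) : RD (fun k => f k t) :=
  (hf (|t| + 1)).at (t := t) (by
    constructor
    · linarith [neg_abs_le t]
    · linarith [le_abs_self t])

lemma LD.symb {f : (Fin n → ℤ) → ℝ → ℂ} (hf : LD f) (i : Fin n) : LD (fun k t => symb i k * f k t) :=
  fun M => (hf M).mul_symbol _ _ 1 (symb_norm_le i)

def Syn (f : (Fin n → ℤ) → ℝ → ℂ) (p : (Fin n → ℝ) × ℝ) : ℂ := FS (fun k => f k p.2) p.1

def dX (i : Fin n) : ((Fin n → ℝ) × ℝ) →L[ℝ] ℂ := (dxi i).comp (ContinuousLinearMap.fst ℝ _ _)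
def dT : ((Fin n → ℝ) × ℝ) →L[ℝ] ℂ := Complex.ofRealCLM.comp (ContinuousLinearMap.snd ℝ _ _)

lemma Syn_hasFDerivAt {f f' : (Fin n → ℤ) → ℝ → ℂ} (hf : LD f) (hf' : LD f')
    (hd : ∀ k t, HasDerivAt (f k) (f' k t) t) (p : (Fin n → ℝ) × ℝ) :
    HasFDerivAt (Syn f) ((∑ i, Syn (fun k t => symb i k * f k t) p • dX i) + Syn f' p • dT) p := by
  obtain ⟨M, hM⟩ : ∃ M : ℝ, p.2 ∈ Set.Ioo (-M) M := ⟨|p.2| + 1, by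
    constructor
    · linarith [neg_abs_le p.2]
    · linarith [le_abs_self p.2]⟩
  let D : (Fin n → ℤ) → ((Fin n → ℝ) × ℝ) → (((Fin n → ℝ) × ℝ) →L[ℝ] ℂ) := fun k q =>
    (∑ i, (symb i k * f k q.2 * ek k q.1) • dX i) + (f' k q.2 * ek k q.1) • dT
  have hD : ∀ k q, HasFDerivAt (fun q : (Fin n → ℝ) × ℝ => f k q.2 * ek k q.1) (D k q) q := by
    intro k q
    have h1 : HasFDerivAt (fun q : (Fin n → ℝ) × ℝ => f k q.2) (f' k q.2 • dT) q := by
      have := (hd k q.2).hasFDerivAt.comp q hasFDerivAt_snd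
      refine this.congr_fderiv ?_
      ext v <;> simp [dT]
    have h2 : HasFDerivAt (fun q : (Fin n → ℝ) × ℝ => ek k q.1) (∑ i, (symb i k * ek k q.1) • dX i) q := by
      have := (ek_hasFDerivAt k q.1).comp q hasFDerivAt_fst
      refine this.congr_fderiv ?_
      rw [ContinuousLinearMap.finsetSum_comp]
      rfl
    refine (h1.mul h2).congr_fderiv ?_
    simp only [D]
    rw [Finset.smul_sum]
    congr 1
    · refine Finset.sum_congr rfl fun i _ => ?_
      rw [smul_smul]; congr 1; ring
    · rw [smul_smul]; congr 1; ring
  choose u hu hu0 hub using fun i => ((hf.symb i) M).exists_bound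
  obtain ⟨u', hu', hu0', hub'⟩ := (hf' M).exists_bound
  have hs1 : ∀ i, Summable (u i) := fun i => by simpa using hu i 0
  have hs' : Summable u' := by simpa using hu' 0
  have hbound : Summable fun k => (∑ i, u i k * ‖(dX i : ((Fin n → ℝ) × ℝ) →L[ℝ] ℂ)‖) +
      u' k * ‖(dT : ((Fin n → ℝ) × ℝ) →L[ℝ] ℂ)‖ :=
    (summable_sum fun i _ => (hs1 i).mul_right _).add (hs'.mul_right _)
  have key := hasFDerivAt_tsum_of_isPreconnected (f := fun k (q : (Fin n → ℝ) × ℝ) => f k q.2 * ek k q.1)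
    (f' := D) (s := Set.univ ×ˢ Set.Ioo (-M) M) (x₀ := p) (x := p) hbound
    (isOpen_univ.prod isOpen_Ioo) (isPreconnected_univ.prod isPreconnected_Ioo)
    (fun k q _ => hD k q) (fun k q hq => ?_) ⟨trivial, hM⟩
    (FS_summable_norm (hf.at p.2) p.1).of_norm ⟨trivial, hM⟩
  · refine key.congr_fderiv ?_
    refine HasSum.tsum_eq ?_
    refine HasSum.add (hasSum_sum fun i _ => ?_) ?_
    · exact (FS_hasSum ((hf.symb i).at p.2) p.1).smul_const _
    · exact (FS_hasSum (hf'.at p.2) p.1).smul_const _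
  · refine (norm_add_le _ _).trans (add_le_add ((norm_sum_le _ _).trans (Finset.sum_le_sum fun i _ => ?_)) ?_)
    · rw [norm_smul, norm_mul, ek_norm, mul_one]
      exact mul_le_mul_of_nonneg_right (hub i k _ hq.2) (norm_nonneg _)
    · rw [norm_smul, norm_mul, ek_norm, mul_one]
      exact mul_le_mul_of_nonneg_right (hub' k _ hq.2) (norm_nonneg _)

def Sm (F : ℕ → (Fin n → ℤ) → ℝ → ℂ) : Prop :=
  (∀ j, LD (F j)) ∧ ∀ j k t, HasDerivAt (F j k) (F (j+1) k t) t

lemma Sm.symb {F : ℕ → (Fin n → ℤ) → ℝ → ℂ} (hF : Sm F) (i : Fin n) :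
    Sm (fun j k t => symb i k * F j k t) :=
  ⟨fun j => (hF.1 j).symb i, fun j k t => (hF.2 j k t).const_mul _⟩

lemma Sm.tail {F : ℕ → (Fin n → ℤ) → ℝ → ℂ} (hF : Sm F) : Sm (fun j => F (j+1)) :=
  ⟨fun j => hF.1 (j+1), fun j => hF.2 (j+1)⟩

lemma Sm.contDiff_nat {F : ℕ → (Fin n → ℤ) → ℝ → ℂ} (hF : Sm F) (m : ℕ) : ContDiff ℝ m (Syn (F 0)) := by
  induction m generalizing F with
  | zero =>
    rw [Nat.cast_zero, contDiff_zero]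
    exact continuous_iff_continuousAt.mpr fun p =>
      (Syn_hasFDerivAt (hF.1 0) (hF.1 1) (hF.2 0) p).continuousAt
  | succ m ih =>
    push_cast
    rw [contDiff_succ_iff_hasFDerivAt]
    refine ⟨_, ?_, fun p => Syn_hasFDerivAt (hF.1 0) (hF.1 1) (hF.2 0) p⟩
    refine ContDiff.add (ContDiff.sum fun i _ => ?_) ?_
    · exact (ih (hF.symb i)).smul contDiff_const
    · exact (ih hF.tail).smul contDiff_const

lemma Sm.contDiff {F : ℕ → (Fin n → ℤ) → ℝ → ℂ} (hF : Sm F) : ContDiff ℝ (⊤ : ℕ∞) (Syn (F 0)) :=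
  contDiff_infty.mpr fun m => hF.contDiff_nat m

/-- derivative of a static synthesis -/
lemma FS_hasFDerivAt {β : (Fin n → ℤ) → ℂ} (hβ : RD β) (x : Fin n → ℝ) :
    HasFDerivAt (FS β) (∑ i, FS (fun k => symb i k * β k) x • dxi i) x := by
  have h0 : LD (fun (_ : Fin n → ℤ) (_ : ℝ) => (0:ℂ)) := fun M s => ⟨0, fun k t _ => by simp⟩
  have h1 := Syn_hasFDerivAt (f := fun k _ => β k) (f' := fun _ _ => 0) (hβ.toRDu _).toLD h0
    (fun k t => hasDerivAt_const _ _) (x, 0)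
  have h2 : HasFDerivAt (fun y : Fin n → ℝ => (y, (0:ℝ))) (ContinuousLinearMap.inl ℝ _ _) x :=
    (ContinuousLinearMap.inl ℝ (Fin n → ℝ) ℝ).hasFDerivAt
  refine (h1.comp x h2).congr_fderiv ?_
  ext v
  simp [dT, dX, Syn]

/-- time derivative on the open half line -/
lemma Syn_time_deriv {f f' : (Fin n → ℤ) → ℝ → ℂ} (hf : LD f) (hf' : LD f')
    (hd : ∀ k t, 0 < t → HasDerivAt (f k) (f' k t) t) (x : Fin n → ℝ) {t : ℝ} (ht : 0 < t) :
    HasDerivAt (fun t => Syn f (x, t)) (Syn f' (x, t)) t := by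
  obtain ⟨u', hu', hu0', hub'⟩ := (hf' (t+1)).exists_bound
  have hs' : Summable u' := by simpa using hu' 0
  exact hasDerivAt_tsum_of_isPreconnected (g := fun k t => f k t * ek k x) (g' := fun k t => f' k t * ek k x)
    (t := Set.Ioo 0 (t+1)) (y₀ := t) hs' isOpen_Ioo isPreconnected_Ioo
    (fun k s hs => (hd k s hs.1).mul_const _)
    (fun k s hs => by
      rw [norm_mul, ek_norm, mul_one]
      exact hub' k s ⟨by linarith [hs.1], hs.2⟩) ⟨ht, by linarith⟩
    (FS_summable_norm (hf.at t) x).of_norm ⟨ht, by linarith⟩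

end syn

section four
variable {n : ℕ}

def Per {E : Type*} (f : (Fin n → ℝ) → E) : Prop :=
  ∀ (x : Fin n → ℝ) (k : Fin n → ℤ), f (x + fun i => (k i : ℝ)) = f x

lemma cell_ae_Icc : (cell n : Set (Fin n → ℝ)) =ᵐ[volume] Set.Icc (0 : Fin n → ℝ) 1 := by
  rw [volume_pi]
  exact Measure.univ_pi_Ico_ae_eq_Icc (μ := fun _ : Fin n => (volume : Measure ℝ)) (f := 0) (g := 1)

lemma cell_meas : MeasurableSet (cell n) := MeasurableSet.univ_pi fun _ => measurableSet_Ico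

lemma cell_vol : volume (cell n) = 1 := by
  rw [measure_congr cell_ae_Icc, Real.volume_Icc_pi]; simp

instance cell_fin : IsFiniteMeasure (volume.restrict (cell n)) :=
  ⟨by rw [Measure.restrict_apply_univ, cell_vol]; exact ENNReal.one_lt_top⟩

lemma cell_sub : cell n ⊆ Set.Icc (0 : Fin n → ℝ) 1 := fun x hx =>
  ⟨fun i => (hx i trivial).1, fun i => (hx i trivial).2.le⟩

lemma cont_intOn {E : Type*} [NormedAddCommGroup E] {f : (Fin n → ℝ) → E} (hf : Continuous f) :
    IntegrableOn f (cell n) :=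
  (hf.continuousOn.integrableOn_compact isCompact_Icc).mono_set cell_sub

lemma cont_bdd {E : Type*} [NormedAddCommGroup E] {f : (Fin n → ℝ) → E} (hf : Continuous f) :
    ∃ C, 0 ≤ C ∧ ∀ x ∈ cell n, ‖f x‖ ≤ C := by
  obtain ⟨C, hC⟩ := (isCompact_Icc (a := (0 : Fin n → ℝ)) (b := 1)).exists_bound_of_continuousOn
    hf.continuousOn
  exact ⟨max C 0, le_max_right _ _, fun x hx => (hC x (cell_sub hx)).trans (le_max_left _ _)⟩

/-- The integral of a partial derivative of a periodic function vanishes. -/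
lemma int_pd_zero {E : Type} [NormedAddCommGroup E] [NormedSpace ℝ E] {F : (Fin n → ℝ) → E}
    (hF : ContDiff ℝ 1 F) (hp : Per F) (i : Fin n) :
    ∫ x in cell n, fderiv ℝ F x (Pi.single i 1) = 0 := by
  rw [setIntegral_congr_set cell_ae_Icc]
  cases n with
  | zero => exact i.elim0
  | succ m =>
    have hc : Continuous fun x => fderiv ℝ F x (Pi.single i 1) :=
      (hF.continuous_fderiv one_ne_zero).clm_apply continuous_const
    have e : ∀ x, (∑ j : Fin (m+1), (if j = i then fderiv ℝ F x else 0) (Pi.single j 1)) =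
        fderiv ℝ F x (Pi.single i 1) := by
      intro x
      rw [Finset.sum_eq_single i]
      · simp
      · intro j _ hj; simp [hj]
      · simp
    have key := integral_divergence_of_hasFDerivAt_off_countable' (a := (0 : Fin (m+1) → ℝ)) (b := 1)
      zero_le_one (fun j => if j = i then F else fun _ => 0)
      (fun j x => if j = i then fderiv ℝ F x else 0) ∅ Set.countable_empty
      (fun j => by
        split_ifs
        · exact hF.continuous.continuousOn
        · exact continuousOn_const)
      (fun x _ j => by
        by_cases hj : j = i
        · simp only [hj, if_true]
          exact (hF.differentiable one_ne_zero x).hasFDerivAt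
        · simp only [hj, if_false]
          exact hasFDerivAt_const _ _)
      (by
        simp only [e]
        exact hc.continuousOn.integrableOn_compact isCompact_Icc)
    simp only [e] at key
    rw [key]
    refine Finset.sum_eq_zero fun j _ => ?_
    by_cases hj : j = i
    · subst hj
      rw [sub_eq_zero]
      refine integral_congr_ae (Filter.Eventually.of_forall fun y => ?_)
      simp only [if_true, Pi.one_apply, Pi.zero_apply]
      have := hp (j.insertNth (0:ℝ) y) (Pi.single j 1)
      rw [← this]
      congr 1
      funext l
      refine Fin.succAboveCases j ?_ (fun l => ?_) l
      · simp
      · simp [Fin.succAbove_ne]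
    · simp [hj]

/-- Fourier coefficients -/
def coef (f : (Fin n → ℝ) → ℂ) (k : Fin n → ℤ) : ℂ := ∫ x in cell n, f x * ek (-k) x

lemma ek_contDiff (k : Fin n → ℤ) : ContDiff ℝ (⊤ : ℕ∞) (ek k : (Fin n → ℝ) → ℂ) := by
  unfold ek
  refine ContDiff.cexp (ContDiff.sum fun i _ => contDiff_const.mul ?_)
  exact Complex.ofRealCLM.contDiff.comp (contDiff_apply ℝ ℝ i)

lemma symb_neg' (i : Fin n) (k : Fin n → ℤ) : symb i (-k) = - symb i k := by
  unfold symb; simp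

lemma dxi_single (i j : Fin n) : dxi i (Pi.single j (1:ℝ)) = if i = j then 1 else 0 := by
  by_cases h : i = j
  · subst h; simp [dxi]
  · simp [dxi, Pi.single_apply, h]

lemma sum_dxi (a : Fin n → ℂ) (j : Fin n) : (∑ i, a i • dxi i) (Pi.single j (1:ℝ)) = a j := by
  rw [sum_apply]
  simp only [smul_apply, dxi_single, smul_eq_mul, mul_ite, mul_one, mul_zero]
  simp

lemma ek_pd (k : Fin n → ℤ) (i : Fin n) (x) : fderiv ℝ (ek k) x (Pi.single i 1) = symb i k * ek k x := by
  rw [(ek_hasFDerivAt k x).fderiv, sum_dxi]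

lemma int_ek (k : Fin n → ℤ) : ∫ x in cell n, ek k x = if k = 0 then 1 else 0 := by
  split_ifs with h
  · subst h
    simp only [ek_zero]
    rw [setIntegral_const, Measure.real, cell_vol]; simp
  · obtain ⟨i, hi⟩ := Function.ne_iff.mp h
    have h1 := int_pd_zero ((ek_contDiff k).of_le (by exact_mod_cast le_top)) (ek_periodic k) i
    simp only [ek_pd] at h1
    rw [integral_const_mul] at h1
    have h2 : symb i k ≠ 0 := by
      unfold symb
      have : (k i : ℂ) ≠ 0 := by exact_mod_cast hi
      have := Real.pi_ne_zero
      simp [*]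
    exact (mul_eq_zero.mp h1).resolve_left h2

lemma coef_FS {β : (Fin n → ℤ) → ℂ} (hβ : RD β) (k : Fin n → ℤ) : coef (FS β) k = β k := by
  unfold coef FS
  have h := hasSum_integral_of_summable_integral_norm (μ := volume.restrict (cell n))
    (F := fun l x => β l * ek (l - k) x) (fun l =>
      cont_intOn (continuous_const.mul (ek_contDiff _).continuous)) (by
      simp only [norm_mul, ek_norm, mul_one]
      rw [show (fun l => ∫ x in cell n, ‖β l‖) = fun l => ‖β l‖ by
        funext l; rw [setIntegral_const, Measure.real, cell_vol]; simp]
      exact hβ.summable_norm)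
  have e : ∀ x, ∑' l, β l * ek (l - k) x = (∑' l, β l * ek l x) * ek (-k) x := by
    intro x
    rw [← tsum_mul_right]
    refine tsum_congr fun l => ?_
    rw [mul_assoc, ← ek_add]; rfl
  simp only [e] at h
  refine h.unique ?_
  have h2 : ∀ l, ∫ x in cell n, β l * ek (l - k) x = if l = k then β k else 0 := by
    intro l
    rw [integral_const_mul, int_ek]
    by_cases hl : l = k
    · simp [hl]
    · simp [hl, sub_eq_zero]
  simp only [h2]
  exact hasSum_ite_eq k (β k)

lemma FS_inj {β γ : (Fin n → ℤ) → ℂ} (hβ : RD β) (hγ : RD γ) (h : ∀ x, FS β x = FS γ x) : β = γ := by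
  funext k
  rw [← coef_FS hβ, ← coef_FS hγ, funext h]

lemma pd_per {E : Type*} [NormedAddCommGroup E] [NormedSpace ℝ E] {f : (Fin n → ℝ) → E}
    (hp : Per f) (v : Fin n → ℝ) : Per (fun x => fderiv ℝ f x v) := by
  intro x k
  have : f = fun x => f (x + fun i => (k i : ℝ)) := funext fun x => (hp x k).symm
  simp only
  conv_rhs => rw [this]
  rw [fderiv_comp_add_right]

lemma pd_smooth {E : Type*} [NormedAddCommGroup E] [NormedSpace ℝ E] {f : (Fin n → ℝ) → E}
    (hf : ContDiff ℝ (⊤ : ℕ∞) f) (v : Fin n → ℝ) : ContDiff ℝ (⊤ : ℕ∞) (fun x => fderiv ℝ f x v) :=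
  (hf.fderiv_right (m := (⊤ : ℕ∞)) (by simp)).clm_apply contDiff_const

lemma coef_pd {f : (Fin n → ℝ) → ℂ} (hf : ContDiff ℝ (⊤ : ℕ∞) f) (hp : Per f) (i : Fin n) (k) :
    coef (fun x => fderiv ℝ f x (Pi.single i 1)) k = symb i k * coef f k := by
  have h1 := int_pd_zero (F := fun x => f x * ek (-k) x) ((hf.mul (ek_contDiff (-k))).of_le (by exact_mod_cast le_top))
    (fun x l => by simp only [hp x l, ek_periodic]) i
  have hd : ∀ x, fderiv ℝ (fun x => f x * ek (-k) x) x (Pi.single i 1) =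
      fderiv ℝ f x (Pi.single i 1) * ek (-k) x - symb i k * (f x * ek (-k) x) := by
    intro x
    rw [fderiv_fun_mul (hf.differentiable (by simp) x) ((ek_contDiff (-k)).differentiable (by simp) x)]
    simp only [add_apply, smul_apply, ek_pd, symb_neg', smul_eq_mul]
    ring
  simp only [hd] at h1
  have c1 : Continuous fun x => fderiv ℝ f x (Pi.single i 1) * ek (-k) x :=
    (pd_smooth hf _).continuous.mul (ek_contDiff (-k)).continuous
  have c2 : Continuous fun x => symb i k * (f x * ek (-k) x) :=
    continuous_const.mul (hf.continuous.mul (ek_contDiff (-k)).continuous)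
  rw [integral_sub (cont_intOn c1) (cont_intOn c2), integral_const_mul, sub_eq_zero] at h1
  exact h1

lemma coef_RD {f : (Fin n → ℝ) → ℂ} (hf : ContDiff ℝ (⊤ : ℕ∞) f) (hp : Per f) : RD (coef f) := by
  intro s
  induction s generalizing f with
  | zero =>
    obtain ⟨C, hC0, hC⟩ := cont_bdd hf.continuous
    refine ⟨C, fun k => ?_⟩
    rw [pow_zero, mul_one]
    refine (norm_setIntegral_le_of_norm_le_const (C := C) (by rw [cell_vol]; exact ENNReal.one_lt_top) fun x hx => ?_).trans ?_
    · rw [norm_mul, ek_norm, mul_one]; exact hC x hx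
    · simp [Measure.real, cell_vol]
  | succ s ih =>
    obtain ⟨C, hC⟩ := ih hf hp
    choose D hD using fun i : Fin n => ih (pd_smooth hf (Pi.single i 1)) (pd_per hp (Pi.single i 1))
    refine ⟨C + ∑ i, D i, fun k => ?_⟩
    have hw := wt_pos k
    have : ‖coef f k‖ * wt k ^ (s+1) = ‖coef f k‖ * wt k ^ s + ∑ i, |(k i : ℝ)| * ‖coef f k‖ * wt k ^ s := by
      have hwt : wt k = 1 + ∑ i, |(k i : ℝ)| := rfl
      rw [← Finset.sum_mul, ← Finset.sum_mul, show ∑ i, |(k i : ℝ)| = wt k - 1 by rw [hwt]; ring]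
      ring
    rw [this]
    refine add_le_add (hC k) (Finset.sum_le_sum fun i _ => le_trans ?_ (hD i k))
    rw [coef_pd hf hp, norm_mul, symb_norm]
    have h1 : |(k i : ℝ)| ≤ 2 * Real.pi * |(k i : ℝ)| := by
      have := Real.pi_gt_three
      nlinarith [abs_nonneg (k i : ℝ)]
    gcongr

lemma torus_lift {f : (Fin n → ℝ) → ℂ} (hf : Continuous f) (hp : Per f) :
    ∃ F : C(UnitAddTorus (Fin n), ℂ), ∀ x : Fin n → ℝ, F (fun i => (x i : UnitAddCircle)) = f x := by
  let F : UnitAddTorus (Fin n) → ℂ := fun q => f (fun i => (AddCircle.equivIoc 1 0 (q i) : ℝ))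
  have hF : ∀ x : Fin n → ℝ, F (fun i => (x i : UnitAddCircle)) = f x := by
    intro x
    have : ∀ i, ∃ m : ℤ, (AddCircle.equivIoc (1:ℝ) 0 (x i : UnitAddCircle) : ℝ) = x i + m := by
      intro i
      have h1 : ((AddCircle.equivIoc (1:ℝ) 0 (x i : UnitAddCircle) : ℝ) : UnitAddCircle) = (x i : UnitAddCircle) :=
        AddCircle.coe_equivIoc
      rw [← sub_eq_zero, ← AddCircle.coe_sub, AddCircle.coe_eq_zero_iff] at h1
      obtain ⟨m, hm⟩ := h1
      refine ⟨m, ?_⟩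
      simp at hm; linarith
    choose m hm using this
    simp only [F]
    rw [show (fun i => (AddCircle.equivIoc (1:ℝ) 0 (x i : UnitAddCircle) : ℝ)) = x + fun i => (m i : ℝ) from
      funext hm]
    exact hp x m
  have hq : IsOpenQuotientMap (Pi.map fun (_ : Fin n) (y : ℝ) => (y : UnitAddCircle)) :=
    IsOpenQuotientMap.piMap fun _ => QuotientAddGroup.isOpenQuotientMap_mk
  refine ⟨⟨F, hq.isQuotientMap.continuous_iff.mpr ?_⟩, hF⟩
  have : F ∘ (Pi.map fun (_ : Fin n) (y : ℝ) => (y : UnitAddCircle)) = f := funext hF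
  rw [this]; exact hf

lemma mFourier_eq_ek (k : Fin n → ℤ) (x : Fin n → ℝ) :
    UnitAddTorus.mFourier k (fun i => (x i : UnitAddCircle)) = ek k x := by
  simp only [UnitAddTorus.mFourier, ContinuousMap.coe_mk, ek, Complex.exp_sum]
  refine Finset.prod_congr rfl fun i _ => ?_
  rw [fourier_coe_apply]
  congr 1
  unfold symb; push_cast; simp only [div_one]; ring

lemma FS_coef {f : (Fin n → ℝ) → ℂ} (hf : ContDiff ℝ (⊤ : ℕ∞) f) (hp : Per f) (x) :
    FS (coef f) x = f x := by
  obtain ⟨F, hF⟩ := torus_lift hf.continuous hp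
  have hset : {x : Fin n → ℝ | ∀ i, x i ∈ Set.Ioc ((0 : Fin n → ℝ) i) ((0 : Fin n → ℝ) i + 1)} =ᵐ[volume] cell n := by
    have h1 : (Set.univ.pi fun i => Set.Ioc ((0 : Fin n → ℝ) i) ((1 : Fin n → ℝ) i)) =ᵐ[volume]
        Set.Icc (0 : Fin n → ℝ) 1 := by
      rw [volume_pi]
      exact Measure.univ_pi_Ioc_ae_eq_Icc
    have h2 : {x : Fin n → ℝ | ∀ i, x i ∈ Set.Ioc ((0 : Fin n → ℝ) i) ((0 : Fin n → ℝ) i + 1)} =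
        (Set.univ.pi fun i => Set.Ioc ((0 : Fin n → ℝ) i) ((1 : Fin n → ℝ) i)) := by
      ext x; simp [Set.mem_pi]
    rw [h2]
    exact h1.trans cell_ae_Icc.symm
  have hc : ∀ k, UnitAddTorus.mFourierCoeff F k = coef f k := by
    intro k
    rw [UnitAddTorus.mFourierCoeff_eq_integral F k 0, setIntegral_congr_set hset]
    unfold coef
    refine integral_congr_ae (Filter.Eventually.of_forall fun y => ?_)
    simp only [mFourier_eq_ek, hF, smul_eq_mul, mul_comm]
  have hs : Summable (UnitAddTorus.mFourierCoeff F) := by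
    rw [funext hc]; exact (coef_RD hf hp).summable_norm.of_norm
  have h := UnitAddTorus.hasSum_mFourier_series_apply_of_summable hs (fun i => (x i : UnitAddCircle))
  simp only [hc, mFourier_eq_ek, hF, smul_eq_mul] at h
  exact h.tsum_eq

lemma exists_FS {f : (Fin n → ℝ) → ℂ} (hf : ContDiff ℝ (⊤ : ℕ∞) f) (hp : Per f) :
    ∃ β, RD β ∧ ∀ x, FS β x = f x := ⟨coef f, coef_RD hf hp, FS_coef hf hp⟩

lemma ek_conj (k : Fin n → ℤ) (x : Fin n → ℝ) : starRingEnd ℂ (ek k x) = ek (-k) x := by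
  unfold ek
  rw [← Complex.exp_conj, map_sum]
  congr 1
  refine Finset.sum_congr rfl fun i _ => ?_
  rw [map_mul, symb_conj, symb_neg', Complex.conj_ofReal]

lemma wt_neg (k : Fin n → ℤ) : wt (-k) = wt k := by unfold wt; simp

lemma real_symm {β : (Fin n → ℤ) → ℂ} (hβ : RD β) {f : (Fin n → ℝ) → ℝ} (h : ∀ x, FS β x = f x)
    (l : Fin n → ℤ) : β (-l) = starRingEnd ℂ (β l) := by
  have hγ : RD (fun k => starRingEnd ℂ (β (-k))) := fun s => by
    obtain ⟨C, hC⟩ := hβ s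
    refine ⟨C, fun k => ?_⟩
    rw [RCLike.norm_conj, ← wt_neg]; exact hC (-k)
  have h2 : (fun k => starRingEnd ℂ (β (-k))) = β := by
    refine FS_inj hγ hβ fun x => ?_
    have h3 := (FS_hasSum hβ x).star
    have h4 : HasSum (fun k => starRingEnd ℂ (β (-k)) * ek k x) (star (FS β x)) := by
      rw [← (Equiv.neg (Fin n → ℤ)).hasSum_iff] at h3
      refine (congrArg (fun u => HasSum u _) (funext fun l => ?_)).mpr h3
      show _ = starRingEnd ℂ (β (-l) * ek (-l) x)
      rw [map_mul, ek_conj, neg_neg]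
    have h5 : FS (fun k => starRingEnd ℂ (β (-k))) x = star (FS β x) := h4.tsum_eq
    rw [h5, h x]
    exact Complex.conj_ofReal _
  have h3 : starRingEnd ℂ (β (-l)) = β l := congrFun h2 l
  rw [← h3, Complex.conj_conj]

end four

section flat
variable {n : ℕ}

/-- flattened solution, on the Fourier side -/
theorem flat_four (b : Fin n → (Fin n → ℤ) → ℂ) (hb : ∀ i, RD (b i))
    (hreal : ∀ i l, b i (-l) = starRingEnd ℂ (b i l)) (c : (Fin n → ℤ) → ℂ) (hc : RD c)
    (hinv : cvs c (fun k => (if k = 0 then 1 else 0) + ∑ i, cvs (b i) (b i) k)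
      = fun k => if k = 0 then 1 else 0) (ψ : (Fin n → ℤ) → ℂ) (hψ : RD ψ) :
    ∃ (U : ℕ → (Fin n → ℤ) → ℝ → ℂ) (p p' : (Fin n → ℤ) → ℝ → ℂ) (Z : (Fin n → ℤ) → G2)
      (X : Fin n → (Fin n → ℤ) → G2), Sm U ∧ (∀ k, U 0 k 0 = ψ k) ∧ RDu Set.univ p ∧
      RD Z ∧ (∀ i, RD (X i)) ∧ (∀ k, Z k =ᵐ[mu0] U 1 k) ∧
      (∀ i k, X i k =ᵐ[mu0] fun t => symb i k * U 0 k t) ∧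
      (∀ k t, 0 < t → U 1 k t =
        cvs c (fun k => p k t + ∑ i, - cvs (b i) (fun k => symb i k * U 0 k t) k) k) ∧
      (∀ k t, 0 < t → HasDerivAt (p k) (p' k t) t) ∧ RDu Set.univ p' ∧
      (∀ k t, 0 < t → p' k t =
        (- ∑ i, symb i k * (symb i k * U 0 k t + cvs (b i) (fun k => U 1 k t) k))) := by
  obtain ⟨z, p, x, C, Z, X, hz, hp, hx, cz, cp, cx, hZ, hX, hZz, hXx, ez, ex, ep⟩ :=
    half_solve b hb hreal c hc hinv ψ hψ
  have gp : Gd p := ⟨hp, cp⟩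
  have gx : ∀ i, Gd (x i) := fun i => ⟨hx i, cx i⟩
  have gz : Gd z := ⟨hz, cz⟩
  have ez' : Zof b c p x = z := ez.symm
  have gs : Gd (stepP b z x) := (Gd.sum fun i => ((gx i).add (gz.conv (hb i))).symb i).neg
  have rp : Rl p (stepP b z x) := by
    intro k t ht
    have h0 := ep k 0 le_rfl
    rw [intervalIntegral.integral_same, sub_zero] at h0
    rw [ep k t ht, h0]
    unfold stepP
    rw [intervalIntegral.integral_neg, sub_eq_add_neg]
  have rx : ∀ i, Rl (x i) (stepX z i) := by
    intro i k t ht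
    have h0 := ex i k 0 le_rfl
    rw [intervalIntegral.integral_same, add_zero] at h0
    rw [ex i k t ht, h0]
    unfold stepX
    rw [intervalIntegral.integral_const_mul]
    ring
  obtain ⟨zs, h0, hG, hR⟩ := boot_seq hb hc gp gx (by rw [ez']; exact rp) (by rw [ez']; exact rx)
  obtain ⟨W, hW, hWd, hW0⟩ := extend_fam hG hR
  rw [h0, ez'] at hW0
  have hWc : ∀ k, Continuous (W 0 k) := fun k =>
    continuous_iff_continuousAt.mpr fun t => (hWd 0 k t).continuousAt
  let V : (Fin n → ℤ) → ℝ → ℂ := fun k t => ψ k + ∫ s in (0:ℝ)..t, W 0 k s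
  let U : ℕ → (Fin n → ℤ) → ℝ → ℂ := fun j => Nat.casesOn j V W
  have hU0 : U 0 = V := rfl
  have hU1 : ∀ j, U (j+1) = W j := fun _ => rfl
  have hVd : ∀ k t, HasDerivAt (V k) (W 0 k t) t := fun k t =>
    (intervalIntegral.integral_hasDerivAt_right ((hWc k).intervalIntegrable _ _)
      ((hWc k).stronglyMeasurableAtFilter _ _) (hWc k).continuousAt).const_add _
  have hVL : LD V := by
    intro M s
    obtain ⟨A, hA⟩ := hψ s
    obtain ⟨B, hB⟩ := hW 0 s
    refine ⟨A + B * M, fun k t ht => ?_⟩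
    have hwp : 0 < wt k ^ s := pow_pos (wt_pos k) s
    have h1 : ‖∫ s in (0:ℝ)..t, W 0 k s‖ ≤ (B / wt k ^ s) * |t - 0| :=
      intervalIntegral.norm_integral_le_of_norm_le_const fun y _ => by
        rw [le_div_iff₀ hwp]; exact hB k y trivial
    rw [sub_zero] at h1
    have hB0 : 0 ≤ B := le_trans (by positivity) (hB k 0 trivial)
    have htM : |t| ≤ M := abs_le.mpr ⟨ht.1.le, ht.2.le⟩
    calc ‖V k t‖ * wt k ^ s ≤ (‖ψ k‖ + B / wt k ^ s * |t|) * wt k ^ s := by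
          gcongr; exact (norm_add_le _ _).trans (by gcongr)
      _ = ‖ψ k‖ * wt k ^ s + B * |t| := by field_simp
      _ ≤ A + B * M := by gcongr; exact hA k
  have hVx : ∀ i k t, 0 ≤ t → x i k t = symb i k * V k t := by
    intro i k t ht
    rw [ex i k t ht]
    congr 2
    refine intervalIntegral.integral_congr fun s hs => ?_
    rw [Set.uIcc_of_le ht] at hs
    exact (hW0 k s hs.1).symm
  have hst : ∀ k t, 0 < t → stepP b z x k t =
      (- ∑ i, symb i k * (symb i k * U 0 k t + cvs (b i) (fun k => U 1 k t) k)) := by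
    intro k t ht
    unfold stepP
    congr 1
    refine Finset.sum_congr rfl fun i _ => ?_
    rw [hVx i k t ht.le]
    congr 2
    unfold conv cvs
    refine tsum_congr fun l => ?_
    rw [← hW0 _ t ht.le]
    rfl
  refine ⟨U, p, stepP b z x, Z, X, ⟨?_, ?_⟩, ?_, hp, hZ, hX, ?_, ?_, ?_, ?_, gs.1, hst⟩
  · intro j
    cases j with
    | zero => exact hVL
    | succ j => exact (hW j).toLD
  · intro j
    cases j with
    | zero => exact hVd
    | succ j => exact hWd j
  · intro k
    show ψ k + ∫ s in (0:ℝ)..0, W 0 k s = ψ k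
    simp
  · intro k
    filter_upwards [hZz k, ae_restrict_mem measurableSet_Ioi] with t h1 h2
    rw [h1]; exact (hW0 k t (le_of_lt h2)).symm
  · intro i k
    filter_upwards [hXx i k, ae_restrict_mem measurableSet_Ioi] with t h1 h2
    rw [h1]; exact hVx i k t (le_of_lt h2)
  · intro k t ht
    show W 0 k t = _
    rw [hW0 k t ht.le, ez]
    unfold conv cvs
    refine tsum_congr fun l => ?_
    congr 1
    show _ + _ = _ + _
    congr 1
    refine Finset.sum_congr rfl fun i _ => ?_
    congr 1
    refine tsum_congr fun m => ?_
    rw [hVx i _ t ht.le]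
    rfl
  · intro k t ht
    exact (rp.hasDeriv gs k ht.le).hasDerivAt (Ici_mem_nhds ht)

end flat

section l2
variable {n : ℕ}

lemma tsum_sq_le {a : (Fin n → ℤ) → ℝ} (ha : ∀ k, 0 ≤ a k) (hs : Summable a)
    (hs2 : Summable fun k => (wt k ^ n * a k) ^ 2) :
    (∑' k, a k) ^ 2 ≤ (∑' k : Fin n → ℤ, (wt k)⁻¹ ^ (2 * n)) * ∑' k, (wt k ^ n * a k) ^ 2 := by
  have h1 : Filter.Tendsto (fun S : Finset (Fin n → ℤ) => (∑ k ∈ S, a k) ^ 2) Filter.atTop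
      (nhds ((∑' k, a k) ^ 2)) := (hs.hasSum).pow 2
  refine le_of_tendsto' h1 fun S => ?_
  have h2 : ∑ k ∈ S, a k = ∑ k ∈ S, ((wt k)⁻¹ ^ n) * (wt k ^ n * a k) := by
    refine Finset.sum_congr rfl fun k _ => ?_
    have := (wt_pos k).ne'
    rw [inv_pow]; field_simp
  rw [h2]
  refine (Finset.sum_mul_sq_le_sq_mul_sq _ _ _).trans ?_
  have h3 : ∑ k ∈ S, ((wt k)⁻¹ ^ n) ^ 2 = ∑ k ∈ S, (wt k)⁻¹ ^ (2 * n) :=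
    Finset.sum_congr rfl fun k _ => by rw [← pow_mul, mul_comm]
  rw [h3]
  refine mul_le_mul ((summable_wt n).sum_le_tsum S fun k _ => ?_)
    (hs2.sum_le_tsum S fun k _ => sq_nonneg _) (Finset.sum_nonneg fun k _ => sq_nonneg _) ?_
  · have := wt_pos k; positivity
  · exact tsum_nonneg fun k => by have := wt_pos k; positivity

lemma G2_lint (F : G2) : ∫⁻ t, ‖F t‖ₑ ^ 2 ∂mu0 = ENNReal.ofReal (‖F‖ ^ 2) := by
  have h := eLpNorm_nnreal_pow_eq_lintegral (f := F) (μ := mu0) (p := 2) (by norm_num)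
  have h2 : ‖F‖ₑ = eLpNorm F 2 mu0 := Lp.enorm_def F
  rw [ENNReal.ofReal_pow (norm_nonneg _), ofReal_norm_eq_enorm, h2]
  have h3 : ((2 : NNReal) : ENNReal) = 2 := rfl
  rw [h3] at h
  have h4 : ((2 : NNReal) : ℝ) = ((2:ℕ) : ℝ) := by norm_num
  rw [h4] at h
  simp only [ENNReal.rpow_natCast] at h
  exact h.symm

lemma Syn_L2 {f : (Fin n → ℤ) → ℝ → ℂ} (hf : LD f) (hcont : Continuous (Syn f))
    (hfc : ∀ k, Continuous (f k)) {F : (Fin n → ℤ) → G2} (hF : RD F)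
    (hFf : ∀ k, F k =ᵐ[mu0] f k) :
    IntegrableOn (fun p => ‖Syn f p‖ ^ 2) (cell n ×ˢ Set.Ioi (0:ℝ)) := by
  refine ⟨(hcont.norm.pow 2).aestronglyMeasurable, ?_⟩
  set A := ∑' k : Fin n → ℤ, (wt k)⁻¹ ^ (2 * n) with hA
  have hA0 : 0 ≤ A := tsum_nonneg fun k => by have := wt_pos k; positivity
  have hb : ∀ p : (Fin n → ℝ) × ℝ, ‖‖Syn f p‖ ^ 2‖ₑ ≤ ENNReal.ofReal A *
      ∑' k : Fin n → ℤ, ENNReal.ofReal (wt k ^ (2*n)) * ‖f k p.2‖ₑ ^ 2 := by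
    intro p
    have hR := hf.at p.2
    have hs := hR.summable_norm
    have hs2 : Summable fun k => (wt k ^ n * ‖f k p.2‖) ^ 2 := by
      obtain ⟨C, hC⟩ := hR (2 * n)
      have hC0 : 0 ≤ C := le_trans (by have := wt_pos (0 : Fin n → ℤ); positivity) (hC 0)
      refine Summable.of_nonneg_of_le (fun k => sq_nonneg _) (fun k => ?_)
        ((summable_wt n).mul_left (C^2))
      have hw := wt_pos k
      have h1 : wt k ^ n * ‖f k p.2‖ ≤ C * (wt k)⁻¹ ^ n := by
        rw [inv_pow, ← div_eq_mul_inv, le_div_iff₀ (by positivity)]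
        refine le_trans (le_of_eq ?_) (hC k)
        ring
      calc (wt k ^ n * ‖f k p.2‖) ^ 2 ≤ (C * (wt k)⁻¹ ^ n) ^ 2 := by gcongr
        _ = _ := by ring
    have h1 : ‖Syn f p‖ ≤ ∑' k, ‖f k p.2‖ := by
      unfold Syn FS
      refine (norm_tsum_le_tsum_norm (FS_summable_norm hR _)).trans (le_of_eq ?_)
      refine tsum_congr fun k => ?_
      rw [norm_mul, ek_norm, mul_one]
    have h2 : ‖Syn f p‖ ^ 2 ≤ A * ∑' k, (wt k ^ n * ‖f k p.2‖) ^ 2 :=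
      (by gcongr : _ ≤ (∑' k, ‖f k p.2‖) ^ 2).trans (tsum_sq_le (fun k => norm_nonneg _) hs hs2)
    rw [Real.enorm_of_nonneg (sq_nonneg _)]
    refine (ENNReal.ofReal_le_ofReal h2).trans (le_of_eq ?_)
    rw [ENNReal.ofReal_mul hA0, ENNReal.ofReal_tsum_of_nonneg (fun k => sq_nonneg _) hs2]
    congr 1
    refine tsum_congr fun k => ?_
    have hw := wt_pos k
    rw [mul_pow, ENNReal.ofReal_mul (by positivity), ← pow_mul, mul_comm n 2,
      ENNReal.ofReal_pow (norm_nonneg _), ofReal_norm_eq_enorm]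
  have hprod : (volume : Measure ((Fin n → ℝ) × ℝ)).restrict (cell n ×ˢ Set.Ioi (0:ℝ)) =
      (volume.restrict (cell n)).prod mu0 := by
    rw [Measure.volume_eq_prod, Measure.prod_restrict]
  unfold HasFiniteIntegral
  refine lt_of_le_of_lt (lintegral_mono hb) ?_
  rw [hprod, lintegral_const_mul' _ _ ENNReal.ofReal_ne_top]
  refine ENNReal.mul_lt_top ENNReal.ofReal_lt_top ?_
  rw [lintegral_tsum fun k => by
    exact (((hfc k).comp continuous_snd).enorm.measurable.pow_const 2).const_mul _ |>.aemeasurable]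
  have hk : ∀ k : Fin n → ℤ, ∫⁻ p : (Fin n → ℝ) × ℝ, ENNReal.ofReal (wt k ^ (2*n)) * ‖f k p.2‖ₑ ^ 2
      ∂((volume.restrict (cell n)).prod mu0) = ENNReal.ofReal (wt k ^ (2*n) * ‖F k‖ ^ 2) := by
    intro k
    rw [lintegral_const_mul' _ _ ENNReal.ofReal_ne_top]
    have h1 := lintegral_prod_mul (μ := volume.restrict (cell n)) (ν := mu0) (f := fun _ => 1)
      (g := fun t => ‖f k t‖ₑ ^ 2) aemeasurable_const
      ((hfc k).enorm.measurable.pow_const 2).aemeasurable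
    simp only [one_mul, lintegral_one, Measure.restrict_apply_univ, cell_vol] at h1
    rw [h1, ENNReal.ofReal_mul (by have := wt_pos k; positivity), ← G2_lint]
    congr 1
    refine lintegral_congr_ae ?_
    filter_upwards [hFf k] with t ht
    rw [ht]
  simp only [hk]
  rw [← ENNReal.ofReal_tsum_of_nonneg]
  · exact ENNReal.ofReal_lt_top
  · intro k; have := wt_pos k; positivity
  · obtain ⟨C, hC⟩ := hF (2 * n)
    refine Summable.of_nonneg_of_le (fun k => by have := wt_pos k; positivity) (fun k => ?_)
        ((summable_wt n).mul_left (C^2))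
    have hw := wt_pos k
    have h1 : wt k ^ n * ‖F k‖ ≤ C * (wt k)⁻¹ ^ n := by
      rw [inv_pow, ← div_eq_mul_inv, le_div_iff₀ (by positivity)]
      refine le_trans (le_of_eq ?_) (hC k)
      ring
    have hC0 : 0 ≤ C := le_trans (by positivity) (hC k)
    calc wt k ^ (2*n) * ‖F k‖ ^ 2 = (wt k ^ n * ‖F k‖) ^ 2 := by ring
      _ ≤ (C * (wt k)⁻¹ ^ n) ^ 2 := by gcongr
      _ = _ := by ring

end l2

section fr
variable {n : ℕ}

lemma sum_dX (a : Fin n → ℂ) (b : ℂ) (j : Fin n) :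
    ((∑ i, a i • dX i) + b • dT : ((Fin n → ℝ) × ℝ) →L[ℝ] ℂ) (eX n j) = a j := by
  have := sum_dxi a j
  have h2 : (∑ i, a i • dX i : ((Fin n → ℝ) × ℝ) →L[ℝ] ℂ) = (∑ i, a i • dxi i).comp (ContinuousLinearMap.fst ℝ _ _) := by
    ext <;> simp [dX]
  rw [h2, add_apply, ContinuousLinearMap.comp_apply]
  show (∑ i, a i • dxi i) (Pi.single j 1) + _ = _
  rw [this]; simp [dT, eX]

lemma sum_dT (a : Fin n → ℂ) (b : ℂ) :
    ((∑ i, a i • dX i) + b • dT : ((Fin n → ℝ) × ℝ) →L[ℝ] ℂ) (eY n) = b := by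
  simp [dT, dX, dxi, eY]

lemma Sm.cont {F : ℕ → (Fin n → ℤ) → ℝ → ℂ} (hF : Sm F) (j) (k) : Continuous (F j k) :=
  continuous_iff_continuousAt.mpr fun t => (hF.2 j k t).continuousAt

/-- real part of a synthesis -/
def RS (f : (Fin n → ℤ) → ℝ → ℂ) (p : (Fin n → ℝ) × ℝ) : ℝ := (Syn f p).re

lemma RS_contDiff {F : ℕ → (Fin n → ℤ) → ℝ → ℂ} (hF : Sm F) : ContDiff ℝ (⊤ : ℕ∞) (RS (F 0)) :=
  Complex.reCLM.contDiff.comp hF.contDiff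

lemma RS_hasF {F : ℕ → (Fin n → ℤ) → ℝ → ℂ} (hF : Sm F) (p) : HasFDerivAt (RS (F 0))
    (Complex.reCLM.comp ((∑ i, Syn (fun k t => symb i k * F 0 k t) p • dX i) + Syn (F 1) p • dT)) p :=
  Complex.reCLM.hasFDerivAt.comp p (Syn_hasFDerivAt (hF.1 0) (hF.1 1) (hF.2 0) p)

lemma RS_pdX {F : ℕ → (Fin n → ℤ) → ℝ → ℂ} (hF : Sm F) (i : Fin n) :
    pdE n (RS (F 0)) (eX n i) = RS (fun k t => symb i k * F 0 k t) := by
  funext p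
  unfold pdE
  rw [(RS_hasF hF p).fderiv, ContinuousLinearMap.comp_apply, sum_dX]
  rfl

lemma RS_pdT {F : ℕ → (Fin n → ℤ) → ℝ → ℂ} (hF : Sm F) :
    pdE n (RS (F 0)) (eY n) = RS (F 1) := by
  funext p
  unfold pdE
  rw [(RS_hasF hF p).fderiv, ContinuousLinearMap.comp_apply, sum_dT]
  rfl

lemma pdE_T_eq {f : (Fin n → ℝ) × ℝ → ℝ} (hf : Differentiable ℝ f) (x : Fin n → ℝ) {t d : ℝ}
    (h : HasDerivAt (fun s => f (x, s)) d t) : pdE n f (eY n) (x, t) = d := by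
  have h1 : HasDerivAt (fun s : ℝ => (x, s)) (eY n) t :=
    (hasDerivAt_const t x).prodMk (hasDerivAt_id t)
  have h2 := (hf (x, t)).hasFDerivAt.comp_hasDerivAt t h1
  exact h2.unique h

lemma pdE_X_eq {f : (Fin n → ℝ) × ℝ → ℝ} (hf : Differentiable ℝ f) (x : Fin n → ℝ) (t : ℝ)
    {D : (Fin n → ℝ) →L[ℝ] ℝ} (i : Fin n)
    (h : HasFDerivAt (fun y => f (y, t)) D x) : pdE n f (eX n i) (x, t) = D (Pi.single i 1) := by
  have h1 : HasFDerivAt (fun y : Fin n → ℝ => (y, t)) (ContinuousLinearMap.inl ℝ (Fin n → ℝ) ℝ) x :=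
    (hasFDerivAt_id x).prodMk (hasFDerivAt_const t x)
  have h2 := (hf (x, t)).hasFDerivAt.comp x h1
  have := h2.unique h
  rw [← this]
  rfl

theorem flat_real (b : Fin n → (Fin n → ℝ) → ℝ) (hb : ∀ i, ContDiff ℝ (⊤ : ℕ∞) (b i))
    (hbp : ∀ i, ZPeriodic n (b i)) (ψ : (Fin n → ℝ) → ℝ) (hψ : ContDiff ℝ (⊤ : ℕ∞) ψ)
    (hψp : ZPeriodic n ψ) :
    ∃ u : (Fin n → ℝ) × ℝ → ℝ, ContDiff ℝ (⊤ : ℕ∞) u ∧ ZPeriodicE n u ∧ (∀ x, u (x, 0) = ψ x) ∧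
      (∀ p : (Fin n → ℝ) × ℝ, 0 < p.2 →
        pdE n (fun p => (1 + ∑ i, b i p.1 ^ 2) * pdE n u (eY n) p + ∑ i, b i p.1 * pdE n u (eX n i) p)
          (eY n) p
        + ∑ i, pdE n (fun p => pdE n u (eX n i) p + b i p.1 * pdE n u (eY n) p) (eX n i) p = 0) ∧
      IntegrableOn (fun p => pdE n u (eY n) p ^ 2) (cell n ×ˢ Set.Ioi (0:ℝ)) ∧
      ∀ i, IntegrableOn (fun p => pdE n u (eX n i) p ^ 2) (cell n ×ˢ Set.Ioi (0:ℝ)) := by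
  have ofRealS : ∀ f : (Fin n → ℝ) → ℝ, ContDiff ℝ (⊤ : ℕ∞) f → ZPeriodic n f →
      ∃ β : (Fin n → ℤ) → ℂ, RD β ∧ ∀ x, FS β x = f x := fun f h1 h2 =>
    exists_FS (f := fun x => (f x : ℂ)) (Complex.ofRealCLM.contDiff.comp h1)
      (fun x k => congrArg Complex.ofReal (h2 x k))
  have ha0 : ∀ x, 0 < 1 + ∑ i, b i x ^ 2 := fun x => by positivity
  choose β hβ hβb using fun i => ofRealS (b i) (hb i) (hbp i)
  obtain ⟨c, hc, hcc⟩ := ofRealS (fun x => (1 + ∑ i, b i x ^ 2)⁻¹)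
    ((contDiff_const.add (ContDiff.sum fun i _ => (hb i).pow 2)).inv fun x => (ha0 x).ne')
    (fun x k => by simp only [hbp _ x k])
  obtain ⟨ψ', hψ', hψψ⟩ := ofRealS ψ hψ hψp
  have hD : RD (fun k : Fin n → ℤ => (if k = 0 then (1:ℂ) else 0) + ∑ i, cvs (β i) (β i) k) :=
    RD_delta.add (RD_sum _ fun i _ => (hβ i).cvs (hβ i))
  have hinv : cvs c (fun k => (if k = 0 then 1 else 0) + ∑ i, cvs (β i) (β i) k)
      = fun k => if k = 0 then 1 else 0 := by
    refine FS_inj (hc.cvs hD) RD_delta fun x => ?_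
    rw [FS_cvs hc hD, FS_delta, FS_add RD_delta (RD_sum _ fun i _ => (hβ i).cvs (hβ i)), FS_delta,
      FS_sum _ fun i => (hβ i).cvs (hβ i), hcc]
    simp only [FS_cvs (hβ _) (hβ _), hβb]
    have := (ha0 x).ne'
    rw [← Complex.ofReal_one]
    simp only [← Complex.ofReal_mul, ← Complex.ofReal_sum, ← Complex.ofReal_add]
    congr 1
    simp only [← pow_two]
    exact inv_mul_cancel₀ this
  obtain ⟨U, P, P', Z, X, hU, hU0, hP, hZ, hX, hZU, hXU, eU, dP, hP', eP'⟩ :=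
    flat_four β hβ (fun i l => real_symm (hβ i) (hβb i) l) c hc hinv ψ' hψ'
  have hXi : ∀ i, pdE n (RS (U 0)) (eX n i) = RS (fun k t => symb i k * U 0 k t) := RS_pdX hU
  have hT : pdE n (RS (U 0)) (eY n) = RS (U 1) := RS_pdT hU
  have cX : ∀ i, ContDiff ℝ (⊤ : ℕ∞) (RS (fun k t => symb i k * U 0 k t)) := fun i =>
    RS_contDiff (hU.symb i)
  have cT : ContDiff ℝ (⊤ : ℕ∞) (RS (U 1)) := RS_contDiff hU.tail
  have cb : ∀ i, ContDiff ℝ (⊤ : ℕ∞) (fun p : (Fin n → ℝ) × ℝ => b i p.1) := fun i =>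
    (hb i).comp contDiff_fst
  have cF : Differentiable ℝ (fun p : (Fin n → ℝ) × ℝ => (1 + ∑ i, b i p.1 ^ 2) * RS (U 1) p
      + ∑ i, b i p.1 * RS (fun k t => symb i k * U 0 k t) p) :=
    (((contDiff_const.add (ContDiff.sum fun i _ => (cb i).pow 2)).mul cT).add
      (ContDiff.sum fun i _ => (cb i).mul (cX i))).differentiable (by simp)
  have cq : ∀ i, Differentiable ℝ (fun p : (Fin n → ℝ) × ℝ => RS (fun k t => symb i k * U 0 k t) p
      + b i p.1 * RS (U 1) p) := fun i =>
    ((cX i).add ((cb i).mul cT)).differentiable (by simp)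
  have rX : ∀ i t, RD (fun k => symb i k * U 0 k t) := fun i t => ((hU.1 0).symb i).at t
  have rT : ∀ t, RD (fun k => U 1 k t) := fun t => (hU.1 1).at t
  -- the flux identity
  have flux : ∀ x t, 0 < t → (1 + ∑ i, b i x ^ 2) * RS (U 1) (x, t)
      + ∑ i, b i x * RS (fun k t => symb i k * U 0 k t) (x, t) = RS P (x, t) := by
    intro x t ht
    have h1 : Syn (U 1) (x, t) = ((1 + ∑ i, b i x ^ 2)⁻¹ : ℝ) *
        (Syn P (x, t) + ∑ i, - (b i x * Syn (fun k t => symb i k * U 0 k t) (x, t))) := by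
      have h2 : (fun k => U 1 k t) = cvs c (fun k => P k t + ∑ i, - cvs (β i) (fun k => symb i k * U 0 k t) k) :=
        funext fun k => eU k t ht
      have rP : RD (fun k => P k t) := hP.toLD.at t
      have rC : ∀ i, RD (fun k => - cvs (β i) (fun k => symb i k * U 0 k t) k) := fun i s => by
        obtain ⟨C, hC⟩ := ((hβ i).cvs (rX i t)) s
        exact ⟨C, fun k => by rw [norm_neg]; exact hC k⟩
      have rS : RD (fun k => ∑ i, - cvs (β i) (fun k => symb i k * U 0 k t) k) :=
        RD_sum _ fun i _ => rC i
      show FS (fun k => U 1 k t) x = _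
      rw [h2, FS_cvs hc (rP.add rS), hcc, FS_add rP rS, FS_sum _ rC]
      simp only [FS_neg ((hβ _).cvs (rX _ t)), FS_cvs (hβ _) (rX _ t), hβb]
      rfl
    have h3 := congrArg Complex.re h1
    rw [Complex.re_ofReal_mul, Complex.add_re, Complex.re_sum] at h3
    simp only [Complex.neg_re, Complex.re_ofReal_mul] at h3
    have h4 : RS (U 1) (x, t) = (1 + ∑ i, b i x ^ 2)⁻¹ * (RS P (x, t) +
      ∑ i, - (b i x * RS (fun k t => symb i k * U 0 k t) (x, t))) := h3
    rw [h4, mul_inv_cancel_left₀ (ha0 x).ne', Finset.sum_neg_distrib]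
    ring
  refine ⟨RS (U 0), RS_contDiff hU, ?_, ?_, ?_, ?_, ?_⟩
  · intro x y k
    exact congrArg Complex.re (FS_periodic _ x k)
  · intro x
    show (FS (fun k => U 0 k 0) x).re = ψ x
    simp only [hU0]
    rw [hψψ, Complex.ofReal_re]
  · rintro ⟨x, t⟩ ht
    replace ht : 0 < t := ht
    simp only [hXi, hT]
    have e1 := pdE_T_eq cF x (t := t) (d := RS P' (x, t)) (by
      have h1 : HasDerivAt (fun s => RS P (x, s)) (RS P' (x, t)) t :=
        Complex.reCLM.hasFDerivAt.comp_hasDerivAt t (Syn_time_deriv hP.toLD hP'.toLD dP x ht)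
      refine h1.congr_of_eventuallyEq ?_
      filter_upwards [lt_mem_nhds ht] with s hs
      exact flux x s hs)
    have rQ : ∀ i, RD (fun k => symb i k * U 0 k t + cvs (β i) (fun k => U 1 k t) k) := fun i =>
      (rX i t).add ((hβ i).cvs (rT t))
    have e2 : ∀ i, pdE n (fun p => RS (fun k t => symb i k * U 0 k t) p + b i p.1 * RS (U 1) p) (eX n i) (x, t)
        = (FS (fun k => symb i k * (symb i k * U 0 k t + cvs (β i) (fun k => U 1 k t) k)) x).re := by
      intro i
      have h1 := Complex.reCLM.hasFDerivAt.comp x (FS_hasFDerivAt (rQ i) x)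
      have h2 : (fun y => RS (fun k t => symb i k * U 0 k t) (y, t) + b i y * RS (U 1) (y, t)) =
          Complex.reCLM ∘ FS (fun k => symb i k * U 0 k t + cvs (β i) (fun k => U 1 k t) k) := by
        funext y
        show _ = (FS (fun k => symb i k * U 0 k t + cvs (β i) (fun k => U 1 k t) k) y).re
        rw [FS_add (rX i t) ((hβ i).cvs (rT t)), FS_cvs (hβ i) (rT t), hβb, Complex.add_re,
          Complex.re_ofReal_mul]
        rfl
      rw [← h2] at h1
      rw [pdE_X_eq (cq i) x t i h1, ContinuousLinearMap.comp_apply, sum_dxi]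
      rfl
    rw [e1]
    simp only [e2]
    have h5 : (fun k => P' k t) =
        fun k => - ∑ i, symb i k * (symb i k * U 0 k t + cvs (β i) (fun k => U 1 k t) k) :=
      funext fun k => eP' k t ht
    have h6 : RS P' (x, t) = (FS (fun k => P' k t) x).re := rfl
    rw [h6, h5, FS_neg (RD_sum _ fun i _ => (rQ i).symb i), FS_sum _ fun i => (rQ i).symb i,
      Complex.neg_re, Complex.re_sum]
    ring
  · rw [hT]
    refine (Syn_L2 (hU.1 1) hU.tail.contDiff.continuous (hU.cont 1) hZ hZU).mono'
      ((cT.continuous.pow 2).aestronglyMeasurable) (Filter.Eventually.of_forall fun p => ?_)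
    rw [Real.norm_of_nonneg (sq_nonneg _), ← sq_abs]
    exact pow_le_pow_left₀ (abs_nonneg _) (Complex.abs_re_le_norm _) 2
  · intro i
    rw [hXi]
    refine (Syn_L2 ((hU.1 0).symb i) (hU.symb i).contDiff.continuous ((hU.symb i).cont 0) (hX i) (hXU i)).mono'
      (((cX i).continuous.pow 2).aestronglyMeasurable) (Filter.Eventually.of_forall fun p => ?_)
    rw [Real.norm_of_nonneg (sq_nonneg _), ← sq_abs]
    exact pow_le_pow_left₀ (abs_nonneg _) (Complex.abs_re_le_norm _) 2

end fr

section shear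
variable {n : ℕ}

/-- the shear `(x,y) ↦ (x, h x - y)` -/
def shr (h : (Fin n → ℝ) → ℝ) (p : (Fin n → ℝ) × ℝ) : (Fin n → ℝ) × ℝ := (p.1, h p.1 - p.2)

lemma shr_shr (h : (Fin n → ℝ) → ℝ) (p) : shr h (shr h p) = p := by
  unfold shr; ext <;> simp

lemma shr_fst (h : (Fin n → ℝ) → ℝ) (p) : (shr h p).1 = p.1 := rfl

lemma shr_smooth {h : (Fin n → ℝ) → ℝ} (hh : ContDiff ℝ (⊤ : ℕ∞) h) : ContDiff ℝ (⊤ : ℕ∞) (shr h) :=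
  contDiff_fst.prodMk ((hh.comp contDiff_fst).sub contDiff_snd)

lemma pdE_smooth {φ : (Fin n → ℝ) × ℝ → ℝ} (hφ : ContDiff ℝ (⊤ : ℕ∞) φ) (v) :
    ContDiff ℝ (⊤ : ℕ∞) (pdE n φ v) :=
  (hφ.fderiv_right (m := (⊤ : ℕ∞)) (by simp)).clm_apply contDiff_const

lemma shr_hasF {h : (Fin n → ℝ) → ℝ} (hh : Differentiable ℝ h) (p : (Fin n → ℝ) × ℝ) :
    HasFDerivAt (shr h) ((ContinuousLinearMap.fst ℝ (Fin n → ℝ) ℝ).prod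
      ((fderiv ℝ h p.1).comp (ContinuousLinearMap.fst ℝ (Fin n → ℝ) ℝ) -
        ContinuousLinearMap.snd ℝ (Fin n → ℝ) ℝ)) p :=
  hasFDerivAt_fst.prodMk (((hh p.1).hasFDerivAt.comp p hasFDerivAt_fst).sub hasFDerivAt_snd)

lemma pdY_shr {h : (Fin n → ℝ) → ℝ} (hh : Differentiable ℝ h) {v : (Fin n → ℝ) × ℝ → ℝ}
    (hv : Differentiable ℝ v) (p) :
    pdE n (fun p => v (shr h p)) (eY n) p = - pdE n v (eY n) (shr h p) := by
  have h1 := (hv (shr h p)).hasFDerivAt.comp p (shr_hasF hh p)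
  have h2 : pdE n (fun p => v (shr h p)) (eY n) p = _ :=
    congrArg (fun L : ((Fin n → ℝ) × ℝ) →L[ℝ] ℝ => L (eY n)) h1.fderiv
  rw [h2]
  unfold pdE
  rw [ContinuousLinearMap.comp_apply, ← map_neg]
  congr 1
  simp [eY]

lemma pdX_shr {h : (Fin n → ℝ) → ℝ} (hh : Differentiable ℝ h) {v : (Fin n → ℝ) × ℝ → ℝ}
    (hv : Differentiable ℝ v) (i : Fin n) (p) :
    pdE n (fun p => v (shr h p)) (eX n i) p =
      pdE n v (eX n i) (shr h p) + pdX n h i p.1 * pdE n v (eY n) (shr h p) := by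
  have h1 := (hv (shr h p)).hasFDerivAt.comp p (shr_hasF hh p)
  have h2 : pdE n (fun p => v (shr h p)) (eX n i) p = _ :=
    congrArg (fun L : ((Fin n → ℝ) × ℝ) →L[ℝ] ℝ => L (eX n i)) h1.fderiv
  rw [h2]
  unfold pdE
  rw [ContinuousLinearMap.comp_apply, ← smul_eq_mul, ← map_smul, ← map_add]
  congr 1
  simp [eX, eY, pdX]

/-- normal flux -/
def flx (b : Fin n → (Fin n → ℝ) → ℝ) (u : (Fin n → ℝ) × ℝ → ℝ) (p : (Fin n → ℝ) × ℝ) : ℝ :=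
  (1 + ∑ i, b i p.1 ^ 2) * pdE n u (eY n) p + ∑ i, b i p.1 * pdE n u (eX n i) p

/-- tangential flux -/
def tfx (b : Fin n → (Fin n → ℝ) → ℝ) (u : (Fin n → ℝ) × ℝ → ℝ) (i : Fin n) (p : (Fin n → ℝ) × ℝ) : ℝ :=
  pdE n u (eX n i) p + b i p.1 * pdE n u (eY n) p

lemma line_T {v : (Fin n → ℝ) × ℝ → ℝ} (hv : Differentiable ℝ v) (x : Fin n → ℝ) (t : ℝ) :
    HasDerivAt (fun s => v (x, s)) (pdE n v (eY n) (x, t)) t := by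
  have h1 : HasDerivAt (fun s : ℝ => (x, s)) (eY n) t :=
    (hasDerivAt_const t x).prodMk (hasDerivAt_id t)
  exact (hv (x, t)).hasFDerivAt.comp_hasDerivAt t h1

lemma line_X {v : (Fin n → ℝ) × ℝ → ℝ} (hv : Differentiable ℝ v) (x : Fin n → ℝ) (t : ℝ) (i : Fin n) :
    fderiv ℝ (fun y => v (y, t)) x (Pi.single i 1) = pdE n v (eX n i) (x, t) := by
  have h1 : HasFDerivAt (fun y : Fin n → ℝ => (y, t)) (ContinuousLinearMap.inl ℝ (Fin n → ℝ) ℝ) x :=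
    (hasFDerivAt_id x).prodMk (hasFDerivAt_const t x)
  have h2 := (hv (x, t)).hasFDerivAt.comp x h1
  have h3 : fderiv ℝ (fun y => v (y, t)) x = _ := h2.fderiv
  rw [h3]; rfl

lemma dfb {f : (Fin n → ℝ) × ℝ → ℝ} (hf : ContDiff ℝ (⊤ : ℕ∞) f) : Differentiable ℝ f :=
  hf.differentiable (by simp)

variable {b : Fin n → (Fin n → ℝ) → ℝ}

lemma flx_smooth (hb : ∀ i, ContDiff ℝ (⊤ : ℕ∞) (b i)) {u : (Fin n → ℝ) × ℝ → ℝ}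
    (hu : ContDiff ℝ (⊤ : ℕ∞) u) : ContDiff ℝ (⊤ : ℕ∞) (flx b u) := by
  have cb : ∀ i, ContDiff ℝ (⊤ : ℕ∞) (fun p : (Fin n → ℝ) × ℝ => b i p.1) := fun i =>
    (hb i).comp contDiff_fst
  exact (((contDiff_const.add (ContDiff.sum fun i _ => (cb i).pow 2)).mul (pdE_smooth hu _)).add
      (ContDiff.sum fun i _ => (cb i).mul (pdE_smooth hu _)))

lemma tfx_smooth (hb : ∀ i, ContDiff ℝ (⊤ : ℕ∞) (b i)) {u : (Fin n → ℝ) × ℝ → ℝ}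
    (hu : ContDiff ℝ (⊤ : ℕ∞) u) (i) : ContDiff ℝ (⊤ : ℕ∞) (tfx b u i) :=
  (pdE_smooth hu _).add (((hb i).comp contDiff_fst).mul (pdE_smooth hu _))

lemma flx_eq (u : (Fin n → ℝ) × ℝ → ℝ) (p) :
    flx b u p = pdE n u (eY n) p + ∑ i, b i p.1 * tfx b u i p := by
  unfold flx tfx
  simp only [mul_add, Finset.sum_add_distrib, add_mul, one_mul, Finset.sum_mul]
  have : ∑ i, b i p.1 ^ 2 * pdE n u (eY n) p = ∑ i, b i p.1 * (b i p.1 * pdE n u (eY n) p) :=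
    Finset.sum_congr rfl fun i _ => by ring
  rw [this]; ring

lemma flx_pdT (hb : ∀ i, ContDiff ℝ (⊤ : ℕ∞) (b i)) {u : (Fin n → ℝ) × ℝ → ℝ}
    (hu : ContDiff ℝ (⊤ : ℕ∞) u) (p) : pdE n (flx b u) (eY n) p =
      pdE n (pdE n u (eY n)) (eY n) p + ∑ i, b i p.1 * pdE n (tfx b u i) (eY n) p := by
  obtain ⟨x, t⟩ := p
  refine pdE_T_eq (dfb (flx_smooth hb hu)) x ?_
  have h1 : (fun s => flx b u (x, s)) = fun s => pdE n u (eY n) (x, s) + ∑ i, b i x * tfx b u i (x, s) :=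
    funext fun s => flx_eq u (x, s)
  rw [h1]
  exact (line_T (dfb (pdE_smooth hu _)) x t).add
    (HasDerivAt.fun_sum fun i _ => (line_T (dfb (tfx_smooth hb hu i)) x t).const_mul (b i x))

lemma lap_shr {h : (Fin n → ℝ) → ℝ} (hh : ContDiff ℝ (⊤ : ℕ∞) h) {u : (Fin n → ℝ) × ℝ → ℝ}
    (hu : ContDiff ℝ (⊤ : ℕ∞) u) (p) : lapE n (fun p => u (shr h p)) p =
      pdE n (flx (pdX n h) u) (eY n) (shr h p) + ∑ i, pdE n (tfx (pdX n h) u i) (eX n i) (shr h p) := by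
  have hb : ∀ i, ContDiff ℝ (⊤ : ℕ∞) (pdX n h i) := fun i => pd_smooth hh _
  have hd : Differentiable ℝ h := hh.differentiable (by simp)
  have eX' : ∀ i, pdE n (fun p => u (shr h p)) (eX n i) = fun p => tfx (pdX n h) u i (shr h p) := fun i =>
    funext fun p => pdX_shr hd (dfb hu) i p
  have eY' : pdE n (fun p => u (shr h p)) (eY n) = fun p => (fun r => - pdE n u (eY n) r) (shr h p) :=
    funext fun p => pdY_shr hd (dfb hu) p
  unfold lapE
  have hneg : pdE n (fun r => - pdE n u (eY n) r) (eY n) (shr h p) =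
      - pdE n (pdE n u (eY n)) (eY n) (shr h p) := by
    unfold pdE; rw [fderiv_fun_neg]; rfl
  rw [eY', pdY_shr hd (dfb (pdE_smooth hu _).neg), hneg, neg_neg, flx_pdT hb hu]
  have : ∀ i, pdE n (pdE n (fun p => u (shr h p)) (eX n i)) (eX n i) p =
      pdE n (tfx (pdX n h) u i) (eX n i) (shr h p) + pdX n h i p.1 * pdE n (tfx (pdX n h) u i) (eY n) (shr h p) :=
    fun i => by rw [eX', pdX_shr hd (dfb (tfx_smooth hb hu i))]
  simp only [this, Finset.sum_add_distrib, shr_fst]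
  ring

lemma shr_mp {h : (Fin n → ℝ) → ℝ} (hh : Continuous h) :
    MeasurePreserving (shr h) (volume : Measure ((Fin n → ℝ) × ℝ)) volume := by
  have := MeasurePreserving.skew_product (μa := (volume : Measure (Fin n → ℝ))) (μb := volume)
    (μc := (volume : Measure ℝ)) (μd := (volume : Measure ℝ)) (f := id) (MeasurePreserving.id _)
    (g := fun x y => h x - y)
    (((hh.comp continuous_fst).sub continuous_snd).measurable)
    (Filter.Eventually.of_forall fun x => (Measure.measurePreserving_sub_left volume (h x)).map_eq)
  exact this

lemma fluid_meas {h : (Fin n → ℝ) → ℝ} (hh : Continuous h) : MeasurableSet (fluidCell n h) := by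
  have h1 : MeasurableSet {p : (Fin n → ℝ) × ℝ | p.1 ∈ cell n} := measurable_fst cell_meas
  have h2 : MeasurableSet {p : (Fin n → ℝ) × ℝ | p.2 < h p.1} :=
    measurableSet_lt measurable_snd (hh.comp continuous_fst).measurable
  exact h1.inter h2

lemma shr_pre (h : (Fin n → ℝ) → ℝ) : shr h ⁻¹' (cell n ×ˢ Set.Ioi (0:ℝ)) = fluidCell n h := by
  ext p; simp [shr, fluidCell]

lemma shr_pre' (h : (Fin n → ℝ) → ℝ) : shr h ⁻¹' (fluidCell n h) = cell n ×ˢ Set.Ioi (0:ℝ) := by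
  ext p; simp [shr, fluidCell]

lemma shr_int {h : (Fin n → ℝ) → ℝ} (hh : Continuous h) {f : (Fin n → ℝ) × ℝ → ℝ}
    (hf : IntegrableOn f (cell n ×ˢ Set.Ioi (0:ℝ))) :
    IntegrableOn (fun p => f (shr h p)) (fluidCell n h) := by
  rw [← shr_pre h]
  exact ((shr_mp hh).restrict_preimage (cell_meas.prod measurableSet_Ioi)).integrable_comp_of_integrable hf

lemma shr_int' {h : (Fin n → ℝ) → ℝ} (hh : Continuous h) {f : (Fin n → ℝ) × ℝ → ℝ}
    (hf : IntegrableOn f (fluidCell n h)) :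
    IntegrableOn (fun p => f (shr h p)) (cell n ×ˢ Set.Ioi (0:ℝ)) := by
  rw [← shr_pre' h]
  exact ((shr_mp hh).restrict_preimage (fluid_meas hh)).integrable_comp_of_integrable hf

/-- `(f + b g)²` is integrable when `f²`, `g²` are. -/
lemma sq_comb {S : Set ((Fin n → ℝ) × ℝ)} (hS : ∀ p ∈ S, p.1 ∈ cell n) (hSm : MeasurableSet S)
    {b : (Fin n → ℝ) → ℝ} (hb : Continuous b) {f g : (Fin n → ℝ) × ℝ → ℝ} (hf : Continuous f)
    (hg : Continuous g) (hf2 : IntegrableOn (fun p => f p ^ 2) S) (hg2 : IntegrableOn (fun p => g p ^ 2) S) :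
    IntegrableOn (fun p => (f p + b p.1 * g p) ^ 2) S := by
  obtain ⟨C, hC0, hC⟩ := cont_bdd hb
  refine ((hf2.const_mul 2).add (hg2.const_mul (2 * C^2))).mono'
    ((hf.add ((hb.comp continuous_fst).mul hg)).pow 2).aestronglyMeasurable ?_
  filter_upwards [ae_restrict_mem hSm] with p hp
  have h1 : b p.1 ^ 2 ≤ C ^ 2 := by
    rw [← sq_abs]; exact pow_le_pow_left₀ (abs_nonneg _) (hC _ (hS p hp)) 2
  rw [Real.norm_of_nonneg (sq_nonneg _)]
  show _ ≤ 2 * f p ^ 2 + 2 * C^2 * g p ^ 2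
  nlinarith [sq_nonneg (f p - b p.1 * g p), mul_le_mul_of_nonneg_right h1 (sq_nonneg (g p))]

theorem harm_exists {h ψ : (Fin n → ℝ) → ℝ} (hh : ContDiff ℝ (⊤ : ℕ∞) h) (hhp : ZPeriodic n h)
    (hψ : ContDiff ℝ (⊤ : ℕ∞) ψ) (hψp : ZPeriodic n ψ) : ∃ φ, IsHarmonicExt n h ψ φ := by
  have hb : ∀ i, ContDiff ℝ (⊤ : ℕ∞) (pdX n h i) := fun i => pd_smooth hh _
  have hbp : ∀ i, ZPeriodic n (pdX n h i) := fun i => pd_per hhp _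
  have hd : Differentiable ℝ h := hh.differentiable (by simp)
  obtain ⟨u, hu, hup, hu0, hpde, hT, hX⟩ := flat_real (pdX n h) hb hbp ψ hψ hψp
  refine ⟨fun p => u (shr h p), hu.comp (shr_smooth hh), ?_, ?_, ?_, ?_⟩
  · intro x y k
    simp only [shr, hhp x k]
    exact hup x (h x - y) k
  · intro p hp
    rw [lap_shr hh hu]
    exact hpde (shr h p) (by simpa [shr] using hp)
  · intro x
    simp [shr, hu0]
  · have e : gradSqE n (fun p => u (shr h p)) = fun p =>
        (fun r => (∑ i, (pdE n u (eX n i) r + pdX n h i r.1 * pdE n u (eY n) r) ^ 2) +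
          pdE n u (eY n) r ^ 2) (shr h p) := by
      funext p
      unfold gradSqE
      simp only [pdX_shr hd (dfb hu), pdY_shr hd (dfb hu), neg_sq, shr_fst]
    rw [e]
    refine shr_int (f := fun r => (∑ i, (pdE n u (eX n i) r + pdX n h i r.1 * pdE n u (eY n) r) ^ 2) +
          pdE n u (eY n) r ^ 2) hh.continuous ?_
    refine Integrable.add (integrable_finset_sum _ fun i _ => ?_) hT
    exact sq_comb (fun p hp => hp.1) (cell_meas.prod measurableSet_Ioi) (hb i).continuous
      (pdE_smooth hu _).continuous (pdE_smooth hu _).continuous (hX i) hT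

end shear

section green
variable {n : ℕ}

/-- flattened harmonic functions -/
structure FH (b : Fin n → (Fin n → ℝ) → ℝ) (v : (Fin n → ℝ) × ℝ → ℝ) : Prop where
  smooth : ContDiff ℝ (⊤ : ℕ∞) v
  per : ZPeriodicE n v
  pde : ∀ p : (Fin n → ℝ) × ℝ, 0 < p.2 →
    pdE n (flx b v) (eY n) p + ∑ i, pdE n (tfx b v i) (eX n i) p = 0
  lT : IntegrableOn (fun p => pdE n v (eY n) p ^ 2) (cell n ×ˢ Set.Ioi (0:ℝ))
  lX : ∀ i, IntegrableOn (fun p => pdE n v (eX n i) p ^ 2) (cell n ×ˢ Set.Ioi (0:ℝ))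

lemma pdE_per {φ : (Fin n → ℝ) × ℝ → ℝ} (hp : ZPeriodicE n φ) (v) : ZPeriodicE n (pdE n φ v) := by
  intro x y k
  have : φ = fun p => φ (p + ((fun i => (k i : ℝ)), 0)) := funext fun p => by
    obtain ⟨x, y⟩ := p
    rw [← hp x y k]; simp
  unfold pdE
  conv_rhs => rw [this]
  rw [fderiv_comp_add_right]
  simp

/-- differentiation under the integral over the cell -/
lemma cell_deriv {w : (Fin n → ℝ) × ℝ → ℝ} (hw : ContDiff ℝ (⊤ : ℕ∞) w) (t : ℝ) :
    HasDerivAt (fun t => ∫ x in cell n, w (x, t)) (∫ x in cell n, pdE n w (eY n) (x, t)) t := by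
  have hc : Continuous (pdE n w (eY n)) := (pdE_smooth hw _).continuous
  obtain ⟨C, hC⟩ := ((isCompact_Icc (a := (0 : Fin n → ℝ)) (b := 1)).prod
    (isCompact_Icc (a := t - 1) (b := t + 1))).exists_bound_of_continuousOn hc.continuousOn
  have hs : ∀ s, Continuous fun x : Fin n → ℝ => w (x, s) := fun s =>
    hw.continuous.comp (continuous_id.prodMk continuous_const)
  refine (hasDerivAt_integral_of_dominated_loc_of_deriv_le (μ := volume.restrict (cell n))
    (F := fun s x => w (x, s)) (F' := fun s x => pdE n w (eY n) (x, s)) (x₀ := t)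
    (s := Set.Ioo (t - 1) (t + 1)) (bound := fun _ => C) (Ioo_mem_nhds (by linarith) (by linarith))
    (Filter.Eventually.of_forall fun s => (hs s).aestronglyMeasurable) (cont_intOn (hs t))
    (hc.comp (continuous_id.prodMk continuous_const)).aestronglyMeasurable ?_
    (integrable_const _) ?_).2
  · filter_upwards [ae_restrict_mem cell_meas] with x hx s hs
    exact hC (x, s) ⟨cell_sub hx, hs.1.le, hs.2.le⟩
  · exact Filter.Eventually.of_forall fun x s _ => line_T (dfb hw) x s

variable {b : Fin n → (Fin n → ℝ) → ℝ}

lemma tfx_per (hbp : ∀ i, ZPeriodic n (b i)) {v : (Fin n → ℝ) × ℝ → ℝ} (hv : ZPeriodicE n v) (i) :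
    ZPeriodicE n (tfx b v i) := by
  intro x y k
  unfold tfx
  rw [pdE_per hv _ x y k, pdE_per hv _ x y k]
  simp only [hbp i x k]

lemma green_deriv (hb : ∀ i, ContDiff ℝ (⊤ : ℕ∞) (b i)) (hbp : ∀ i, ZPeriodic n (b i))
    {v w : (Fin n → ℝ) × ℝ → ℝ} (hv : FH b v) (hw : FH b w) {t : ℝ} (ht : 0 < t) :
    HasDerivAt (fun t => ∫ x in cell n, (v (x, t) * flx b w (x, t) - w (x, t) * flx b v (x, t))) 0 t := by
  have cv := hv.smooth
  have cw := hw.smooth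
  have fv := flx_smooth hb cv
  have fw := flx_smooth hb cw
  have tv := tfx_smooth hb cv
  have tw := tfx_smooth hb cw
  have h1 := cell_deriv (w := fun p => v p * flx b w p - w p * flx b v p) ((cv.mul fw).sub (cw.mul fv)) t
  have cz : ∀ i, ContDiff ℝ (⊤ : ℕ∞) (fun p => v p * tfx b w i p - w p * tfx b v i p) := fun i =>
    (cv.mul (tw i)).sub (cw.mul (tv i))
  have cz' : ∀ i, ContDiff ℝ (⊤ : ℕ∞) (fun x => v (x, t) * tfx b w i (x, t) - w (x, t) * tfx b v i (x, t)) :=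
    fun i => (cz i).comp (contDiff_id.prodMk contDiff_const)
  have e : ∀ x, pdE n (fun p => v p * flx b w p - w p * flx b v p) (eY n) (x, t) =
      - ∑ i, fderiv ℝ (fun x => v (x, t) * tfx b w i (x, t) - w (x, t) * tfx b v i (x, t)) x (Pi.single i 1) := by
    intro x
    have e1 : ∀ (u z : (Fin n → ℝ) × ℝ → ℝ), ContDiff ℝ (⊤ : ℕ∞) u → ContDiff ℝ (⊤ : ℕ∞) z → ∀ (a c : (Fin n → ℝ) × ℝ → ℝ),
        ContDiff ℝ (⊤ : ℕ∞) a → ContDiff ℝ (⊤ : ℕ∞) c → ∀ d, pdE n (fun p => u p * z p - a p * c p) d (x, t) =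
        (pdE n u d (x, t) * z (x, t) + u (x, t) * pdE n z d (x, t)) -
        (pdE n a d (x, t) * c (x, t) + a (x, t) * pdE n c d (x, t)) := by
      intro u z hu hz a c ha hc d
      unfold pdE
      rw [(((dfb hu (x, t)).hasFDerivAt.fun_mul (dfb hz (x, t)).hasFDerivAt).fun_sub
        ((dfb ha (x, t)).hasFDerivAt.fun_mul (dfb hc (x, t)).hasFDerivAt)).fderiv]
      simp only [add_apply, sub_apply, smul_apply, smul_eq_mul]
      ring
    have e2 : ∀ i, fderiv ℝ (fun x => v (x, t) * tfx b w i (x, t) - w (x, t) * tfx b v i (x, t)) x (Pi.single i 1)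
        = pdE n (fun p => v p * tfx b w i p - w p * tfx b v i p) (eX n i) (x, t) := fun i =>
      line_X (dfb (cz i)) x t i
    simp only [e2]
    rw [e1 v _ cv fw w _ cw fv]
    simp only [e1 v _ cv (tw _) w _ cw (tv _)]
    have pv := hv.pde (x, t) ht
    have pw := hw.pde (x, t) ht
    rw [eq_neg_of_add_eq_zero_left pv, eq_neg_of_add_eq_zero_left pw]
    have k1 : pdE n v (eY n) (x, t) * flx b w (x, t) - pdE n w (eY n) (x, t) * flx b v (x, t) =
        - ∑ i, (pdE n v (eX n i) (x, t) * tfx b w i (x, t) - pdE n w (eX n i) (x, t) * tfx b v i (x, t)) := by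
      unfold flx tfx
      rw [← Finset.sum_neg_distrib, mul_add, mul_add, Finset.mul_sum, Finset.mul_sum]
      have : ∑ i, -(pdE n v (eX n i) (x, t) * (pdE n w (eX n i) (x, t) + b i x * pdE n w (eY n) (x, t)) -
          pdE n w (eX n i) (x, t) * (pdE n v (eX n i) (x, t) + b i x * pdE n v (eY n) (x, t))) =
          ∑ i, pdE n v (eY n) (x, t) * (b i x * pdE n w (eX n i) (x, t)) -
          ∑ i, pdE n w (eY n) (x, t) * (b i x * pdE n v (eX n i) (x, t)) := by
        rw [← Finset.sum_sub_distrib]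
        exact Finset.sum_congr rfl fun i _ => by ring
      rw [this]; ring
    have k2 : ∑ i, (pdE n v (eX n i) (x, t) * tfx b w i (x, t) + v (x, t) * pdE n (tfx b w i) (eX n i) (x, t) -
        (pdE n w (eX n i) (x, t) * tfx b v i (x, t) + w (x, t) * pdE n (tfx b v i) (eX n i) (x, t))) =
        ∑ i, (pdE n v (eX n i) (x, t) * tfx b w i (x, t) - pdE n w (eX n i) (x, t) * tfx b v i (x, t)) +
        v (x, t) * ∑ i, pdE n (tfx b w i) (eX n i) (x, t) - w (x, t) * ∑ i, pdE n (tfx b v i) (eX n i) (x, t) := by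
      rw [Finset.mul_sum, Finset.mul_sum, ← Finset.sum_add_distrib, ← Finset.sum_sub_distrib]
      exact Finset.sum_congr rfl fun i _ => by ring
    rw [k2]
    linarith [k1]
  have h2 : ∫ x in cell n, pdE n (fun p => v p * flx b w p - w p * flx b v p) (eY n) (x, t) = 0 := by
    simp only [e]
    rw [integral_neg, integral_finset_sum]
    · rw [neg_eq_zero]
      refine Finset.sum_eq_zero fun i _ => ?_
      refine int_pd_zero ((cz' i).of_le (by simp)) (fun x k => ?_) i
      simp only [hv.per x t k, hw.per x t k, tfx_per hbp hv.per i x t k, tfx_per hbp hw.per i x t k]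
    · intro i _
      exact cont_intOn (pd_smooth (cz' i) _).continuous
  rw [h2] at h1
  exact h1

end green

section green2
variable {n : ℕ} {b : Fin n → (Fin n → ℝ) → ℝ}

lemma strip_meas : MeasurableSet (cell n ×ˢ Set.Ioi (0:ℝ)) := cell_meas.prod measurableSet_Ioi

lemma tfx_sq (hb : ∀ i, ContDiff ℝ (⊤ : ℕ∞) (b i)) {v : (Fin n → ℝ) × ℝ → ℝ} (hv : FH b v) (i) :
    IntegrableOn (fun p => tfx b v i p ^ 2) (cell n ×ˢ Set.Ioi (0:ℝ)) :=
  sq_comb (fun _ hp => hp.1) strip_meas (hb i).continuous (pdE_smooth hv.smooth _).continuous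
    (pdE_smooth hv.smooth _).continuous (hv.lX i) hv.lT

lemma flx_sq (hb : ∀ i, ContDiff ℝ (⊤ : ℕ∞) (b i)) {v : (Fin n → ℝ) × ℝ → ℝ} (hv : FH b v) :
    IntegrableOn (fun p => flx b v p ^ 2) (cell n ×ˢ Set.Ioi (0:ℝ)) := by
  have key : ∀ S : Finset (Fin n), IntegrableOn
      (fun p => (pdE n v (eY n) p + ∑ i ∈ S, b i p.1 * tfx b v i p) ^ 2) (cell n ×ˢ Set.Ioi (0:ℝ)) := by
    intro S
    induction S using Finset.induction_on with
    | empty => simpa using hv.lT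
    | insert i S hi ih =>
      have := sq_comb (fun _ hp => hp.1) strip_meas (hb i).continuous
        (f := fun p => pdE n v (eY n) p + ∑ i ∈ S, b i p.1 * tfx b v i p)
        ((pdE_smooth hv.smooth _).continuous.add (continuous_finset_sum _ fun j _ =>
          ((hb j).continuous.comp continuous_fst).mul (tfx_smooth hb hv.smooth j).continuous))
        (tfx_smooth hb hv.smooth i).continuous ih (tfx_sq hb hv i)
      refine this.congr_fun (fun p _ => ?_) strip_meas
      simp only [Finset.sum_insert hi]
      ring
  refine (key Finset.univ).congr_fun (fun p _ => ?_) strip_meas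
  simp only [flx_eq]

lemma growth_pt {v : (Fin n → ℝ) × ℝ → ℝ} (hv : ContDiff ℝ (⊤ : ℕ∞) v) (x : Fin n → ℝ) {t : ℝ} (ht : 0 ≤ t) :
    v (x, t) ^ 2 ≤ (1 + t) * (v (x, 0) ^ 2 + ∫ s in (0:ℝ)..t, pdE n v (eY n) (x, s) ^ 2) := by
  have hc : Continuous fun s : ℝ => pdE n v (eY n) (x, s) ^ 2 :=
    (((pdE_smooth hv _).continuous).comp (continuous_const.prodMk continuous_id)).pow 2
  set G : ℝ → ℝ := fun t => v (x, 0) ^ 2 + (∫ s in (0:ℝ)..t, pdE n v (eY n) (x, s) ^ 2) - v (x, t) ^ 2 / (1 + t) with hG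
  have hd : ∀ s, 0 ≤ s → HasDerivAt G ((pdE n v (eY n) (x, s) - v (x, s) / (1 + s)) ^ 2) s := by
    intro s hs
    have h1 := (hc.integral_hasStrictDerivAt 0 s).hasDerivAt
    have h2 := (line_T (dfb hv) x s)
    have h3 := ((h2.fun_pow 2).fun_div ((hasDerivAt_id s).const_add 1) (by simp; positivity))
    have h4 := (h1.const_add (v (x, 0) ^ 2)).fun_sub h3
    refine h4.congr_deriv ?_
    have : (1 + s) ≠ 0 := by positivity
    simp only [id]
    field_simp
    ring
  have hm : MonotoneOn G (Set.Ici 0) := by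
    refine monotoneOn_of_deriv_nonneg (convex_Ici 0) (fun s hs => (hd s hs).continuousAt.continuousWithinAt)
      (fun s hs => ?_) (fun s hs => ?_)
    · rw [interior_Ici] at hs
      exact (hd s (le_of_lt hs)).differentiableAt.differentiableWithinAt
    · rw [interior_Ici] at hs
      rw [(hd s (le_of_lt hs)).deriv]; positivity
  have := hm (Set.mem_Ici.2 le_rfl) (Set.mem_Ici.2 ht) ht
  simp only [hG] at this
  simp only [intervalIntegral.integral_same, add_zero, div_one, sub_self] at this
  have ht' : 0 < 1 + t := by positivity
  have h5 : v (x, t) ^ 2 / (1 + t) ≤ v (x, 0) ^ 2 + ∫ s in (0:ℝ)..t, pdE n v (eY n) (x, s) ^ 2 := by linarith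
  rw [div_le_iff₀ ht'] at h5
  linarith

lemma slice_cont {w : (Fin n → ℝ) × ℝ → ℝ} (hw : Continuous w) (t : ℝ) : Continuous fun x => w (x, t) :=
  hw.comp (continuous_id.prodMk continuous_const)

lemma growth {v : (Fin n → ℝ) × ℝ → ℝ} (hv : FH b v) :
    ∃ C, 0 ≤ C ∧ ∀ t, 0 ≤ t → ∫ x in cell n, v (x, t) ^ 2 ≤ (1 + t) * C := by
  set D := ∫ p in cell n ×ˢ Set.Ioi (0:ℝ), pdE n v (eY n) p ^ 2
  have cv := hv.smooth.continuous
  refine ⟨(∫ x in cell n, v (x, 0) ^ 2) + D, ?_, fun t ht => ?_⟩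
  · exact add_nonneg (integral_nonneg fun _ => sq_nonneg _) (integral_nonneg fun _ => sq_nonneg _)
  have hsub : cell n ×ˢ Set.Ioc 0 t ⊆ cell n ×ˢ Set.Ioi (0:ℝ) :=
    Set.prod_mono_right fun s hs => hs.1
  have hI : IntegrableOn (fun p => pdE n v (eY n) p ^ 2) (cell n ×ˢ Set.Ioc 0 t) := hv.lT.mono_set hsub
  have hI' : Integrable (fun p => pdE n v (eY n) p ^ 2)
      ((volume.restrict (cell n)).prod (volume.restrict (Set.Ioc 0 t))) := by
    rw [Measure.prod_restrict]; exact hI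
  have h1 : ∫ x in cell n, ∫ s in Set.Ioc 0 t, pdE n v (eY n) (x, s) ^ 2 ≤ D := by
    rw [← integral_prod _ hI', Measure.prod_restrict]
    exact setIntegral_mono_set hv.lT (Filter.Eventually.of_forall fun _ => sq_nonneg _)
      (Filter.Eventually.of_forall hsub)
  have h2 : IntegrableOn (fun x => ∫ s in Set.Ioc 0 t, pdE n v (eY n) (x, s) ^ 2) (cell n) :=
    hI'.integral_prod_left
  have h3 : IntegrableOn (fun x => v (x, 0) ^ 2) (cell n) := cont_intOn ((slice_cont cv 0).pow 2)
  calc ∫ x in cell n, v (x, t) ^ 2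
      ≤ ∫ x in cell n, (1 + t) * (v (x, 0) ^ 2 + ∫ s in Set.Ioc 0 t, pdE n v (eY n) (x, s) ^ 2) := by
        refine integral_mono (cont_intOn ((slice_cont cv t).pow 2)) ((h3.add h2).const_mul _) fun x => ?_
        have := growth_pt hv.smooth x ht
        rwa [intervalIntegral.integral_of_le ht] at this
    _ = (1 + t) * ((∫ x in cell n, v (x, 0) ^ 2) + ∫ x in cell n, ∫ s in Set.Ioc 0 t, pdE n v (eY n) (x, s) ^ 2) := by
        rw [integral_const_mul, integral_add h3 h2]
    _ ≤ _ := by gcongr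

lemma flux_slice (hb : ∀ i, ContDiff ℝ (⊤ : ℕ∞) (b i)) {v : (Fin n → ℝ) × ℝ → ℝ} (hv : FH b v) :
    IntegrableOn (fun t => ∫ x in cell n, flx b v (x, t) ^ 2) (Set.Ioi (0:ℝ)) := by
  have h := flx_sq hb hv
  have hI' : Integrable (fun p => flx b v p ^ 2)
      ((volume.restrict (cell n)).prod (volume.restrict (Set.Ioi (0:ℝ)))) := by
    rw [Measure.prod_restrict]; exact h
  exact hI'.integral_prod_right

theorem green (hb : ∀ i, ContDiff ℝ (⊤ : ℕ∞) (b i)) (hbp : ∀ i, ZPeriodic n (b i))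
    {v w : (Fin n → ℝ) × ℝ → ℝ} (hv : FH b v) (hw : FH b w) :
    ∫ x in cell n, (v (x, 0) * flx b w (x, 0) - w (x, 0) * flx b v (x, 0)) = 0 := by
  set F : ℝ → ℝ := fun t => ∫ x in cell n, (v (x, t) * flx b w (x, t) - w (x, t) * flx b v (x, t)) with hF
  have cv := hv.smooth
  have cw := hw.smooth
  have fv := flx_smooth hb cv
  have fw := flx_smooth hb cw
  have hcont : Continuous F := continuous_iff_continuousAt.2 fun t =>
    (cell_deriv (w := fun p => v p * flx b w p - w p * flx b v p) ((cv.mul fw).sub (cw.mul fv)) t).continuousAt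
  have hconst : ∀ t, 0 < t → F t = F 0 := by
    intro t ht
    obtain ⟨c, _, hc⟩ := exists_hasDerivAt_eq_slope F (fun _ => 0) ht hcont.continuousOn
      (fun s hs => green_deriv hb hbp hv hw hs.1)
    have : t - 0 ≠ 0 := by simpa using ht.ne'
    rw [eq_comm, div_eq_zero_iff] at hc
    rcases hc with hc | hc
    · linarith
    · exact absurd hc this
  obtain ⟨C1, hC1, h1⟩ := growth hv
  obtain ⟨C2, hC2, h2⟩ := growth hw
  have gv := flux_slice hb hv
  have gw := flux_slice hb hw
  by_contra hne
  change F 0 ≠ 0 at hne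
  have hA : 0 < |F 0| := abs_pos.2 hne
  set A := |F 0|
  set δ := A / (2 * (C1 + C2 + 1)) with hδ
  have hδ0 : 0 < δ := by positivity
  have hδC : δ * (C1 + C2) ≤ A / 2 := by
    rw [hδ, div_mul_eq_mul_div, div_le_div_iff₀ (by positivity) (by positivity)]
    nlinarith
  have bound : ∀ t, 0 < t → A ≤ δ * (C1 + C2) + (1 + t) / δ *
      ((∫ x in cell n, flx b v (x, t) ^ 2) + ∫ x in cell n, flx b w (x, t) ^ 2) := by
    intro t ht
    have ht1 : 0 < 1 + t := by positivity
    have i1 : IntegrableOn (fun x => v (x, t) ^ 2) (cell n) := cont_intOn ((slice_cont cv.continuous t).pow 2)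
    have i2 : IntegrableOn (fun x => w (x, t) ^ 2) (cell n) := cont_intOn ((slice_cont cw.continuous t).pow 2)
    have i3 : IntegrableOn (fun x => flx b v (x, t) ^ 2) (cell n) := cont_intOn ((slice_cont fv.continuous t).pow 2)
    have i4 : IntegrableOn (fun x => flx b w (x, t) ^ 2) (cell n) := cont_intOn ((slice_cont fw.continuous t).pow 2)
    have j1 : IntegrableOn (fun x => δ / (1 + t) * (v (x, t) ^ 2 + w (x, t) ^ 2)) (cell n) :=
      (i1.add i2).const_mul _
    have j2 : IntegrableOn (fun x => (1 + t) / δ * (flx b v (x, t) ^ 2 + flx b w (x, t) ^ 2)) (cell n) :=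
      (i3.add i4).const_mul _
    have hle : |F t| ≤ ∫ x in cell n, (δ / (1 + t) * (v (x, t) ^ 2 + w (x, t) ^ 2) +
        (1 + t) / δ * (flx b v (x, t) ^ 2 + flx b w (x, t) ^ 2)) := by
      rw [← Real.norm_eq_abs]
      refine norm_integral_le_of_norm_le (j1.add j2)
        (Filter.Eventually.of_forall fun x => ?_)
      rw [Real.norm_eq_abs]
      have hy : ∀ a c : ℝ, |a * c| ≤ δ / (1 + t) * a ^ 2 + (1 + t) / δ * c ^ 2 := by
        intro a c
        set e := δ / (1 + t) with he
        have he0 : 0 < e := by positivity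
        have : (1 + t) / δ = e⁻¹ := by rw [he, inv_div]
        rw [this, abs_mul]
        have h3 : 0 ≤ e⁻¹ * (e * |a| - |c|) ^ 2 := by positivity
        have h4 : e⁻¹ * (e * |a| - |c|) ^ 2 = e * a ^ 2 + e⁻¹ * c ^ 2 - 2 * (|a| * |c|) := by
          rw [← sq_abs a, ← sq_abs c]; field_simp; ring
        have := mul_nonneg (abs_nonneg a) (abs_nonneg c)
        linarith
      have := abs_sub (v (x, t) * flx b w (x, t)) (w (x, t) * flx b v (x, t))
      have ha := hy (v (x, t)) (flx b w (x, t))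
      have hb := hy (w (x, t)) (flx b v (x, t))
      linarith
    rw [hconst t ht] at hle
    rw [integral_add j1 j2, integral_const_mul, integral_const_mul,
      integral_add i1 i2, integral_add i3 i4] at hle
    have h3 := h1 t ht.le
    have h4 := h2 t ht.le
    have h5 : δ / (1 + t) * ((∫ x in cell n, v (x, t) ^ 2) + ∫ x in cell n, w (x, t) ^ 2) ≤ δ * (C1 + C2) := by
      calc _ ≤ δ / (1 + t) * ((1 + t) * C1 + (1 + t) * C2) := by gcongr
        _ = _ := by field_simp
    linarith
  apply not_integrableOn_Ioi_inv (a := (1:ℝ))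
  have hg := ((gv.add gw).mono_set (Set.Ioi_subset_Ioi (zero_le_one' ℝ))).const_mul (4 / (δ * A))
  refine hg.mono' (measurable_inv.aestronglyMeasurable) ?_
  filter_upwards [ae_restrict_mem measurableSet_Ioi] with t ht
  have ht1 : (1:ℝ) < t := ht
  have ht0 : 0 < t := by linarith
  have hb1 := bound t ht0
  simp only [Pi.add_apply]
  rw [Real.norm_of_nonneg (by positivity)]
  have hg0 : 0 ≤ (∫ x in cell n, flx b v (x, t) ^ 2) + ∫ x in cell n, flx b w (x, t) ^ 2 :=
    add_nonneg (integral_nonneg fun _ => sq_nonneg _) (integral_nonneg fun _ => sq_nonneg _)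
  set g := (∫ x in cell n, flx b v (x, t) ^ 2) + ∫ x in cell n, flx b w (x, t) ^ 2
  have hb2 : A / 2 ≤ (2 * t) / δ * g := by
    have : (1 + t) / δ * g ≤ (2 * t) / δ * g := by gcongr; linarith
    linarith
  rw [div_mul_eq_mul_div, le_div_iff₀ hδ0] at hb2
  rw [div_mul_eq_mul_div, le_div_iff₀ (by positivity), inv_mul_le_iff₀ ht0]
  linarith

end green2

section final
variable {n : ℕ} {h ψ : (Fin n → ℝ) → ℝ} {φ : (Fin n → ℝ) × ℝ → ℝ}

lemma shr_tfx (hh : ContDiff ℝ (⊤ : ℕ∞) h) (hφ : ContDiff ℝ (⊤ : ℕ∞) φ) (i) (p) :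
    tfx (pdX n h) (fun p => φ (shr h p)) i p = pdE n φ (eX n i) (shr h p) := by
  have hd : Differentiable ℝ h := hh.differentiable (by simp)
  unfold tfx
  rw [pdX_shr hd (dfb hφ), pdY_shr hd (dfb hφ)]; ring

lemma ext_FH (hh : ContDiff ℝ (⊤ : ℕ∞) h) (hhp : ZPeriodic n h) (H : IsHarmonicExt n h ψ φ) :
    FH (pdX n h) (fun p => φ (shr h p)) := by
  have hd : Differentiable ℝ h := hh.differentiable (by simp)
  have hφ := H.smooth
  have hu : ContDiff ℝ (⊤ : ℕ∞) (fun p => φ (shr h p)) := hφ.comp (shr_smooth hh)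
  have hS : ∀ v, IntegrableOn (fun p => pdE n φ v p ^ 2) (fluidCell n h) →
      IntegrableOn (fun p => pdE n φ v (shr h p) ^ 2) (cell n ×ˢ Set.Ioi (0:ℝ)) := fun v hv =>
    shr_int' hh.continuous hv
  have hY : IntegrableOn (fun p => pdE n φ (eY n) p ^ 2) (fluidCell n h) := by
    refine H.gradL2.mono' ((pdE_smooth hφ _).continuous.pow 2).aestronglyMeasurable
      (Filter.Eventually.of_forall fun p => ?_)
    rw [Real.norm_of_nonneg (sq_nonneg _)]
    unfold gradSqE
    have : 0 ≤ ∑ i, pdE n φ (eX n i) p ^ 2 := Finset.sum_nonneg fun _ _ => sq_nonneg _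
    linarith
  have hX : ∀ i, IntegrableOn (fun p => pdE n φ (eX n i) p ^ 2) (fluidCell n h) := by
    intro i
    refine H.gradL2.mono' ((pdE_smooth hφ _).continuous.pow 2).aestronglyMeasurable
      (Filter.Eventually.of_forall fun p => ?_)
    rw [Real.norm_of_nonneg (sq_nonneg _)]
    unfold gradSqE
    have := Finset.single_le_sum (f := fun i => pdE n φ (eX n i) p ^ 2) (fun _ _ => sq_nonneg _) (Finset.mem_univ i)
    have h2 := sq_nonneg (pdE n φ (eY n) p)
    linarith
  have cs : Continuous (shr h) := (shr_smooth hh).continuous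
  refine ⟨hu, ?_, ?_, ?_, ?_⟩
  · intro x y k
    simp only [shr, hhp x k, H.periodic x (h x - y) k]
  · intro p hp
    have := lap_shr hh hu (shr h p)
    rw [shr_shr] at this
    rw [← this]
    simp only [shr_shr]
    refine H.harmonic _ ?_
    simp only [shr]; linarith
  · refine (hS _ hY).congr_fun (fun p _ => ?_) strip_meas
    simp only [pdY_shr hd (dfb hφ)]; ring
  · intro i
    refine (sq_comb (fun _ hp => hp.1) strip_meas (pd_smooth hh (Pi.single i 1)).continuous
      ((pdE_smooth hφ _).continuous.comp cs) ((pdE_smooth hφ _).continuous.comp cs) (hS _ (hX i)) (hS _ hY)).congr_fun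
      (fun p _ => ?_) strip_meas
    simp only [pdX_shr hd (dfb hφ)]
    rfl

lemma ext_zero (H : IsHarmonicExt n h ψ φ) (x) : φ (shr h (x, 0)) = ψ x := by
  simp [shr, H.boundary]

/-- the two boundary operators in the flattened picture -/
lemma ops (hh : ContDiff ℝ (⊤ : ℕ∞) h) (hhp : ZPeriodic n h) (hψ : ContDiff ℝ (⊤ : ℕ∞) ψ) (hψp : ZPeriodic n ψ) :
    ∃ v, FH (pdX n h) v ∧ (∀ x, v (x, 0) = ψ x) ∧ (∀ x, DtN n h ψ x = - flx (pdX n h) v (x, 0)) ∧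
      ∀ x, (1 + ∑ i, pdX n h i x ^ 2) * Bop n h ψ x = - flx (pdX n h) v (x, 0) + ∑ i, pdX n h i x * pdX n ψ i x := by
  have hd : Differentiable ℝ h := hh.differentiable (by simp)
  have E := harm_exists hh hhp hψ hψp
  have H := E.choose_spec
  have hF := ext_FH hh hhp H
  have s0 : ∀ x, shr h (x, 0) = (x, h x) := fun x => by simp [shr]
  refine ⟨_, hF, ext_zero H, fun x => ?_, fun x => ?_⟩
  · unfold DtN
    rw [dif_pos E, flx_eq]
    simp only [shr_tfx hh H.smooth, pdY_shr hd (dfb H.smooth), s0]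
    ring
  · unfold Bop
    rw [dif_pos E]
    have hx : ∀ i, pdE n (fun p => E.choose (shr h p)) (eX n i) (x, 0) = pdX n ψ i x := by
      intro i
      rw [← line_X (dfb hF.smooth) x 0 i]
      unfold pdX
      congr 2
      funext z
      exact ext_zero H z
    unfold flx
    simp only [hx, pdY_shr hd (dfb H.smooth), s0]
    ring

end final

theorem Bop_adjoint (n : ℕ) (hn : 1 ≤ n) (h ψ χ : (Fin n → ℝ) → ℝ)
    (hh : ContDiff ℝ (⊤ : ℕ∞) h) (hhper : ZPeriodic n h)
    (hψ : ContDiff ℝ (⊤ : ℕ∞) ψ) (hψper : ZPeriodic n ψ)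
    (hχ : ContDiff ℝ (⊤ : ℕ∞) χ) (hχper : ZPeriodic n χ) :
    ∫ x in cell n, Bop n h ψ x * χ x
      = ∫ x in cell n, ψ x *
          ( DtN n h (fun z => χ z / (1 + ∑ i, (pdX n h i z)^2)) x
            - divX n (fun z i => (χ z / (1 + ∑ j, (pdX n h j z)^2)) * pdX n h i z) x ) := by
  have hb : ∀ i, ContDiff ℝ (⊤ : ℕ∞) (pdX n h i) := fun i => pd_smooth hh _
  have hbp : ∀ i, ZPeriodic n (pdX n h i) := fun i => pd_per hhper _
  have ha : ∀ x, 0 < 1 + ∑ i, pdX n h i x ^ 2 := fun x => by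
    have : 0 ≤ ∑ i, pdX n h i x ^ 2 := Finset.sum_nonneg fun _ _ => sq_nonneg _
    linarith
  set ρ : (Fin n → ℝ) → ℝ := fun z => χ z / (1 + ∑ i, (pdX n h i z)^2) with hρ
  have cρ : ContDiff ℝ (⊤ : ℕ∞) ρ := hχ.div (contDiff_const.add (ContDiff.sum fun i _ => (hb i).pow 2))
    fun x => (ha x).ne'
  have pρ : ZPeriodic n ρ := fun x k => by
    simp only [hρ, hχper x k, hbp _ x k]
  obtain ⟨v, hv, v0, -, vB⟩ := ops hh hhper hψ hψper
  obtain ⟨w, hw, w0, wG, -⟩ := ops hh hhper cρ pρ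
  have G := green hb hbp hv hw
  simp only [v0, w0] at G
  have fv := (slice_cont (flx_smooth hb hv.smooth).continuous 0)
  have fw := (slice_cont (flx_smooth hb hw.smooth).continuous 0)
  have cT : ∀ i, ContDiff ℝ (⊤ : ℕ∞) (fun z => ψ z * (ρ z * pdX n h i z)) := fun i => hψ.mul (cρ.mul (hb i))
  have cR : ∀ i, ContDiff ℝ (⊤ : ℕ∞) (fun z => ρ z * pdX n h i z) := fun i => cρ.mul (hb i)
  have T : ∫ x in cell n, ∑ i, pdX n (fun z => ψ z * (ρ z * pdX n h i z)) i x = 0 := by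
    rw [integral_finset_sum]
    · refine Finset.sum_eq_zero fun i _ => ?_
      refine int_pd_zero ((cT i).of_le (by simp)) (fun x k => ?_) i
      simp only [hψper x k, pρ x k, hbp i x k]
    · intro i _
      exact cont_intOn (pd_smooth (cT i) _).continuous
  have hdT : ∀ i x, pdX n (fun z => ψ z * (ρ z * pdX n h i z)) i x =
      ψ x * pdX n (fun z => ρ z * pdX n h i z) i x + ρ x * pdX n h i x * pdX n ψ i x := by
    intro i x
    change fderiv ℝ (fun z => ψ z * (ρ z * pdX n h i z)) x (Pi.single i 1) =
      ψ x * fderiv ℝ (fun z => ρ z * pdX n h i z) x (Pi.single i 1) +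
        ρ x * pdX n h i x * fderiv ℝ ψ x (Pi.single i 1)
    rw [((hψ.differentiable (by simp) x).hasFDerivAt.fun_mul
      ((cR i).differentiable (by simp) x).hasFDerivAt).fderiv]
    simp only [add_apply, smul_apply, smul_eq_mul]
  have iT : IntegrableOn (fun x => ∑ i, pdX n (fun z => ψ z * (ρ z * pdX n h i z)) i x) (cell n) :=
    cont_intOn (continuous_finset_sum _ fun i _ => (pd_smooth (cT i) _).continuous)
  have iG : IntegrableOn (fun x => ψ x * flx (pdX n h) w (x, 0) - ρ x * flx (pdX n h) v (x, 0)) (cell n) :=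
    cont_intOn ((hψ.continuous.mul fw).sub (cρ.continuous.mul fv))
  have iD : IntegrableOn (fun x => ψ x * (- flx (pdX n h) w (x, 0) - divX n (fun z i => ρ z * pdX n h i z) x)) (cell n) :=
    cont_intOn (hψ.continuous.mul (fw.neg.sub (continuous_finset_sum _ fun i _ => (pd_smooth (cR i) _).continuous)))
  have e : ∀ x, Bop n h ψ x * χ x = ψ x * (- flx (pdX n h) w (x, 0) - divX n (fun z i => ρ z * pdX n h i z) x)
      + ((ψ x * flx (pdX n h) w (x, 0) - ρ x * flx (pdX n h) v (x, 0)) +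
        ∑ i, pdX n (fun z => ψ z * (ρ z * pdX n h i z)) i x) := by
    intro x
    have hχρ : χ x = ρ x * (1 + ∑ i, pdX n h i x ^ 2) := by
      simp only [hρ]; rw [div_mul_cancel₀ _ (ha x).ne']
    simp only [hdT]
    rw [hχρ, Finset.sum_add_distrib, ← Finset.mul_sum]
    have := vB x
    have h2 : ∑ i, ρ x * pdX n h i x * pdX n ψ i x = ρ x * ∑ i, pdX n h i x * pdX n ψ i x := by
      rw [Finset.mul_sum]; exact Finset.sum_congr rfl fun i _ => by ring
    rw [h2]
    unfold divX
    calc _ = ρ x * ((1 + ∑ i, pdX n h i x ^ 2) * Bop n h ψ x) := by ring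
      _ = _ := by rw [this]; ring
  simp only [e, wG]
  have iGT : IntegrableOn (fun x => (ψ x * flx (pdX n h) w (x, 0) - ρ x * flx (pdX n h) v (x, 0)) +
      ∑ i, pdX n (fun z => ψ z * (ρ z * pdX n h i z)) i x) (cell n) := iG.add iT
  rw [integral_add iD iGT, integral_add iG iT, G, T, add_zero, add_zero]

end
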